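/- Let n = 2m be even, 1 ≤ k ≤ m−1, and 1 ≤ j ≤ binom(n,2). For every e ≥ 1, the morphism Ext^j_S(𝒩_{k,e}, S) → Ext^j_S(𝒩_{k−1,e}, S) induced by the inclusion 𝒩_{k−1,e} ⊆ 𝒩_{k,e} is the zero map. -/

import Mathlib

/-!
Common setup: the polynomial ring `S = ℂ[x_{i,j}]` of the space
`X = ⋀² (ℂⁿ)*` of `n × n` complex skew-symmetric matrices, Pfaffians, the
`GL_n(ℂ)`-action, invariant ideals, Pfaffian varieties and their (radical)
vanishing ideals, local cohomology (Mathlib's `localCohomology`), the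
localization `S_Pf`, 𝒟-module spans in `S_Pf` (via the partial derivatives,
extended to `S_Pf` as derivations), Gaussian binomial coefficients, and
injective-hull data for `E = E(ℂ)`.
-/

open scoped BigOperators

noncomputable section

namespace SkewLC

/-- Indices `(i,j)` with `i < j`, labelling the variables `x_{i,j}`. -/
abbrev SkewIdx (n : ℕ) := {p : Fin n × Fin n // p.1 < p.2}

/-- `S = Sym(⋀² ℂ^n) ≅ ℂ[x_{i,j} : 1 ≤ i < j ≤ n]`. -/
abbrev PS (n : ℕ) := MvPolynomial (SkewIdx n) ℂ

/-- The `(i,j)` entry of the generic skew-symmetric matrix `(x_{i,j})`. -/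
def genEntry (n : ℕ) (i j : Fin n) : PS n :=
  if h : i < j then MvPolynomial.X ⟨(i, j), h⟩
  else if h' : j < i then - MvPolynomial.X ⟨(j, i), h'⟩
  else 0

/-- The Pfaffian of the principal `2r × 2r` block of the generic skew-symmetric
matrix (zero by convention if `2r > n`):
`Pf_r = (1/(2^r r!)) ∑_σ sign(σ) ∏_i x_{σ(2i-1) σ(2i)}`. -/
def pfBlock (n r : ℕ) : PS n :=
  if h : 2 * r ≤ n then
    (((2 ^ r * r.factorial : ℕ) : ℂ))⁻¹ •
      ∑ σ : Equiv.Perm (Fin (2 * r)),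
        (Equiv.Perm.sign σ : ℤ) •
          ∏ i : Fin r,
            genEntry n (Fin.castLE h (σ ⟨2 * i.1, by have := i.isLt; omega⟩))
              (Fin.castLE h (σ ⟨2 * i.1 + 1, by have := i.isLt; omega⟩))
  else 0

/-- The full `n × n` Pfaffian `Pf` (for `n` even). -/
def pfaffian (n : ℕ) : PS n := pfBlock n (n / 2)

/-- The action of an `n × n` matrix `g` on `S`, sending the generic
skew-symmetric matrix `X` to `g X gᵀ` (on variables,
`x_{ij} ↦ ∑_{a,b} g_{ia} g_{jb} x_{ab}`).  Restricted to invertible `g` this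
is the natural action of `GL_n(ℂ)` on `S`. -/
def glMap (n : ℕ) (g : Matrix (Fin n) (Fin n) ℂ) : PS n →ₐ[ℂ] PS n :=
  MvPolynomial.aeval fun p : SkewIdx n =>
    ∑ a : Fin n, ∑ b : Fin n, (g p.1.1 a * g p.1.2 b) • genEntry n a b

/-- `z : ℕ → ℕ` is a partition with at most `m` nonzero parts, recorded as the
(0-indexed) weakly decreasing sequence `z 0 ≥ z 1 ≥ ⋯`; so `z i` is the
`(i+1)`-st part `z_{i+1}` of the partition. -/
def IsPartition (m : ℕ) (z : ℕ → ℕ) : Prop :=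
  (∀ i j, i ≤ j → z j ≤ z i) ∧ ∀ i, m ≤ i → z i = 0

/-- The rectangular partition `a × b` (`a` parts equal to `b`). -/
def rect (a b : ℕ) : ℕ → ℕ := fun i => if i < a then b else 0

/-- The highest weight vector of the irreducible summand
`𝕊_{z^{(2)}} W ⊆ S`: the product `∏_i Pf_i^{z_i - z_{i+1}}` of powers of the
principal `2i × 2i` Pfaffians. -/
def hwVector (n : ℕ) (z : ℕ → ℕ) : PS n :=
  ∏ i ∈ Finset.range (n / 2), pfBlock n (i + 1) ^ (z i - z (i + 1))

/-- The `GL_n(ℂ)`-invariant ideal `I_z ⊆ S` generated by the irreducible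
subrepresentation `𝕊_{z^{(2)}} W` of `S`; since that irreducible is spanned by
the `GL`-orbit of its highest weight vector, `I_z` is the ideal generated by
the `GL_n(ℂ)`-orbit of `hwVector n z`. -/
def invIdeal (n : ℕ) (z : ℕ → ℕ) : Ideal (PS n) :=
  Ideal.span {f | ∃ g : Matrix.GeneralLinearGroup (Fin n) ℂ,
    f = glMap n g.val (hwVector n z)}

/-- The Pfaffian variety `O̅_k`: skew-symmetric `n × n` matrices of rank `≤ 2k`. -/
def rankVariety (n k : ℕ) : Set (Matrix (Fin n) (Fin n) ℂ) :=
  {A | A.transpose = -A ∧ A.rank ≤ 2 * k}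

/-- Evaluation of a polynomial in `S` at a matrix. -/
def evalMat (n : ℕ) (A : Matrix (Fin n) (Fin n) ℂ) : PS n →+* ℂ :=
  (MvPolynomial.aeval fun p : SkewIdx n => A p.1.1 p.1.2).toRingHom

/-- The (radical) vanishing ideal of the Pfaffian variety `O̅_k`; local
cohomology with support in `O̅_k` is local cohomology at this ideal. -/
def varIdeal (n k : ℕ) : Ideal (PS n) :=
  ⨅ A ∈ rankVariety n k, RingHom.ker (evalMat n A)

/-- The homogeneous maximal ideal `𝔪 ⊆ S` (the vanishing ideal of the origin);
`H^j_{{0}}(-) = H^j_𝔪(-)`. -/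
def mIdeal (n : ℕ) : Ideal (PS n) :=
  RingHom.ker (evalMat n 0)

/-- The Gaussian binomial coefficient evaluated at `q^e`,
`binom(a,b)_{q^e} ∈ ℤ[q] ⊆ ℚ[q]`, where
`binom(a,b)_q = ∏_{i=1}^{b} (1 - q^{a-b+i})/(1 - q^i)`.
(The polynomial division below is exact.) -/
def gaussBinom (a b e : ℕ) : Polynomial ℚ :=
  (∏ i ∈ Finset.range b, (1 - Polynomial.X ^ (e * (a - b + i + 1)))) /
    (∏ i ∈ Finset.range b, (1 - Polynomial.X ^ (e * (i + 1))))

/-- Data exhibiting `E` as the injective hull of `ℂ = S/𝔪` over `S`: an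
injective `S`-module together with an essential embedding of `S/𝔪`. -/
structure InjHullData (n : ℕ) where
  /-- the underlying module -/
  E : Type
  [addCommGroup : AddCommGroup E]
  [module : Module (PS n) E]
  injective : Module.Injective (PS n) E
  emb : (PS n ⧸ mIdeal n) →ₗ[PS n] E
  emb_injective : Function.Injective emb
  essential : ∀ N : Submodule (PS n) E, N ≠ ⊥ → N ⊓ LinearMap.range emb ≠ ⊥

attribute [instance] InjHullData.addCommGroup InjHullData.module

/-- `S_Pf`, the localization of `S` at the Pfaffian. -/
abbrev SPf (n : ℕ) : Type := Localization.Away (pfaffian n)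

/-- `Pf⁻¹ ∈ S_Pf`. -/
def pfInv (n : ℕ) : SPf n := IsLocalization.Away.invSelf (S := SPf n) (pfaffian n)

/-- An `S`-submodule of `S_Pf` is a `𝒟_X`-submodule iff it is stable under the
partial derivatives `∂/∂x_{ij}` (extended to `S_Pf`, as the family `δ`). -/
def DStable (n : ℕ) (δ : SkewIdx n → Derivation ℂ (SPf n) (SPf n))
    (N : Submodule (PS n) (SPf n)) : Prop :=
  ∀ p : SkewIdx n, ∀ x ∈ N, δ p x ∈ N

/-- `⟨v⟩_𝒟 ⊆ S_Pf`, the `𝒟_X`-submodule of `S_Pf` generated by `v`: the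
smallest `S`-submodule containing `v` and stable under all partial
derivatives. -/
def dSpan (n : ℕ) (δ : SkewIdx n → Derivation ℂ (SPf n) (SPf n)) (v : SPf n) :
    Submodule (PS n) (SPf n) :=
  sInf {N : Submodule (PS n) (SPf n) | v ∈ N ∧ DStable n δ N}

/-- The statement that `δ` is the family of partial derivatives `∂/∂x_{ij}` of
`S` extended to derivations of `S_Pf` (such an extension exists and is
unique). -/
def IsDerivExtension (n : ℕ) (δ : SkewIdx n → Derivation ℂ (SPf n) (SPf n)) : Prop :=
  ∀ (p : SkewIdx n) (f : PS n),
    δ p (algebraMap (PS n) (SPf n) f) = algebraMap (PS n) (SPf n) (MvPolynomial.pderiv p f)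

/-- For `n = 2m` and `0 ≤ p ≤ m - 1`, the indecomposable equivariant
`𝒟_X`-module `Q_p = S_Pf / ⟨Pf^{2(p-m+1)}⟩_𝒟 = S_Pf / ⟨Pf^{-2(m-1-p)}⟩_𝒟`. -/
abbrev QMod (n : ℕ) (δ : SkewIdx n → Derivation ℂ (SPf n) (SPf n)) (p : ℕ) :=
  SPf n ⧸ dSpan n δ (pfInv n ^ (2 * (n / 2 - 1 - p)))

/-- The `S`-submodule `𝒩_{k,e} = I_{(m-k) × e} ⊗_S 𝒫_{-e-2k} ⊆ S_Pf`
(`m = n/2`), i.e. the image of the invariant ideal `I_{(m-k) × e}` under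
multiplication by `Pf^{-e-2k}`. -/
def NMod (n k e : ℕ) : Submodule (PS n) (SPf n) :=
  Submodule.map
    ((LinearMap.mulLeft (PS n) (pfInv n ^ (e + 2 * k))).comp
      (Algebra.linearMap (PS n) (SPf n)))
    (invIdeal n (rect (n / 2 - k) e))

/-- The set `succ(z, l, m)` of partitions obtained from `z` by adding boxes in
row `l + 1` or higher (rows recorded 0-indexed: `y i > z i` for some
`l ≤ i < m`). -/
def succSet (m : ℕ) (z : ℕ → ℕ) (l : ℕ) : Set (ℕ → ℕ) :=
  {y | IsPartition m y ∧ (∀ i, z i ≤ y i) ∧ ∃ i, l ≤ i ∧ i < m ∧ z i < y i}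

/-- The ideal `I_{succ(z,l,m)} = ∑_{y ∈ succ(z,l,m)} I_y`. -/
def succIdeal (n : ℕ) (z : ℕ → ℕ) (l : ℕ) : Ideal (PS n) :=
  ⨆ y ∈ succSet (n / 2) z l, invIdeal n y

/-- The subquotient `J_{z,l} = I_z / I_{succ(z,l,m)}` of `S` (`m = n/2`). -/
abbrev JMod (n : ℕ) (z : ℕ → ℕ) (l : ℕ) :=
  ↥(invIdeal n z) ⧸
    Submodule.comap (invIdeal n z : Submodule (PS n) (PS n)).subtype
      (succIdeal n z l : Submodule (PS n) (PS n))

end SkewLC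

namespace SkewLC
namespace Cech

/-- Laurent polynomials in the variables `σ`. -/
abbrev Lau (σ : Type) := AddMonoidAlgebra ℂ (σ → ℤ)

/-- The polynomial ring. -/
abbrev Pol (σ : Type) := MvPolynomial σ ℂ

section basics
variable {σ : Type}

/-- Laurent monomial. -/
def mon (a : σ → ℤ) : Lau σ := AddMonoidAlgebra.single a 1

lemma mon_mul (a b : σ → ℤ) : mon a * mon b = mon (a + b) := by
  simp [mon, AddMonoidAlgebra.single_mul_single]

lemma mon_zero : mon (0 : σ → ℤ) = 1 := rfl

lemma mon_pow (a : σ → ℤ) (h : ℕ) : mon a ^ h = mon ((h : ℤ) • a) := by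
  simp [mon, AddMonoidAlgebra.single_pow]

lemma mon_mul_neg (a : σ → ℤ) : mon a * mon (-a) = 1 := by
  rw [mon_mul, add_neg_cancel, mon_zero]

lemma smul_mon (a : σ → ℤ) (c : ℂ) : c • mon a = AddMonoidAlgebra.single a c := by
  simp [mon]

lemma coeff_mon_mul (a b : σ → ℤ) (f : Lau σ) : (mon a * f).coeff b = f.coeff (b - a) := by
  rw [mon, AddMonoidAlgebra.coeff_single_mul_apply]; simp [neg_add_eq_sub]

lemma lau_ind {motive : Lau σ → Prop} (x : Lau σ) (h0 : motive 0)
    (hadd : ∀ x y, motive x → motive y → motive (x + y))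
    (hm : ∀ a (c : ℂ), motive (c • mon a)) : motive x :=
  AddMonoidAlgebra.induction_linear x h0 hadd (fun a c => by rw [← smul_mon]; exact hm a c)

/-- exponents inclusion -/
def expHom (σ : Type) : (σ →₀ ℕ) →+ (σ → ℤ) where
  toFun a := fun p => (a p : ℤ)
  map_zero' := by ext; simp
  map_add' := by intro a b; ext; simp

lemma expHom_inj : Function.Injective (expHom σ) := by
  intro a b h
  ext p
  have := congrFun h p
  simpa [expHom] using this

/-- Polynomials into Laurent polynomials. -/
def toL (σ : Type) : Pol σ →ₐ[ℂ] Lau σ := AddMonoidAlgebra.mapDomainAlgHom ℂ ℂ (expHom σ)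

lemma toL_apply (f : Pol σ) : toL σ f = AddMonoidAlgebra.mapDomain (expHom σ) f := rfl

lemma toL_inj : Function.Injective (toL σ) := AddMonoidAlgebra.mapDomain_injective expHom_inj

lemma toL_monomial (a : σ →₀ ℕ) (c : ℂ) :
    toL σ (MvPolynomial.monomial a c) = c • mon (expHom σ a) := by
  rw [smul_mon, toL_apply, ← MvPolynomial.single_eq_monomial, AddMonoidAlgebra.mapDomain_single]

lemma toL_coeff (f : Pol σ) (a : σ →₀ ℕ) : (toL σ f).coeff (expHom σ a) = MvPolynomial.coeff a f := by
  rw [toL_apply, AddMonoidAlgebra.coeff_mapDomain, Finsupp.mapDomain_apply expHom_inj]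
  rfl

lemma toL_coeff_nonneg (f : Pol σ) (b : σ → ℤ) (h : (toL σ f).coeff b ≠ 0) (p : σ) : 0 ≤ b p := by
  by_contra hn
  apply h
  rw [toL_apply, AddMonoidAlgebra.coeff_mapDomain, Finsupp.mapDomain_of_notMem_range]
  rintro ⟨a, rfl⟩
  apply hn
  simp [expHom]

instance : Algebra (Pol σ) (Lau σ) := (toL σ).toRingHom.toAlgebra

lemma smul_def' (f : Pol σ) (g : Lau σ) : f • g = toL σ f * g := rfl

lemma algMap_eq (f : Pol σ) : algebraMap (Pol σ) (Lau σ) f = toL σ f := rfl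

instance : IsScalarTower ℂ (Pol σ) (Lau σ) :=
  IsScalarTower.of_algebraMap_eq (fun c => by
    rw [algMap_eq]; exact ((toL σ).commutes c).symm)

end basics

section fin
variable {σ : Type} [Fintype σ] [DecidableEq σ]

lemma mon_mem_range (b : σ → ℤ) (hb : ∀ p, 0 ≤ b p) : ∃ f : Pol σ, toL σ f = mon b := by
  refine ⟨MvPolynomial.monomial (Finsupp.equivFunOnFinite.symm fun p => (b p).toNat) 1, ?_⟩
  rw [toL_monomial, one_smul]
  congr 1
  ext p
  simp [expHom, hb p]

lemma mem_range_toL (f : Lau σ) : (∃ g : Pol σ, toL σ g = f) ↔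
    ∀ b, f.coeff b ≠ 0 → ∀ p, 0 ≤ b p := by
  constructor
  · rintro ⟨g, rfl⟩ b hb p
    exact toL_coeff_nonneg g b hb p
  · intro h
    have : f = ∑ b ∈ f.coeff.support, f.coeff b • mon b := by
      conv_lhs => rw [← AddMonoidAlgebra.sum_coeff_single f]
      rw [Finsupp.sum]
      exact Finset.sum_congr rfl (fun b _ => (smul_mon b _).symm)
    rw [this]
    have h2 : (∑ b ∈ f.coeff.support, f.coeff b • mon b) ∈ (toL σ).range := by
      refine Subalgebra.sum_mem _ fun b hb => Subalgebra.smul_mem _ ?_ _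
      exact mon_mem_range b (h b (by simpa using hb))
    exact h2

/-- indicator exponent -/
def ind (A : Finset σ) : σ → ℤ := fun p => if p ∈ A then 1 else 0

/-- product of the variables in `A` -/
def XA (A : Finset σ) : Pol σ := ∏ p ∈ A, MvPolynomial.X p

lemma toL_X (p : σ) : toL σ (MvPolynomial.X p) = mon (Pi.single p 1) := by
  rw [MvPolynomial.X, toL_monomial, one_smul]
  congr 1
  ext q
  by_cases h : p = q
  · subst h; simp [expHom]
  · simp [expHom, h, Pi.single_apply, Ne.symm h, Finsupp.single_apply]

lemma mon_sum {ι : Type} (s : Finset ι) (a : ι → σ → ℤ) : mon (∑ i ∈ s, a i) = ∏ i ∈ s, mon (a i) := by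
  classical
  induction s using Finset.induction_on with
  | empty => simp [mon_zero]
  | insert i s hi ih => rw [Finset.sum_insert hi, Finset.prod_insert hi, ← mon_mul, ih]

lemma toL_XA (A : Finset σ) : toL σ (XA A) = mon (ind A) := by
  rw [XA, map_prod]
  simp_rw [toL_X]
  rw [← mon_sum]
  congr 1
  ext q
  simp [ind, Pi.single_apply]

lemma toL_XA_pow (A : Finset σ) (h : ℕ) : toL σ (XA A ^ h) = mon ((h : ℤ) • ind A) := by
  rw [map_pow, toL_XA, mon_pow]

variable {V : Type} [AddCommGroup V] [Module (Lau σ) V] [Module (Pol σ) V]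
  [IsScalarTower (Pol σ) (Lau σ) V]

lemma pol_smul (f : Pol σ) (v : V) : f • v = toL σ f • v := by
  rw [← algMap_eq, algebraMap_smul]

lemma XA_smul (A : Finset σ) (h : ℕ) (v : V) : XA A ^ h • v = mon ((h : ℤ) • ind A) • v := by
  rw [pol_smul, toL_XA_pow]

lemma mon_smul_smul (a b : σ → ℤ) (v : V) : mon a • mon b • v = mon (a + b) • v := by
  rw [smul_smul, mon_mul]

lemma mon_zero_smul (v : V) : mon (0 : σ → ℤ) • v = v := by rw [mon_zero, one_smul]

lemma XA_dvd {A B : Finset σ} (h : A ⊆ B) : XA A ∣ XA B := Finset.prod_dvd_prod_of_subset _ _ _ h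

/-- Localization of a submodule of `V` at the variables in `A`, inside `V`. -/
def loc (N : Submodule (Pol σ) V) (A : Finset σ) : Submodule (Pol σ) V where
  carrier := {v | ∃ h : ℕ, XA A ^ h • v ∈ N}
  zero_mem' := ⟨0, by simp⟩
  add_mem' := by
    rintro a b ⟨h, ha⟩ ⟨k, hb⟩
    refine ⟨h + k, ?_⟩
    rw [smul_add]
    refine N.add_mem ?_ ?_
    · rw [add_comm, pow_add, mul_smul]; exact N.smul_mem _ ha
    · rw [pow_add, mul_smul]; exact N.smul_mem _ hb
  smul_mem' := by
    rintro c a ⟨h, ha⟩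
    exact ⟨h, by rw [smul_comm]; exact N.smul_mem _ ha⟩

lemma mem_loc {N : Submodule (Pol σ) V} {A : Finset σ} {v : V} :
    v ∈ loc N A ↔ ∃ h : ℕ, XA A ^ h • v ∈ N := Iff.rfl

lemma smul_of_dvd {N : Submodule (Pol σ) V} {f g : Pol σ} {v : V} (h : f ∣ g) (hv : f • v ∈ N) :
    g • v ∈ N := by
  obtain ⟨c, rfl⟩ := h
  rw [mul_comm, mul_smul]; exact N.smul_mem _ hv

lemma loc_mono_left {N N' : Submodule (Pol σ) V} (h : N ≤ N') (A : Finset σ) : loc N A ≤ loc N' A := by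
  rintro v ⟨k, hk⟩
  exact ⟨k, h hk⟩

lemma loc_mono_right (N : Submodule (Pol σ) V) {A B : Finset σ} (h : A ⊆ B) : loc N A ≤ loc N B := by
  rintro v ⟨k, hk⟩
  exact ⟨k, smul_of_dvd (pow_dvd_pow_of_dvd (XA_dvd h) k) hk⟩

lemma le_loc (N : Submodule (Pol σ) V) (A : Finset σ) : N ≤ loc N A :=
  fun v hv => ⟨0, by simpa using hv⟩

lemma loc_loc (N : Submodule (Pol σ) V) (A : Finset σ) {v : V} (h : ℕ) (hv : XA A ^ h • v ∈ loc N A) :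
    v ∈ loc N A := by
  obtain ⟨k, hk⟩ := hv
  exact ⟨k + h, by rwa [pow_add, mul_smul]⟩

lemma mon_neg_mem_loc {N : Submodule (Pol σ) V} {A : Finset σ} {v : V} (hv : v ∈ loc N A) (h : ℕ) :
    mon (-((h : ℤ) • ind A)) • v ∈ loc N A := by
  refine loc_loc N A h ?_
  rw [XA_smul, mon_smul_smul, add_neg_cancel, mon_zero_smul]; exact hv

/-- a monomial with non-negative exponents off `A` preserves `loc N A` -/
lemma mon_mem_loc {N : Submodule (Pol σ) V} {A : Finset σ} {v : V} (hv : v ∈ loc N A) (a : σ → ℤ)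
    (ha : ∀ p, p ∉ A → 0 ≤ a p) : mon a • v ∈ loc N A := by
  have : ∃ h : ℕ, ∀ p, -(h : ℤ) ≤ a p := by
    refine ⟨∑ p, (a p).natAbs, fun p => ?_⟩
    have : (a p).natAbs ≤ ∑ p, (a p).natAbs := Finset.single_le_sum (f := fun p => (a p).natAbs) (by simp) (Finset.mem_univ p)
    omega
  obtain ⟨h, hh⟩ := this
  obtain ⟨f, hf⟩ := mon_mem_range (a + (h : ℤ) • ind A) (by
    intro p
    by_cases hp : p ∈ A
    · simp [ind, hp]; linarith [hh p]
    · simp [ind, hp, ha p hp])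
  refine loc_loc N A h ?_
  rw [XA_smul, mon_smul_smul, add_comm, ← hf, ← pol_smul]
  exact Submodule.smul_mem _ _ hv

variable {V' : Type} [AddCommGroup V'] [Module (Lau σ) V'] [Module (Pol σ) V']
  [IsScalarTower (Pol σ) (Lau σ) V']

lemma map_pol_smul (f : V' →ₗ[Lau σ] V) (s : Pol σ) (v : V') : f (s • v) = s • f v := by
  rw [pol_smul, map_smul, pol_smul]

lemma map_loc {N' : Submodule (Pol σ) V'} {N : Submodule (Pol σ) V} (f : V' →ₗ[Lau σ] V)
    (hf : ∀ v ∈ N', f v ∈ N) {A : Finset σ} {v : V'} (hv : v ∈ loc N' A) : f v ∈ loc N A := by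
  obtain ⟨h, hh⟩ := hv
  exact ⟨h, by rw [← map_pol_smul]; exact hf _ hh⟩

end fin
end Cech
end SkewLC

namespace SkewLC
namespace Cech

section cpx
variable {σ : Type} [Fintype σ] [DecidableEq σ]

/-- an arbitrary ranking of the variables -/
def rk (p : σ) : ℕ := (Fintype.equivFin σ p : ℕ)

lemma rk_inj : Function.Injective (rk : σ → ℕ) := by
  intro a b h
  exact (Fintype.equivFin σ).injective (Fin.ext h)

/-- the Čech sign -/
def sgn (a : σ) (A : Finset σ) : ℤ := (-1) ^ (A.filter (fun q => rk q < rk a)).card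

lemma sgn_sq (a : σ) (A : Finset σ) : sgn a A * sgn a A = 1 := by
  rw [sgn, ← pow_add, ← two_mul, pow_mul]; simp

lemma sgn_swap_aux {a b : σ} {B : Finset σ} (ha : a ∈ B) (hab : rk a < rk b) :
    sgn a B * sgn b (B.erase a) = -(sgn b B * sgn a (B.erase b)) := by
  have h1 : sgn a (B.erase b) = sgn a B := by
    unfold sgn
    congr 2
    ext q
    simp only [Finset.mem_filter, Finset.mem_erase]
    constructor
    · rintro ⟨⟨_, h⟩, h'⟩; exact ⟨h, h'⟩
    · rintro ⟨h, h'⟩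
      refine ⟨⟨?_, h⟩, h'⟩
      rintro rfl; omega
  have h2 : sgn b B = - sgn b (B.erase a) := by
    unfold sgn
    have : B.filter (fun q => rk q < rk b) = insert a ((B.erase a).filter (fun q => rk q < rk b)) := by
      ext q
      simp only [Finset.mem_filter, Finset.mem_erase, Finset.mem_insert]
      constructor
      · rintro ⟨h, h'⟩
        by_cases hq : q = a
        · exact Or.inl hq
        · exact Or.inr ⟨⟨hq, h⟩, h'⟩
      · rintro (rfl | ⟨⟨_, h⟩, h'⟩)
        · exact ⟨ha, hab⟩
        · exact ⟨h, h'⟩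
    rw [this, Finset.card_insert_of_notMem (by simp), pow_succ]
    ring
  rw [h1, h2]; ring

lemma sgn_swap {a b : σ} {B : Finset σ} (ha : a ∈ B) (hb : b ∈ B) (hab : a ≠ b) :
    sgn a B * sgn b (B.erase a) = -(sgn b B * sgn a (B.erase b)) := by
  rcases lt_trichotomy (rk a) (rk b) with h | h | h
  · exact sgn_swap_aux ha h
  · exact absurd (rk_inj h) hab
  · rw [sgn_swap_aux hb h]; ring

variable {V : Type} [AddCommGroup V]

/-- the Čech differential -/
def dl (c : Finset σ → V) : Finset σ → V := fun A => ∑ a ∈ A, sgn a A • c (A.erase a)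

lemma dl_add (c d : Finset σ → V) : dl (c + d) = dl c + dl d := by
  ext A; simp [dl, smul_add, Finset.sum_add_distrib]

lemma dl_sub (c d : Finset σ → V) : dl (c - d) = dl c - dl d := by
  ext A; simp [dl, smul_sub, Finset.sum_sub_distrib]

lemma dl_zero : dl (0 : Finset σ → V) = 0 := by ext A; simp [dl]

lemma dl_sum {ι : Type} (s : Finset ι) (c : ι → Finset σ → V) : dl (∑ i ∈ s, c i) = ∑ i ∈ s, dl (c i) := by
  classical
  induction s using Finset.induction_on with
  | empty => simp [dl_zero]
  | insert i s hi ih => rw [Finset.sum_insert hi, Finset.sum_insert hi, dl_add, ih]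

lemma dl_map {V' : Type} [AddCommGroup V'] (f : V →+ V') (c : Finset σ → V) :
    dl (fun A => f (c A)) = fun A => f (dl c A) := by
  ext A; simp [dl, map_sum]

lemma dl_dl (c : Finset σ → V) : dl (dl c) = 0 := by
  ext A
  have h : dl (dl c) A = ∑ x ∈ A ×ˢ A, if x.1 = x.2 then 0 else
      (sgn x.1 A * sgn x.2 (A.erase x.1)) • c ((A.erase x.1).erase x.2) := by
    rw [Finset.sum_product]
    unfold dl
    refine Finset.sum_congr rfl fun a ha => ?_
    rw [Finset.smul_sum, ← Finset.sum_erase (s := A) (a := a) (by simp)]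
    refine Finset.sum_congr rfl fun b hb => ?_
    have := Finset.ne_of_mem_erase hb
    simp only [Ne.symm this, if_false, mul_smul]
  rw [h]
  refine Finset.sum_involution (fun x _ => (x.2, x.1)) ?_ ?_ ?_ ?_
  · rintro ⟨a, b⟩ hx
    simp only [Finset.mem_product] at hx
    by_cases hab : a = b
    · simp [hab]
    · simp only [hab, Ne.symm hab, if_false]
      rw [sgn_swap hx.1 hx.2 hab, Finset.erase_right_comm, neg_smul, neg_add_cancel]
  · rintro ⟨a, b⟩ hx hne heq
    simp only [Prod.mk.injEq] at heq
    apply hne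
    simp [heq.2]
  · rintro ⟨a, b⟩ hx
    simpa [and_comm] using hx
  · rintro ⟨a, b⟩ hx; rfl

/-- contracting homotopy at the variable `p` -/
def hp (p : σ) (c : Finset σ → V) : Finset σ → V := fun A =>
  if p ∈ A then 0 else sgn p (insert p A) • c (insert p A)

lemma hp_homotopy (p : σ) (c : Finset σ → V) : dl (hp p c) + hp p (dl c) = c := by
  ext A
  by_cases hpA : p ∈ A
  · have h1 : hp p (dl c) A = 0 := by simp [hp, hpA]
    have h2 : dl (hp p c) A = c A := by
      unfold dl
      rw [Finset.sum_eq_single p]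
      · simp only [hp, Finset.notMem_erase, if_false, Finset.insert_erase hpA]
        rw [smul_smul, sgn_sq, one_smul]
      · intro b hb hbp
        simp [hp, hpA, Ne.symm hbp]
      · intro h; exact absurd hpA h
    simp [h1, h2]
  · have h1 : hp p (dl c) A = c A +
        ∑ a ∈ A, (sgn p (insert p A) * sgn a (insert p A)) • c ((insert p A).erase a) := by
      simp only [hp, hpA, if_false]
      unfold dl
      rw [Finset.sum_insert hpA, smul_add, smul_smul, sgn_sq, one_smul, Finset.erase_insert hpA,
        Finset.smul_sum]
      congr 1
      exact Finset.sum_congr rfl fun a _ => by rw [smul_smul]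
    rw [Pi.add_apply, h1]
    have h2 : dl (hp p c) A =
        - ∑ a ∈ A, (sgn p (insert p A) * sgn a (insert p A)) • c ((insert p A).erase a) := by
      unfold dl
      rw [← Finset.sum_neg_distrib]
      refine Finset.sum_congr rfl fun a ha => ?_
      have hpa : a ≠ p := by rintro rfl; exact hpA ha
      have h3 : p ∉ A.erase a := fun h => hpA (Finset.mem_of_mem_erase h)
      simp only [hp, h3, if_false]
      have h4 : insert p (A.erase a) = (insert p A).erase a := by
        rw [Finset.erase_insert_of_ne hpa.symm]
      rw [h4, smul_smul, ← neg_smul]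
      congr 1
      have h5 := sgn_swap (a := a) (b := p) (B := insert p A) (by simp [ha]) (by simp) hpa
      rw [Finset.erase_insert hpA] at h5
      have h6 := sgn_sq a (insert p A)
      have h7 := sgn_sq p (insert p A)
      have h8 := sgn_sq a A
      calc sgn a A * sgn p ((insert p A).erase a)
          = (sgn a (insert p A) * sgn a (insert p A)) * (sgn a A * sgn p ((insert p A).erase a)) := by
            rw [h6, one_mul]
        _ = (sgn a (insert p A) * sgn p ((insert p A).erase a)) * (sgn a (insert p A) * sgn a A) := by ring
        _ = -(sgn a A * sgn a A) * (sgn p (insert p A) * sgn a (insert p A)) := by rw [h5]; ring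
        _ = _ := by rw [h8]; ring
    rw [h2]; abel

end cpx

section free
variable {σ : Type} [Fintype σ] [DecidableEq σ]

/-- the standard free module in `ι → Lau` -/
def Sfree (σ ι : Type) : Submodule (Pol σ) (ι → Lau σ) where
  carrier := {f | ∀ i, ∃ g : Pol σ, toL σ g = f i}
  zero_mem' := fun i => ⟨0, by simp⟩
  add_mem' := by
    intro a b ha hb i
    obtain ⟨g, hg⟩ := ha i
    obtain ⟨g', hg'⟩ := hb i
    exact ⟨g + g', by simp [hg, hg']⟩
  smul_mem' := by
    intro c a ha i
    obtain ⟨g, hg⟩ := ha i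
    exact ⟨c * g, by rw [map_mul, hg]; rfl⟩

variable {ι : Type} 

lemma mem_Sfree {f : ι → Lau σ} : f ∈ Sfree σ ι ↔ ∀ i b, (f i).coeff b ≠ 0 → ∀ p, 0 ≤ b p := by
  constructor
  · intro h i; exact (mem_range_toL (f i)).1 (h i)
  · intro h i; exact (mem_range_toL (f i)).2 (h i)

lemma mem_loc_Sfree [Finite ι] {f : ι → Lau σ} {A : Finset σ} :
    f ∈ loc (Sfree σ ι) A ↔ ∀ i b, (f i).coeff b ≠ 0 → ∀ p, p ∉ A → 0 ≤ b p := by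
  constructor
  · rintro ⟨h, hh⟩ i b hb p hp
    rw [XA_smul, mem_Sfree] at hh
    have := hh i (b + (h : ℤ) • ind A) (by
      simp only [Pi.smul_apply, smul_eq_mul]
      rw [coeff_mon_mul]; simpa using hb) p
    simpa [ind, hp] using this
  · intro hf
    cases nonempty_fintype ι
    have : ∃ h : ℕ, ∀ i, ∀ b ∈ (f i).coeff.support, ∀ p, -(h : ℤ) ≤ b p := by
      refine ⟨∑ i, ∑ b ∈ (f i).coeff.support, ∑ p, (b p).natAbs, fun i b hb p => ?_⟩
      have h1 : (b p).natAbs ≤ ∑ p, (b p).natAbs :=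
        Finset.single_le_sum (f := fun p => (b p).natAbs) (by simp) (Finset.mem_univ p)
      have h2 : ∑ p, (b p).natAbs ≤ ∑ b ∈ (f i).coeff.support, ∑ p, (b p).natAbs :=
        Finset.single_le_sum (f := fun b : σ → ℤ => ∑ p, (b p).natAbs) (by simp) hb
      have h3 : ∑ b ∈ (f i).coeff.support, ∑ p, (b p).natAbs ≤
          ∑ i, ∑ b ∈ (f i).coeff.support, ∑ p, (b p).natAbs :=
        Finset.single_le_sum (f := fun i => ∑ b ∈ (f i).coeff.support, ∑ p, (b p).natAbs)
          (by simp) (Finset.mem_univ i)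
      omega
    obtain ⟨h, hh⟩ := this
    refine ⟨h, ?_⟩
    rw [XA_smul, mem_Sfree]
    intro i b hb p
    simp only [Pi.smul_apply, smul_eq_mul] at hb
    rw [coeff_mon_mul] at hb
    by_cases hp : p ∈ A
    · have := hh i _ (by simpa using hb) p
      simp [ind, hp] at this; linarith
    · have := hf i _ hb p hp
      simpa [ind, hp] using this

/-- filter a Laurent polynomial by exponents -/
def fil (Q : (σ → ℤ) → Prop) : Lau σ →+ Lau σ where
  toFun f := by classical exact AddMonoidAlgebra.ofCoeff (f.coeff.filter Q)
  map_zero' := by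
    classical
    ext a; simp [Finsupp.filter_apply]
  map_add' f g := by
    classical
    ext a; simp [Finsupp.filter_add]

lemma fil_coeff (Q : (σ → ℤ) → Prop) [DecidablePred Q] (f : Lau σ) (a : σ → ℤ) :
    (fil Q f).coeff a = if Q a then f.coeff a else 0 := by
  classical
  simp only [fil, AddMonoidHom.coe_mk, ZeroHom.coe_mk, AddMonoidAlgebra.coeff_ofCoeff, Finsupp.filter_apply]
  split_ifs <;> simp_all

/-- componentwise filter -/
def filI (ι : Type) (Q : (σ → ℤ) → Prop) : (ι → Lau σ) →+ (ι → Lau σ) where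
  toFun f := fun i => fil Q (f i)
  map_zero' := by ext; simp
  map_add' f g := by ext; simp

/-- Čech cochains of `N` (all degrees) -/
def IsC {V : Type} [AddCommGroup V] [Module (Pol σ) V] (N : Submodule (Pol σ) V) (c : Finset σ → V) : Prop :=
  ∀ A, c A ∈ loc N A

/-- supported in cardinality `b` -/
def Supp {V : Type} [AddCommGroup V] (c : Finset σ → V) (b : ℕ) : Prop :=
  ∀ A : Finset σ, A.card ≠ b → c A = 0

open Classical in
/-- choice of a nonnegative exponent -/
def pch (a : σ → ℤ) : Option σ := if h : ∃ p, 0 ≤ a p then some h.choose else none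

lemma pch_some {a : σ → ℤ} {p : σ} (h : pch a = some p) : 0 ≤ a p := by
  unfold pch at h
  split_ifs at h with h'
  · rw [Option.some_inj] at h; rw [← h]; exact h'.choose_spec

lemma pch_none {a : σ → ℤ} (h : pch a = none) : ∀ p, a p < 0 := by
  unfold pch at h
  split_ifs at h with h'
  push Not at h'; exact h'

lemma exact_free [Finite ι] (c : Finset σ → ι → Lau σ) (hc : IsC (Sfree σ ι) c) (hd : dl c = 0)
    (hneg : ∀ A i a, (∀ p, a p < 0) → (c A i).coeff a = 0) :
    ∃ d, IsC (Sfree σ ι) d ∧ dl d = c ∧ ∀ b, Supp c (b + 1) → Supp d b := by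
  classical
  let cp : σ → Finset σ → ι → Lau σ := fun p A => filI ι (fun a => pch a = some p) (c A)
  have hcp : ∀ p, dl (cp p) = 0 := by
    intro p
    have := dl_map (filI ι (fun a : σ → ℤ => pch a = some p)) c
    rw [hd] at this
    refine this.trans ?_
    funext A; simp
  have hsum : ∑ p, cp p = c := by
    ext A i a
    simp only [Finset.sum_apply, cp, filI, AddMonoidHom.coe_mk, ZeroHom.coe_mk]
    rw [AddMonoidAlgebra.coeff_sum, Finsupp.finset_sum_apply]
    simp_rw [fil_coeff]
    cases h : pch a with
    | none => simp [hneg A i a (pch_none h)]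
    | some p => simp
  refine ⟨∑ p, hp p (cp p), ?_, ?_, ?_⟩
  · intro A
    rw [Finset.sum_apply]
    refine Submodule.sum_mem _ fun p _ => ?_
    by_cases hpA : p ∈ A
    · simp [hp, hpA]
    · simp only [hp, hpA, if_false]
      refine zsmul_mem ?_ _
      rw [mem_loc_Sfree]
      intro i a ha q hq
      simp only [cp, filI, AddMonoidHom.coe_mk, ZeroHom.coe_mk] at ha
      rw [fil_coeff] at ha
      split_ifs at ha with h'
      · by_cases hqp : q = p
        · subst hqp; exact pch_some h'
        · exact mem_loc_Sfree.1 (hc (insert p A)) i a ha q (by simp [hqp, hq])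
      · exact absurd rfl ha
  · rw [dl_sum]
    conv_rhs => rw [← hsum]
    refine Finset.sum_congr rfl fun p _ => ?_
    have := hp_homotopy p (cp p)
    rw [hcp] at this
    have h0 : hp p (0 : Finset σ → ι → Lau σ) = 0 := by ext A; simp [hp]
    rwa [h0, add_zero] at this
  · intro b hb A hA
    rw [Finset.sum_apply]
    refine Finset.sum_eq_zero fun p _ => ?_
    by_cases hpA : p ∈ A
    · simp [hp, hpA]
    · simp only [hp, hpA, if_false]
      have : c (insert p A) = 0 := hb _ (by rw [Finset.card_insert_of_notMem hpA]; omega)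
      simp [cp, this]

lemma exact_free' [Finite ι] (c : Finset σ → ι → Lau σ) (hc : IsC (Sfree σ ι) c) (hd : dl c = 0)
    {b : ℕ} (hb : Supp c b) (hbN : b < Fintype.card σ) :
    ∃ d, IsC (Sfree σ ι) d ∧ dl d = c ∧ ∀ b, Supp c (b + 1) → Supp d b := by
  refine exact_free c hc hd fun A i a ha => ?_
  by_cases hA : A.card = b
  · by_contra hne
    have : ∃ p, p ∉ A := by
      by_contra hcon
      push Not at hcon
      have : A = Finset.univ := Finset.eq_univ_iff_forall.2 hcon
      rw [this, Finset.card_univ] at hA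
      omega
    obtain ⟨p, hp⟩ := this
    have := mem_loc_Sfree.1 (hc A) i a hne p hp
    linarith [ha p]
  · rw [hb A hA]; simp

end free
end Cech
end SkewLC

namespace SkewLC
namespace Cech

section hz
variable {σ : Type} [Fintype σ] [DecidableEq σ]
variable {V : Type} [AddCommGroup V] [Module (Lau σ) V] [Module (Pol σ) V]
  [IsScalarTower (Pol σ) (Lau σ) V]
variable {V' : Type} [AddCommGroup V'] [Module (Lau σ) V'] [Module (Pol σ) V']
  [IsScalarTower (Pol σ) (Lau σ) V']

lemma IsC.dl {N : Submodule (Pol σ) V} {c : Finset σ → V} (hc : IsC N c) : IsC N (dl c) := by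
  intro A
  refine Submodule.sum_mem _ fun a _ => zsmul_mem ?_ _
  exact loc_mono_right N (Finset.erase_subset a A) (hc _)

lemma IsC.sub {N : Submodule (Pol σ) V} {c d : Finset σ → V} (hc : IsC N c) (hd : IsC N d) :
    IsC N (c - d) := fun A => sub_mem (hc A) (hd A)

lemma IsC.add {N : Submodule (Pol σ) V} {c d : Finset σ → V} (hc : IsC N c) (hd : IsC N d) :
    IsC N (c + d) := fun A => add_mem (hc A) (hd A)

lemma IsC.map {N' : Submodule (Pol σ) V'} {N : Submodule (Pol σ) V} (f : V' →ₗ[Lau σ] V)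
    (hf : ∀ v ∈ N', f v ∈ N) {c : Finset σ → V'} (hc : IsC N' c) : IsC N (fun A => f (c A)) :=
  fun A => map_loc f hf (hc A)

lemma dl_mapL (f : V' →ₗ[Lau σ] V) (c : Finset σ → V') :
    dl (fun A => f (c A)) = fun A => f (dl c A) := dl_map f.toAddMonoidHom c

lemma Supp.dl {c : Finset σ → V} {b : ℕ} (hc : Supp c b) : Supp (Cech.dl c) (b + 1) := by
  intro A hA
  refine Finset.sum_eq_zero fun a ha => ?_
  rw [hc, smul_zero]
  rw [Finset.card_erase_of_mem ha]
  have : 0 < A.card := Finset.card_pos.2 ⟨a, ha⟩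
  omega

/-- `f` induces zero on the `b`-th Čech cohomology. -/
def HZ (f : V' →ₗ[Lau σ] V) (N' : Submodule (Pol σ) V') (N : Submodule (Pol σ) V) (b : ℕ) : Prop :=
  ∀ c : Finset σ → V', IsC N' c → Supp c b → dl c = 0 →
    ∃ d : Finset σ → V, IsC N d ∧ dl d = fun A => f (c A)

/-- evaluation map of a family of vectors -/
def lin {ι : Type} [Fintype ι] (g : ι → V) : (ι → Lau σ) →ₗ[Lau σ] V := Fintype.linearCombination (Lau σ) g

lemma lin_apply {ι : Type} [Fintype ι] (g : ι → V) (f : ι → Lau σ) : lin g f = ∑ i, f i • g i := rfl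

/-- the relation module -/
def Rel {ι : Type} [Fintype ι] (g : ι → V) : Submodule (Pol σ) (ι → Lau σ) :=
  Sfree σ ι ⊓ LinearMap.ker ((lin g).restrictScalars (Pol σ))

lemma mem_Rel {ι : Type} [Fintype ι] {g : ι → V} {f : ι → Lau σ} :
    f ∈ Rel g ↔ f ∈ Sfree σ ι ∧ lin g f = 0 := by
  simp [Rel]

lemma lin_mem {ι : Type} [Fintype ι] (g : ι → V) {f : ι → Lau σ} (hf : f ∈ Sfree σ ι) :
    lin g f ∈ Submodule.span (Pol σ) (Set.range g) := by
  rw [lin_apply]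
  refine Submodule.sum_mem _ fun i _ => ?_
  obtain ⟨s, hs⟩ := hf i
  rw [← hs, ← pol_smul]
  exact Submodule.smul_mem _ _ (Submodule.subset_span ⟨i, rfl⟩)

lemma exists_lin {ι : Type} [Fintype ι] (g : ι → V) {v : V}
    (hv : v ∈ Submodule.span (Pol σ) (Set.range g)) : ∃ f ∈ Sfree σ ι, lin g f = v := by
  rw [Submodule.mem_span_range_iff_exists_fun] at hv
  obtain ⟨c, hc⟩ := hv
  refine ⟨fun i => toL σ (c i), fun i => ⟨c i, rfl⟩, ?_⟩
  rw [lin_apply, ← hc]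
  exact Finset.sum_congr rfl fun i _ => (pol_smul _ _).symm

lemma exists_lin_loc {ι : Type} [Fintype ι] (g : ι → V) {v : V} {A : Finset σ}
    (hv : v ∈ loc (Submodule.span (Pol σ) (Set.range g)) A) :
    ∃ f ∈ loc (Sfree σ ι) A, lin g f = v := by
  obtain ⟨h, hh⟩ := hv
  obtain ⟨f, hf, hfv⟩ := exists_lin g hh
  refine ⟨mon (-((h : ℤ) • ind A)) • f, mon_neg_mem_loc (le_loc _ _ hf) h, ?_⟩
  rw [map_smul, hfv, XA_smul, mon_smul_smul, neg_add_cancel, mon_zero_smul]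

lemma mem_loc_Rel {ι : Type} [Fintype ι] {g : ι → V} {f : ι → Lau σ} {A : Finset σ}
    (hf : f ∈ loc (Sfree σ ι) A) (h0 : lin g f = 0) : f ∈ loc (Rel g) A := by
  obtain ⟨h, hh⟩ := hf
  refine ⟨h, mem_Rel.2 ⟨hh, ?_⟩⟩
  rw [map_pol_smul, h0, smul_zero]

/-- dimension shifting for `HZ` -/
lemma step {ι ι' : Type} [Fintype ι] [Fintype ι'] (g : ι → V) (g' : ι' → V') (f : V' →ₗ[Lau σ] V)
    (φ : (ι' → Lau σ) →ₗ[Lau σ] (ι → Lau σ)) (hφS : ∀ v ∈ Sfree σ ι', φ v ∈ Sfree σ ι)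
    (hφ : ∀ v, lin g (φ v) = f (lin g' v)) (b : ℕ)
    (H : HZ f (Submodule.span (Pol σ) (Set.range g')) (Submodule.span (Pol σ) (Set.range g)) b)
    (c d' : Finset σ → ι' → Lau σ) (hc : IsC (Rel g') c) (hd' : IsC (Sfree σ ι') d')
    (hd'b : Supp d' b) (hcd : dl d' = c) :
    ∃ d, IsC (Rel g) d ∧ dl d = fun A => φ (c A) := by
  have hpi : ∀ v ∈ Sfree σ ι', lin g' v ∈ Submodule.span (Pol σ) (Set.range g') := fun v hv => lin_mem g' hv
  obtain ⟨β, hβ, hβd⟩ := H (fun A => lin g' (d' A)) (hd'.map _ hpi) (by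
      intro A hA; simp [hd'b A hA]) (by
      rw [dl_mapL, hcd]; funext A
      obtain ⟨h, hh⟩ := hc A
      have := (mem_Rel.1 hh).2
      rw [XA_smul, map_smul] at this
      have h2 : mon (-((h : ℤ) • ind A)) • mon ((h : ℤ) • ind A) • lin g' (c A) = 0 := by rw [this, smul_zero]
      rwa [mon_smul_smul, neg_add_cancel, mon_zero_smul] at h2)
  choose β' hβ'1 hβ'2 using fun A => exists_lin_loc g (hβ A)
  have hβ'C : IsC (Sfree σ ι) β' := hβ'1
  refine ⟨(fun A => φ (d' A)) - dl β', ?_, ?_⟩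
  · intro A
    refine mem_loc_Rel (((hd'.map φ hφS).sub hβ'C.dl) A) ?_
    have h1 : lin g (dl β' A) = dl β A := by
      have := congrFun (dl_mapL (lin g) β') A
      rw [← this]
      congr 1; funext A; exact hβ'2 A
    simp only [Pi.sub_apply, map_sub, hφ, h1, hβd, sub_self]
  · rw [dl_sub, dl_dl, sub_zero, dl_mapL, hcd]

end hz
end Cech
end SkewLC

namespace SkewLC
namespace Cech

section gr
variable {σ : Type} [Fintype σ] [DecidableEq σ] {M : Type} [AddCommGroup M]

/-- weight of a Laurent exponent -/
def wtE (wt : σ → M) (a : σ → ℤ) : M := ∑ p, a p • wt p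

lemma wtE_add (wt : σ → M) (a b : σ → ℤ) : wtE wt (a + b) = wtE wt a + wtE wt b := by
  simp [wtE, add_smul, Finset.sum_add_distrib]

open Classical in
/-- A grading by `M` on a module over Laurent polynomials. -/
structure Gr (wt : σ → M) (V : Type) [AddCommGroup V] [Module (Lau σ) V] where
  comp : M → V →+ V
  comp_mon : ∀ δ (c : ℂ) a v, comp δ ((c • mon a : Lau σ) • v) = (c • mon a : Lau σ) • comp (δ - wtE wt a) v
  comp_comp : ∀ δ δ' v, comp δ (comp δ' v) = if δ = δ' then comp δ v else 0
  fin : ∀ v, ∃ T : Finset M, ∑ δ ∈ T, comp δ v = v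

variable {wt : σ → M}

open Classical in
/-- the standard grading on a shifted free module -/
def GrFree (wt : σ → M) {ι : Type} [Fintype ι] (ω : ι → M) : Gr wt (ι → Lau σ) where
  comp δ :=
    { toFun := fun f i => fil (fun a => wtE wt a + ω i = δ) (f i)
      map_zero' := by ext; simp
      map_add' := by intro f g; ext; simp }
  comp_mon := by
    intro δ c a v
    ext i b
    simp only [AddMonoidHom.coe_mk, ZeroHom.coe_mk, fil_coeff, Pi.smul_apply, smul_eq_mul]
    rw [smul_mul_assoc, smul_mul_assoc, AddMonoidAlgebra.coeff_smul_apply,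
      AddMonoidAlgebra.coeff_smul_apply, coeff_mon_mul, coeff_mon_mul, fil_coeff]
    have : wtE wt b = wtE wt (b - a) + wtE wt a := by rw [← wtE_add, sub_add_cancel]
    by_cases h : wtE wt b + ω i = δ
    · rw [if_pos h, if_pos]
      rw [← h, this]; abel
    · rw [if_neg h, if_neg]
      · simp
      · intro h'
        apply h
        rw [this, add_right_comm, h', sub_add_cancel]
  comp_comp := by
    intro δ δ' v
    by_cases h : δ = δ'
    · subst h
      rw [if_pos rfl]
      ext i b
      simp only [AddMonoidHom.coe_mk, ZeroHom.coe_mk, fil_coeff]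
      split_ifs <;> rfl
    · rw [if_neg h]
      ext i b
      simp only [AddMonoidHom.coe_mk, ZeroHom.coe_mk, fil_coeff]
      split_ifs with h1 h2
      · exact absurd (h1.symm.trans h2) h
      · rfl
      · rfl
  fin := by
    intro v
    refine ⟨Finset.univ.biUnion fun i => (v i).coeff.support.image fun a => wtE wt a + ω i, ?_⟩
    ext i b
    simp only [Finset.sum_apply, AddMonoidHom.coe_mk, ZeroHom.coe_mk]
    rw [AddMonoidAlgebra.coeff_sum, Finsupp.finset_sum_apply]
    simp_rw [fil_coeff]
    rw [Finset.sum_ite_eq]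
    split_ifs with h
    · rfl
    · by_contra hne
      apply h
      simp only [Finset.mem_biUnion, Finset.mem_univ, true_and, Finset.mem_image]
      exact ⟨i, b, by simpa using Ne.symm hne, rfl⟩

open Classical in
/-- the standard grading on Laurent polynomials -/
def GrL (wt : σ → M) : Gr wt (Lau σ) where
  comp δ := fil (fun a => wtE wt a = δ)
  comp_mon := by
    intro δ c a v
    ext b
    simp only [fil_coeff, smul_eq_mul]
    rw [smul_mul_assoc, smul_mul_assoc, AddMonoidAlgebra.coeff_smul_apply,
      AddMonoidAlgebra.coeff_smul_apply, coeff_mon_mul, coeff_mon_mul, fil_coeff]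
    have : wtE wt b = wtE wt (b - a) + wtE wt a := by rw [← wtE_add, sub_add_cancel]
    by_cases h : wtE wt b = δ
    · rw [if_pos h, if_pos]
      rw [← h, this]; abel
    · rw [if_neg h, if_neg]
      · simp
      · intro h'
        apply h
        rw [this, h', sub_add_cancel]
  comp_comp := by
    intro δ δ' v
    by_cases h : δ = δ'
    · subst h
      rw [if_pos rfl]
      ext b
      simp only [fil_coeff]
      split_ifs <;> rfl
    · rw [if_neg h]
      ext b
      simp only [fil_coeff]
      split_ifs with h1 h2
      · exact absurd (h1.symm.trans h2) h
      · rfl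
      · rfl
  fin := by
    intro v
    refine ⟨v.coeff.support.image fun a => wtE wt a, ?_⟩
    ext b
    rw [AddMonoidAlgebra.coeff_sum, Finsupp.finset_sum_apply]
    simp_rw [fil_coeff]
    rw [Finset.sum_ite_eq]
    split_ifs with h
    · rfl
    · by_contra hne
      apply h
      simp only [Finset.mem_image]
      exact ⟨b, by simpa using Ne.symm hne, rfl⟩

variable {V : Type} [AddCommGroup V] [Module (Lau σ) V] [Module (Pol σ) V]
  [IsScalarTower (Pol σ) (Lau σ) V]

lemma Gr.comp_mon' (G : Gr wt V) (δ : M) (a : σ → ℤ) (v : V) :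
    G.comp δ (mon a • v) = mon a • G.comp (δ - wtE wt a) v := by
  have := G.comp_mon δ 1 a v
  simpa using this

lemma Gr.comp_idem (G : Gr wt V) (δ : M) (v : V) : G.comp δ (G.comp δ v) = G.comp δ v := by
  rw [G.comp_comp, if_pos rfl]

lemma Gr.comp_hom (G : Gr wt V) {g : V} {w : M} (hg : G.comp w g = g) (δ : M) (s : Lau σ) :
    G.comp δ (s • g) = (fil (fun a => wtE wt a + w = δ) s) • g := by
  classical
  induction s using lau_ind with
  | h0 => simp
  | hadd x y hx hy => rw [add_smul, map_add, hx, hy, map_add, add_smul]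
  | hm a c =>
    rw [G.comp_mon]
    have h1 : fil (fun b => wtE wt b + w = δ) (c • mon a) =
        if wtE wt a + w = δ then c • mon a else 0 := by
      ext b
      rw [fil_coeff, smul_mon]
      by_cases hb : a = b
      · subst hb; split_ifs <;> simp
      · have : (AddMonoidAlgebra.single a c : Lau σ).coeff b = 0 := by
          rw [AddMonoidAlgebra.coeff_single, Finsupp.single_apply, if_neg hb]
        split_ifs
        · rfl
        · exact this
        · exact this.symm
        · rfl
    rw [h1, ← hg, G.comp_comp]
    by_cases h : wtE wt a + w = δ
    · rw [if_pos h, if_pos (by rw [← h]; abel), hg, ← h, add_sub_cancel_left, hg]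
    · rw [if_neg h, if_neg, zero_smul, smul_zero]
      intro h'; apply h; rw [← h']; abel

lemma Gr.comp_lin (G : Gr wt V) {ι : Type} [Fintype ι] {g : ι → V} {ω : ι → M}
    (hg : ∀ i, G.comp (ω i) (g i) = g i) (δ : M) (f : ι → Lau σ) :
    G.comp δ (lin g f) = lin g ((GrFree wt ω).comp δ f) := by
  rw [lin_apply, lin_apply, map_sum]
  exact Finset.sum_congr rfl fun i _ => G.comp_hom (hg i) δ (f i)

lemma GrFree_coeff {ι : Type} [Fintype ι] (ω : ι → M) (δ : M) (f : ι → Lau σ) (i : ι) (a : σ → ℤ)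
    (h : (((GrFree wt ω).comp δ f) i).coeff a ≠ 0) : wtE wt a + ω i = δ ∧ (f i).coeff a ≠ 0 := by
  classical
  have h1 : (((GrFree wt ω).comp δ f) i).coeff a = if wtE wt a + ω i = δ then (f i).coeff a else 0 :=
    fil_coeff _ _ _
  rw [h1] at h
  split_ifs at h with h2
  · exact ⟨h2, h⟩
  · exact absurd rfl h

/-- graded submodules -/
def Graded (G : Gr wt V) (N : Submodule (Pol σ) V) : Prop := ∀ v ∈ N, ∀ δ, G.comp δ v ∈ N

lemma Graded.loc {G : Gr wt V} {N : Submodule (Pol σ) V} (hN : Graded G N) {A : Finset σ} {v : V}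
    (hv : v ∈ loc N A) (δ : M) : G.comp δ v ∈ Cech.loc N A := by
  obtain ⟨h, hh⟩ := hv
  refine ⟨h, ?_⟩
  have := hN _ hh (δ + wtE wt ((h : ℤ) • ind A))
  rwa [XA_smul, G.comp_mon', add_sub_cancel_right, ← XA_smul] at this

lemma Sfree_graded {ι : Type} [Fintype ι] (ω : ι → M) : Graded (GrFree wt ω) (Sfree σ ι) := by
  intro v hv δ
  rw [mem_Sfree] at hv ⊢
  intro i b hb
  exact hv i b (GrFree_coeff ω δ v i b hb).2

lemma span_graded (G : Gr wt V) {ι : Type} [Fintype ι] {g : ι → V} {ω : ι → M}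
    (hg : ∀ i, G.comp (ω i) (g i) = g i) : Graded G (Submodule.span (Pol σ) (Set.range g)) := by
  intro v hv δ
  obtain ⟨f, hf, rfl⟩ := exists_lin g hv
  rw [G.comp_lin hg]
  exact lin_mem g (Sfree_graded ω f hf δ)

lemma Rel_graded (G : Gr wt V) {ι : Type} [Fintype ι] {g : ι → V} {ω : ι → M}
    (hg : ∀ i, G.comp (ω i) (g i) = g i) : Graded (GrFree wt ω) (Rel g) := by
  intro v hv δ
  rw [mem_Rel] at hv ⊢
  refine ⟨Sfree_graded ω v hv.1 δ, ?_⟩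
  rw [← G.comp_lin hg, hv.2, map_zero]

/-- the free module as functions into polynomials -/
def freeEquiv (σ ι : Type) : (ι → Pol σ) ≃ₗ[Pol σ] Sfree σ ι :=
  LinearEquiv.ofBijective
    { toFun := fun f => (⟨fun i => toL σ (f i), fun i => ⟨f i, rfl⟩⟩ : Sfree σ ι)
      map_add' := by intro f g; ext i; simp
      map_smul' := by
        intro c f
        apply Subtype.ext
        funext i
        change toL σ (c * f i) = toL σ c * toL σ (f i)
        rw [map_mul] }
    ⟨by
      intro f g h
      funext i
      have := congrFun (congrArg Subtype.val h) i
      exact toL_inj this, by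
      rintro ⟨f, hf⟩
      choose g hg using id hf
      exact ⟨g, Subtype.ext (funext hg)⟩⟩

lemma freeEquiv_apply {ι : Type} (f : ι → Pol σ) (i : ι) : (freeEquiv σ ι f).1 i = toL σ (f i) := rfl

lemma Rel_fg {ι : Type} [Fintype ι] (g : ι → V) : (Rel (σ := σ) g).FG := by
  have h1 : IsNoetherian (Pol σ) (Sfree σ ι) := isNoetherian_of_linearEquiv (freeEquiv σ ι)
  have h2 : Rel (σ := σ) g ≤ Sfree σ ι := inf_le_left
  have h3 := (isNoetherian_submodule.1 h1) _ h2
  exact h3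

lemma exists_gens (G : Gr wt V) {N : Submodule (Pol σ) V} (hN : Graded G N) (hfg : N.FG) :
    ∃ (r : ℕ) (g : Fin r → V) (ω : Fin r → M), (∀ i, G.comp (ω i) (g i) = g i) ∧
      Submodule.span (Pol σ) (Set.range g) = N := by
  classical
  obtain ⟨T, hT⟩ := hfg
  choose F hF using G.fin
  let ι := Σ t : T, F t.1
  let e := (Fintype.equivFin ι).symm
  refine ⟨Fintype.card ι, fun k => G.comp (e k).2.1 (e k).1.1, fun k => (e k).2.1,
    fun k => G.comp_idem _ _, ?_⟩
  apply le_antisymm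
  · rw [Submodule.span_le]
    rintro _ ⟨k, rfl⟩
    refine hN _ ?_ _
    rw [← hT]; exact Submodule.subset_span (e k).1.2
  · rw [← hT, Submodule.span_le]
    intro t ht
    rw [SetLike.mem_coe, ← hF t]
    refine Submodule.sum_mem _ fun δ hδ => Submodule.subset_span ?_
    refine ⟨e.symm ⟨⟨t, ht⟩, ⟨δ, hδ⟩⟩, ?_⟩
    exact congrArg (fun x : ι => G.comp x.2.1 x.1.1) (e.apply_symm_apply ⟨⟨t, ht⟩, ⟨δ, hδ⟩⟩)

/-- truncation of a cochain -/
def trunc (b : ℕ) (c : Finset σ → V) : Finset σ → V := fun A => if A.card = b then c A else 0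

lemma dl_trunc (b : ℕ) (c : Finset σ → V) : dl (trunc b c) = trunc (b + 1) (dl c) := by
  ext A
  unfold trunc dl
  beta_reduce
  split_ifs with h
  · refine Finset.sum_congr rfl fun a ha => ?_
    rw [if_pos]
    rw [Finset.card_erase_of_mem ha, h]; rfl
  · refine Finset.sum_eq_zero fun a ha => ?_
    rw [if_neg, smul_zero]
    rw [Finset.card_erase_of_mem ha]
    have : 0 < A.card := Finset.card_pos.2 ⟨a, ha⟩
    omega

lemma trunc_supp (b : ℕ) (c : Finset σ → V) : Supp (trunc b c) b := fun A hA => by simp [trunc, hA]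

lemma trunc_eq {b : ℕ} {c : Finset σ → V} (h : Supp c b) : trunc b c = c := by
  ext A
  unfold trunc
  split_ifs with h'
  · rfl
  · exact (h A h').symm

lemma trunc_isC {b : ℕ} {N : Submodule (Pol σ) V} {c : Finset σ → V} (h : IsC N c) : IsC N (trunc b c) := by
  intro A
  unfold trunc
  split_ifs
  · exact h A
  · exact zero_mem _

lemma Gr.dl_comp (G : Gr wt V) {c : Finset σ → V} {w : M} (hc : ∀ A, G.comp w (c A) = c A) :
    ∀ A, G.comp w (dl c A) = dl c A := by
  intro A
  have := congrFun (dl_map (G.comp w) c) A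
  rw [← this]
  congr 1; funext A; exact hc A

/-- Homogeneous Čech cocycles of large weight are exact. -/
lemma crude (χ : M →+ ℤ) (hχ : ∀ p, 0 ≤ χ (wt p)) (k : ℕ) :
    ∀ (b : ℕ), b + k = Fintype.card σ → ∀ (V : Type) [AddCommGroup V] [Module (Lau σ) V] [Module (Pol σ) V]
      [IsScalarTower (Pol σ) (Lau σ) V] (G : Gr wt V) (N : Submodule (Pol σ) V), Graded G N → N.FG →
      ∃ C : ℤ, ∀ (c : Finset σ → V) (w : M), IsC N c → Supp c b → dl c = 0 →
        (∀ A, G.comp w (c A) = c A) → C < χ w → ∃ d, IsC N d ∧ dl d = c := by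
  induction k with
  | zero =>
    intro b hb V _ _ _ _ G N hN hfg
    obtain ⟨r, g, ω, hg, rfl⟩ := exists_gens G hN hfg
    refine ⟨∑ i, |χ (ω i)|, fun c w hc hcb hdc hcw hw => ?_⟩
    choose f hf1 hf2 using fun A => exists_lin_loc g (hc A)
    let f' : Finset σ → Fin r → Lau σ := trunc b fun A => (GrFree wt ω).comp w (f A)
    have hf'C : IsC (Sfree σ (Fin r)) f' := trunc_isC fun A => (Sfree_graded ω).loc (hf1 A) w
    have hf'l : ∀ A, lin g (f' A) = c A := by
      intro A
      simp only [f', trunc]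
      split_ifs with h
      · rw [← G.comp_lin hg, hf2, hcw]
      · rw [map_zero, hcb A h]
    have hf'd : dl f' = 0 := by
      funext A
      refine Finset.sum_eq_zero fun a ha => ?_
      simp only [f', trunc]
      rw [if_neg, smul_zero]
      rw [Finset.card_erase_of_mem ha]
      have h1 : 0 < A.card := Finset.card_pos.2 ⟨a, ha⟩
      have h2 : A.card ≤ Fintype.card σ := Finset.card_le_univ A
      omega
    obtain ⟨d, hd1, hd2, -⟩ := exact_free f' hf'C hf'd (by
      intro A i a ha
      by_contra hne
      have h1 : ((GrFree wt ω).comp w (f A) i).coeff a ≠ 0 := by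
        simp only [f', trunc] at hne
        split_ifs at hne with h
        · exact hne
        · exact absurd rfl hne
      have h2 := (GrFree_coeff ω w _ i a h1).1
      have h3 : χ (wtE wt a) ≤ 0 := by
        rw [wtE, map_sum]
        refine Finset.sum_nonpos fun p _ => ?_
        rw [map_zsmul, smul_eq_mul]
        exact mul_nonpos_of_nonpos_of_nonneg (ha p).le (hχ p)
      have h4 : |χ (ω i)| ≤ ∑ i, |χ (ω i)| :=
        Finset.single_le_sum (f := fun i => |χ (ω i)|) (fun _ _ => abs_nonneg _) (Finset.mem_univ i)
      have h5 := le_abs_self (χ (ω i))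
      have h6 : χ w = χ (wtE wt a) + χ (ω i) := by rw [← h2, map_add]
      linarith)
    refine ⟨fun A => lin g (d A), hd1.map _ (fun v hv => lin_mem g hv), ?_⟩
    rw [dl_mapL, hd2]
    funext A; exact hf'l A
  | succ k ih =>
    intro b hb V _ _ _ _ G N hN hfg
    obtain ⟨r, g, ω, hg, rfl⟩ := exists_gens G hN hfg
    obtain ⟨C, hC⟩ := ih (b + 1) (by omega) (Fin r → Lau σ) (GrFree wt ω) (Rel g) (Rel_graded G hg) (Rel_fg g)
    refine ⟨C, fun c w hc hcb hdc hcw hw => ?_⟩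
    choose f hf1 hf2 using fun A => exists_lin_loc g (hc A)
    let f' : Finset σ → Fin r → Lau σ := trunc b fun A => (GrFree wt ω).comp w (f A)
    have hf'C : IsC (Sfree σ (Fin r)) f' := trunc_isC fun A => (Sfree_graded ω).loc (hf1 A) w
    have hf'l : ∀ A, lin g (f' A) = c A := by
      intro A
      simp only [f', trunc]
      split_ifs with h
      · rw [← G.comp_lin hg, hf2, hcw]
      · rw [map_zero, hcb A h]
    have hf'w : ∀ A, (GrFree wt ω).comp w (f' A) = f' A := by
      intro A
      simp only [f', trunc]
      split_ifs
      · exact Gr.comp_idem _ _ _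
      · simp
    have hf's : Supp f' b := trunc_supp _ _
    have hlc : (fun A => lin g (f' A)) = c := funext hf'l
    obtain ⟨d, hd1, hd2⟩ := hC (dl f') w (by
        intro A
        refine mem_loc_Rel (hf'C.dl A) ?_
        have := congrFun (dl_mapL (lin g) f') A
        rw [← this, hlc, hdc]; rfl) hf's.dl (dl_dl _) (Gr.dl_comp _ hf'w) hw
    have hd3 : dl (trunc b d) = dl f' := by
      rw [dl_trunc, hd2, trunc_eq hf's.dl]
    have hdS : IsC (Sfree σ (Fin r)) (trunc b d) :=
      fun A => loc_mono_left inf_le_left A (trunc_isC hd1 A)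
    obtain ⟨e, he1, he2, -⟩ := exact_free' (f' - trunc b d) (hf'C.sub hdS)
      (by rw [dl_sub, hd3, sub_self]) (b := b) (by
        intro A hA; rw [Pi.sub_apply, hf's A hA, trunc_supp b d A hA, sub_zero]) (by omega)
    refine ⟨fun A => lin g (e A), he1.map _ (fun v hv => lin_mem g hv), ?_⟩
    rw [dl_mapL, he2]
    funext A
    rw [Pi.sub_apply, map_sub, hf'l]
    obtain ⟨h, hh⟩ := trunc_isC (b := b) hd1 A
    have := (mem_Rel.1 hh).2
    rw [XA_smul, map_smul] at this
    have h2 : mon (-((h : ℤ) • ind A)) • mon ((h : ℤ) • ind A) • lin g (trunc b d A) = 0 := by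
      rw [this, smul_zero]
    rw [mon_smul_smul, neg_add_cancel, mon_zero_smul] at h2
    rw [h2, sub_zero]

end gr
end Cech
end SkewLC

namespace SkewLC
namespace Cech

section final
variable {σ : Type} [Fintype σ] [DecidableEq σ] {M : Type} [AddCommGroup M] {wt : σ → M}

variable {V : Type} [AddCommGroup V] [Module (Lau σ) V] [Module (Pol σ) V]
  [IsScalarTower (Pol σ) (Lau σ) V]

lemma smul_loc_univ {N : Submodule (Pol σ) V} {v : V} (hv : v ∈ N) (s : Lau σ) :
    s • v ∈ loc N Finset.univ := by
  induction s using lau_ind with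
  | h0 => simp
  | hadd x y hx hy => rw [add_smul]; exact add_mem hx hy
  | hm a c =>
    have h1 : (c • mon a : Lau σ) = toL σ (MvPolynomial.C c) * mon a := by
      rw [MvPolynomial.C_apply, toL_monomial, map_zero, mon_zero, smul_mul_assoc, one_mul]
    rw [h1, mul_smul, ← pol_smul]
    exact Submodule.smul_mem _ _ (mon_mem_loc (le_loc _ _ hv) a (by simp))

lemma Gr.comp_smulC (G : Gr wt V) (δ : M) (c : ℂ) (v : V) :
    G.comp δ ((c • (1 : Lau σ)) • v) = (c • (1 : Lau σ)) • G.comp δ v := by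
  have := G.comp_mon δ c 0 v
  have h0 : wtE wt (0 : σ → ℤ) = 0 := by simp [wtE]
  rwa [mon_zero, h0, sub_zero] at this

/-- residue pairing: existence of a Laurent kernel for a functional on a graded piece. -/
lemma exists_kernel (hfin : ∀ w : M, {a : σ → ℤ | (∀ p, 0 ≤ a p) ∧ wtE wt a = w}.Finite)
    {r : ℕ} (θ : Fin r → M) (δ : M) (lam : (Fin r → Lau σ) →ₗ[ℂ] ℂ) :
    ∃ k : Fin r → Lau σ, ∀ s : Fin r → Pol σ,
      ∑ l, (k l * toL σ (s l)).coeff (fun _ => -1) =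
        lam ((GrFree wt θ).comp δ (fun l => toL σ (s l))) := by
  classical
  let F : Fin r → Finset (σ → ℤ) := fun l => (hfin (δ - θ l)).toFinset
  let Lm : (Fin r → Lau σ) →+ ℂ := lam.toAddMonoidHom.comp ((GrFree wt θ).comp δ)
  have hLC : ∀ (c : ℂ) f, Lm (c • f) = c * Lm f := by
    intro c f
    have h1 : c • f = (c • (1 : Lau σ)) • f := by rw [smul_assoc, one_smul]
    have h2 : (c • (1 : Lau σ)) • (GrFree wt θ).comp δ f = c • (GrFree wt θ).comp δ f := by
      rw [smul_assoc, one_smul]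
    change lam ((GrFree wt θ).comp δ (c • f)) = c * lam ((GrFree wt θ).comp δ f)
    rw [h1, Gr.comp_smulC, h2, map_smul, smul_eq_mul]
  let k : Fin r → Lau σ := fun l => ∑ a ∈ F l, Lm (Pi.single l (mon a)) • mon (fun p => -1 - a p)
  have hk : ∀ l (s : Pol σ), (k l * toL σ s).coeff (fun _ => -1) = Lm (Pi.single l (toL σ s)) := by
    intro l s
    induction s using MvPolynomial.induction_on' with
    | add p q hp hq =>
      rw [map_add, mul_add, AddMonoidAlgebra.coeff_add, Finsupp.add_apply, hp, hq, Pi.single_add, map_add]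
    | monomial u c =>
      rw [toL_monomial, mul_smul_comm, AddMonoidAlgebra.coeff_smul_apply, mul_comm, coeff_mon_mul]
      have h1 : Pi.single l (c • mon (expHom σ u)) = c • (Pi.single l (mon (expHom σ u)) : Fin r → Lau σ) := by
        rw [Pi.single_smul]
      rw [h1, hLC, smul_eq_mul]
      congr 1
      simp only [k]
      rw [AddMonoidAlgebra.coeff_sum, Finsupp.finset_sum_apply]
      have h2 : ∀ a ∈ F l, ((Lm (Pi.single l (mon a)) • mon (fun p => -1 - a p) : Lau σ)).coeff
          ((fun _ => -1) - expHom σ u) = if a = expHom σ u then Lm (Pi.single l (mon (expHom σ u))) else 0 := by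
        intro a _
        rw [smul_mon, AddMonoidAlgebra.coeff_single, Finsupp.single_apply]
        have : ((fun p => -1 - a p) = ((fun _ => -1) - expHom σ u : σ → ℤ)) ↔ a = expHom σ u := by
          constructor
          · intro h; funext p
            have := congrFun h p
            simp only [Pi.sub_apply] at this
            linarith
          · rintro rfl; rfl
        simp only [this]
        split_ifs with h
        · rw [h]
        · rfl
      rw [Finset.sum_congr rfl h2, Finset.sum_ite_eq']
      split_ifs with h
      · rfl
      · symm
        change lam ((GrFree wt θ).comp δ _) = 0
        convert map_zero lam
        ext i b
        change _ = 0
        by_contra hne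
        obtain ⟨h3, h4⟩ := GrFree_coeff θ δ _ i b hne
        by_cases hil : i = l
        · subst hil
          rw [Pi.single_eq_same, mon, AddMonoidAlgebra.coeff_single, Finsupp.single_apply] at h4
          split_ifs at h4 with h5
          · subst h5
            apply h
            simp only [F, Set.Finite.mem_toFinset, Set.mem_setOf_eq]
            refine ⟨fun p => by simp [expHom], ?_⟩
            rw [← h3]; abel
          · exact h4 rfl
        · rw [Pi.single_eq_of_ne hil] at h4
          exact h4 rfl
  refine ⟨k, fun s => ?_⟩
  simp_rw [hk]
  rw [← map_sum]
  change _ = Lm _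
  congr 1
  exact Finset.univ_sum_single _

lemma XA_univ (p : σ) : XA (Finset.univ : Finset σ) = MvPolynomial.X p * XA (Finset.univ.erase p) := by
  rw [XA, XA, Finset.mul_prod_erase _ _ (Finset.mem_univ p)]

lemma extend_hom {ι ι' : Type} [Fintype ι] [Fintype ι']
    (hfin : ∀ w : M, {a : σ → ℤ | (∀ p, 0 ≤ a p) ∧ wtE wt a = w}.Finite)
    (ω' : ι' → M) (N' : Submodule (Pol σ) (ι' → Lau σ)) (N : Submodule (Pol σ) (ι → Lau σ))
    (hS' : N' ≤ Sfree σ ι') (hG : Graded (GrFree wt ω') N') (hfg : N'.FG)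
    (φ : (ι' → Lau σ) →ₗ[Lau σ] (ι → Lau σ)) (hφ : ∀ v ∈ N', φ v ∈ N)
    (H : ∀ ξ : ι' → Lau σ, ξ ∈ loc N' Finset.univ → (∀ i a, (∀ p, a p < 0) → (ξ i).coeff a = 0) →
      ∃ d : σ → ι → Lau σ, (∀ p, d p ∈ loc N (Finset.univ.erase p)) ∧ φ ξ = ∑ p, d p)
    (α : N →ₗ[Pol σ] Pol σ) :
    ∃ β : Sfree σ ι' →ₗ[Pol σ] Pol σ, ∀ v (hv : v ∈ N'), β ⟨v, hS' hv⟩ = α ⟨φ v, hφ v hv⟩ := by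
  classical
  obtain ⟨r, g, θ, hg, hspan⟩ := exists_gens _ hG hfg
  have hgN : ∀ l, g l ∈ N' := fun l => by rw [← hspan]; exact Submodule.subset_span ⟨l, rfl⟩
  choose gp hgp using fun l => hS' (hgN l)
  let v : Fin r → Pol σ := fun l => α ⟨φ (g l), hφ _ (hgN l)⟩
  let colP : ι' → Fin r → Pol σ := fun i l => gp l i
  by_cases hv : v ∈ Submodule.span (Pol σ) (Set.range colP)
  · rw [Submodule.mem_span_range_iff_exists_fun] at hv
    obtain ⟨b, hb⟩ := hv
    let β : Sfree σ ι' →ₗ[Pol σ] Pol σ :=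
      (Fintype.linearCombination (Pol σ) b).comp (freeEquiv σ ι').symm.toLinearMap
    refine ⟨β, ?_⟩
    let α' : N' →ₗ[Pol σ] Pol σ :=
      α.comp (((φ.restrictScalars (Pol σ)).restrict (p := N') (q := N) hφ))
    let β' : N' →ₗ[Pol σ] Pol σ := β.comp (Submodule.inclusion hS')
    have hβα : β' = α' := by
      subst hspan
      refine LinearMap.ext_on (s := Set.range (fun l => (⟨g l, hgN l⟩ : Submodule.span (Pol σ) (Set.range g))))
        ?_ ?_
      · rw [← Submodule.map_injective_of_injective (Submodule.injective_subtype _) |>.eq_iff, Submodule.map_span,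
          Submodule.map_subtype_top, ← Set.range_comp]
        rfl
      · rintro _ ⟨l, rfl⟩
        have h1 : (freeEquiv σ ι').symm ⟨g l, hS' (hgN l)⟩ = gp l := by
          rw [LinearEquiv.symm_apply_eq]
          apply Subtype.ext
          funext i
          rw [freeEquiv_apply, hgp]
        have h2 : β' ⟨g l, hgN l⟩ = ∑ i, gp l i * b i := by
          change Fintype.linearCombination (Pol σ) b ((freeEquiv σ ι').symm ⟨g l, hS' (hgN l)⟩) = _
          rw [h1]; rfl
        rw [h2]
        change _ = v l
        rw [← hb]
        simp [colP, Finset.sum_apply, mul_comm]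
    intro w hw
    have := LinearMap.congr_fun hβα ⟨w, hw⟩
    exact this
  · exfalso
    let colL : ι' → Fin r → Lau σ := fun i l => g l i
    let G2 : Gr wt (Fin r → Lau σ) := GrFree wt (fun l => - θ l)
    have hcol : ∀ i, G2.comp (- ω' i) (colL i) = colL i := by
      intro i
      ext l a
      change (fil (fun a => wtE wt a + - θ l = - ω' i) (g l i)).coeff a = (g l i).coeff a
      rw [fil_coeff]
      split_ifs with h
      · rfl
      · by_contra hne
        have h1 : (((GrFree wt ω').comp (θ l) (g l)) i).coeff a ≠ 0 := by
          rw [hg]; exact Ne.symm hne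
        have h2 := (GrFree_coeff ω' (θ l) _ i a h1).1
        apply h
        rw [← h2]; abel
    let WL : Submodule (Pol σ) (Fin r → Lau σ) := Submodule.span (Pol σ) (Set.range colL)
    have hWL : Graded G2 WL := span_graded G2 hcol
    let vL : Fin r → Lau σ := fun l => toL σ (v l)
    have hvL : vL ∉ WL := by
      intro h
      apply hv
      rw [Submodule.mem_span_range_iff_exists_fun] at h ⊢
      obtain ⟨b, hb⟩ := h
      refine ⟨b, ?_⟩
      funext l
      apply toL_inj
      have := congrFun hb l
      simp only [Finset.sum_apply, Pi.smul_apply] at this ⊢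
      change _ = vL l
      rw [← this, map_sum]
      refine Finset.sum_congr rfl fun i _ => ?_
      rw [smul_eq_mul, map_mul, hgp]; rfl
    obtain ⟨δ, hδ⟩ : ∃ δ, G2.comp δ vL ∉ WL := by
      by_contra hcon
      push Not at hcon
      obtain ⟨T, hT⟩ := G2.fin vL
      apply hvL
      rw [← hT]
      exact Submodule.sum_mem _ fun δ _ => hcon δ
    obtain ⟨lam, hl1, hl2⟩ := Submodule.exists_le_ker_of_notMem (p := WL.restrictScalars ℂ)
      (v := G2.comp δ vL) hδ
    obtain ⟨k, hk⟩ := exists_kernel (wt := wt) hfin (fun l => - θ l) δ lam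
    have hkv : ∑ l, (k l * toL σ (v l)).coeff (fun _ => -1) ≠ 0 := by
      rw [hk]; exact hl1
    have hξ1 : lin g k ∈ loc N' Finset.univ := by
      rw [lin_apply]
      exact Submodule.sum_mem _ fun l _ => smul_loc_univ (hgN l) _
    obtain ⟨d, hd, hdφ⟩ := H (lin g k) hξ1 (by
      intro i a ha
      obtain ⟨s, hs⟩ := mon_mem_range (fun p => -1 - a p) (fun p => by have := ha p; omega)
      have h1 : (lin g k i).coeff a = (toL σ s * lin g k i).coeff (fun _ => -1) := by
        rw [hs, coeff_mon_mul]
        congr 1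
        funext p; simp
      have h2 : toL σ s * lin g k i = ∑ l, k l * toL σ (s * gp l i) := by
        rw [lin_apply, Finset.sum_apply, Finset.mul_sum]
        refine Finset.sum_congr rfl fun l _ => ?_
        rw [map_mul, hgp, Pi.smul_apply, smul_eq_mul]; ring
      rw [h1, h2, AddMonoidAlgebra.coeff_sum, Finsupp.finset_sum_apply, hk]
      have h3 : (fun l => toL σ (s * gp l i)) = s • colL i := by
        funext l
        rw [map_mul, hgp]; rfl
      rw [h3]
      exact hl2 (hWL _ (Submodule.smul_mem _ _ (Submodule.subset_span ⟨i, rfl⟩)) δ))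
    -- clear denominators
    choose hh hhd using hd
    obtain ⟨h0, hh0⟩ : k ∈ loc (Sfree σ (Fin r)) Finset.univ := by
      rw [mem_loc_Sfree]
      intro i b hb p hp
      simp at hp
    let h : ℕ := h0 + 1 + ∑ p, hh p
    have hhp : ∀ p, hh p ≤ h := fun p => by
      have := Finset.single_le_sum (f := hh) (fun _ _ => Nat.zero_le _) (Finset.mem_univ p)
      simp only [h]; omega
    have hdh : ∀ p, XA (Finset.univ.erase p) ^ h • d p ∈ N :=
      fun p => smul_of_dvd (pow_dvd_pow _ (hhp p)) (hhd p)
    have hkh : XA Finset.univ ^ h • k ∈ Sfree σ (Fin r) :=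
      smul_of_dvd (pow_dvd_pow _ (by simp only [h]; omega)) hh0
    choose q hq using hkh
    have e1 : XA (Finset.univ : Finset σ) ^ h • φ (lin g k) = ∑ l, q l • φ (g l) := by
      rw [lin_apply g k, map_sum, Finset.smul_sum]
      refine Finset.sum_congr rfl fun l _ => ?_
      rw [map_smul, pol_smul (q l), hq, Pi.smul_apply, smul_assoc]
    have e2 : XA (Finset.univ : Finset σ) ^ h • φ (lin g k) =
        ∑ p, (MvPolynomial.X p ^ h : Pol σ) • (XA (Finset.univ.erase p) ^ h • d p) := by
      rw [hdφ, Finset.smul_sum]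
      refine Finset.sum_congr rfl fun p _ => ?_
      rw [smul_smul, ← mul_pow, ← XA_univ]
    have e3 : ∑ l, q l * v l = ∑ p, (MvPolynomial.X p ^ h : Pol σ) * α ⟨_, hdh p⟩ := by
      have e4 : ∑ l, q l • (⟨φ (g l), hφ _ (hgN l)⟩ : N) =
          ∑ p, (MvPolynomial.X p ^ h : Pol σ) • (⟨_, hdh p⟩ : N) := by
        apply Subtype.ext
        rw [AddSubmonoidClass.coe_finset_sum, AddSubmonoidClass.coe_finset_sum]
        simp only [Submodule.coe_smul]
        rw [← e1, ← e2]
      have e5 := congrArg α e4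
      rw [map_sum, map_sum] at e5
      simp only [map_smul, smul_eq_mul] at e5
      exact e5
    let u : σ →₀ ℕ := Finsupp.equivFunOnFinite.symm fun _ => h - 1
    have e6 := congrArg (MvPolynomial.coeff u) e3
    have e7 : MvPolynomial.coeff u (∑ p, (MvPolynomial.X p ^ h : Pol σ) * α ⟨_, hdh p⟩) = 0 := by
      rw [MvPolynomial.coeff_sum]
      refine Finset.sum_eq_zero fun p _ => ?_
      rw [MvPolynomial.X_pow_eq_monomial, MvPolynomial.coeff_monomial_mul', if_neg]
      intro hle
      have := hle p
      simp [u, h] at this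
    rw [e7] at e6
    apply hkv
    rw [← e6, ← toL_coeff, map_sum, AddMonoidAlgebra.coeff_sum, Finsupp.finset_sum_apply]
    refine Finset.sum_congr rfl fun l _ => ?_
    rw [map_mul, hq, Pi.smul_apply, smul_def', toL_XA_pow, mul_assoc, coeff_mon_mul]
    congr 1
    funext p
    simp [expHom, u, ind, h]

end final
end Cech
end SkewLC

namespace SkewLC
namespace Cech
section bridge
open CategoryTheory Opposite

lemma sc_zero {R : Type} [CommRing R] {S₁ S₂ : ShortComplex (ModuleCat.{0} R)} (φ : S₁ ⟶ S₂)
    (h : ∀ x : S₁.X₂, S₁.g.hom x = 0 → ∃ y : S₂.X₁, S₂.f.hom y = φ.τ₂.hom x) :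
    ShortComplex.homologyMap φ = 0 := by
  rw [← cancel_epi S₁.homologyπ, ShortComplex.homologyπ_naturality, Limits.comp_zero]
  ext z
  obtain ⟨y, hy⟩ := h (S₁.iCycles.hom z) (by
    rw [← LinearMap.comp_apply, ← ModuleCat.hom_comp, S₁.iCycles_g]; rfl)
  have h1 : (ShortComplex.cyclesMap φ).hom z = S₂.toCycles.hom y := by
    have inj : Function.Injective S₂.iCycles.hom := (ModuleCat.mono_iff_injective _).1 inferInstance
    apply inj
    have e1 := congrArg (fun f => f.hom z) (ShortComplex.cyclesMap_i φ)
    have e2 := congrArg (fun f => f.hom y) (S₂.toCycles_i)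
    simp only [ModuleCat.hom_comp, LinearMap.comp_apply] at e1 e2
    rw [e1, e2, hy]
  have e3 := congrArg (fun f => f.hom y) (S₂.toCycles_comp_homologyπ)
  simp only [ModuleCat.hom_comp, LinearMap.comp_apply] at e3 ⊢
  rw [h1, e3]; rfl

lemma sc_zero_op {R : Type} [CommRing R] {S₁ S₂ : ShortComplex (ModuleCat.{0} R)ᵒᵖ} (φ : S₁ ⟶ S₂)
    (h : ∀ x : S₂.X₂.unop, S₂.f.unop.hom x = 0 → ∃ y : S₁.X₃.unop, S₁.g.unop.hom y = φ.τ₂.unop.hom x) :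
    ShortComplex.homologyMap φ = 0 := by
  have h0 := sc_zero (ShortComplex.unopMap φ) h
  have h1 := ShortComplex.homologyMap_op (ShortComplex.unopMap φ)
  rw [h0] at h1
  have h2 : ShortComplex.homologyMap (ShortComplex.opMap (ShortComplex.unopMap φ)) = 0 := by
    rw [show (0 : S₂.unop.homology ⟶ S₁.unop.homology).op = 0 from rfl] at h1
    have h3 := congrArg (fun t => (S₁.unop.homologyOpIso).hom ≫ t ≫ (S₂.unop.homologyOpIso).inv) h1
    simpa using h3.symm
  exact h2

lemma bridge {R : Type} [CommRing R] {X X' Y : ModuleCat.{0} R} (g : X ⟶ X') (j : ℕ)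
    (h : ∀ y : Abelian.Ext.{0} X' Y (j+1), (Abelian.Ext.mk₀ g).comp y (zero_add _) = 0) :
    (((Ext R (ModuleCat.{0} R) (j+1)).map g.op).app Y) = 0 := by
  let P : ProjectiveResolution X := (HasProjectiveResolution.out).some
  let Q : ProjectiveResolution X' := (HasProjectiveResolution.out).some
  let ψ := ProjectiveResolution.lift g P Q
  have hψ : ψ ≫ Q.π = P.π ≫ (ChainComplex.single₀ _).map g := ProjectiveResolution.lift_commutes g P Q
  have key : ∀ f : Q.complex.X (j+1) ⟶ Y, Q.complex.d (j+2) (j+1) ≫ f = 0 →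
      ∃ u : P.complex.X j ⟶ Y, P.complex.d (j+1) j ≫ u = ψ.f (j+1) ≫ f := by
    intro f hf
    have h1 := ProjectiveResolution.mk₀_comp_extMk f (j+2) rfl hf (R' := P) (g := g)
      ⟨ψ, by
        have := congrArg (fun t => t.f 0) hψ
        simpa using this⟩
    rw [h] at h1
    exact (P.extMk_eq_zero_iff _ (j+2) rfl _ j rfl).1 h1.symm
  let F := ((linearYoneda R (ModuleCat.{0} R)).obj Y).rightOp
  change ((F.leftDerived (j+1)).map g).unop = 0
  rw [Functor.leftDerived_map_eq F (j+1) g ψ hψ]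
  have h5 : (F.mapHomologicalComplex _ ⋙ HomologicalComplex.homologyFunctor _ _ (j+1)).map ψ = 0 := by
    have key' : ∀ p q, p = j + 2 → q = j → ∀ f : Q.complex.X (j+1) ⟶ Y, Q.complex.d p (j+1) ≫ f = 0 →
      ∃ u : P.complex.X q ⟶ Y, P.complex.d (j+1) q ≫ u = ψ.f (j+1) ≫ f := by
      rintro _ _ rfl rfl; exact key
    refine sc_zero_op _ ?_
    intro x hx
    exact key' _ _ (by simp) (by simp) x hx
  rw [h5, Limits.zero_comp, Limits.comp_zero]; rfl

end bridge

section extzero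
open CategoryTheory

/-- the short complex of a presentation -/
def presSC {R : Type} [CommRing R] {Ω P N : Type} [AddCommGroup Ω] [AddCommGroup P] [AddCommGroup N]
    [Module R Ω] [Module R P] [Module R N] (i : Ω →ₗ[R] P) (π : P →ₗ[R] N) (h : ∀ x, π (i x) = 0) :
    ShortComplex (ModuleCat.{0} R) :=
  ShortComplex.mk (ModuleCat.ofHom i) (ModuleCat.ofHom π) (by ext x; exact h x)

lemma presSC_exact {R : Type} [CommRing R] {Ω P N : Type} [AddCommGroup Ω] [AddCommGroup P] [AddCommGroup N]
    [Module R Ω] [Module R P] [Module R N] (i : Ω →ₗ[R] P) (π : P →ₗ[R] N) (h : ∀ x, π (i x) = 0)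
    (hi : Function.Injective i) (hπ : Function.Surjective π) (hex : ∀ x, π x = 0 → ∃ y, i y = x) :
    (presSC i π h).ShortExact := by
  have h1 : Mono (presSC i π h).f := (ModuleCat.mono_iff_injective _).2 hi
  have h2 : Epi (presSC i π h).g := (ModuleCat.epi_iff_surjective _).2 hπ
  refine ⟨?_⟩
  rw [ShortComplex.moduleCat_exact_iff]
  exact hex

lemma ext_step {R : Type} [CommRing R] {Ω P N Ω' P' N' : Type} [AddCommGroup Ω] [AddCommGroup P] [AddCommGroup N]
    [Module R Ω] [Module R P] [Module R N] (i : Ω →ₗ[R] P) (π : P →ₗ[R] N) (h : ∀ x, π (i x) = 0)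
    (hS : (presSC i π h).ShortExact)
    [AddCommGroup Ω'] [AddCommGroup P'] [AddCommGroup N']
    [Module R Ω'] [Module R P'] [Module R N'] (i' : Ω' →ₗ[R] P') (π' : P' →ₗ[R] N') (h' : ∀ x, π' (i' x) = 0)
    (hS' : (presSC i' π' h').ShortExact) [Module.Projective R P]
    (a : Ω' →ₗ[R] Ω) (b : P' →ₗ[R] P) (c : N' →ₗ[R] N) (hab : ∀ x, i (a x) = b (i' x))
    (hbc : ∀ x, π (b x) = c (π' x)) (Y : ModuleCat.{0} R) (j : ℕ)
    (y : Abelian.Ext.{0} (ModuleCat.of R N) Y (j+1)) :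
    ∃ y0 : Abelian.Ext.{0} (ModuleCat.of R Ω) Y j,
      (Abelian.Ext.mk₀ (ModuleCat.ofHom c)).comp y (zero_add _) =
      hS'.extClass.comp ((Abelian.Ext.mk₀ (ModuleCat.ofHom a)).comp y0 (zero_add _)) (add_comm 1 j) := by
  have : Projective (presSC i π h).X₂ := (IsProjective.iff_projective P).1 inferInstance
  obtain ⟨y0, hy0⟩ := Abelian.Ext.contravariant_sequence_exact₃ hS Y y
    (Abelian.Ext.eq_zero_of_projective _) (add_comm 1 j)
  let f : presSC i' π' h' ⟶ presSC i π h :=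
    { τ₁ := ModuleCat.ofHom a
      τ₂ := ModuleCat.ofHom b
      τ₃ := ModuleCat.ofHom c
      comm₁₂ := by ext x; exact hab x
      comm₂₃ := by ext x; exact hbc x }
  refine ⟨y0, ?_⟩
  have := ShortComplex.ShortExact.extClass_naturality hS' hS f
  rw [← hy0]
  have h1 := Abelian.Ext.comp_assoc_of_second_deg_zero hS'.extClass (Abelian.Ext.mk₀ f.τ₁) y0 (add_comm 1 j)
  have h2 := Abelian.Ext.comp_assoc (Abelian.Ext.mk₀ f.τ₃) hS.extClass y0 (zero_add 1) (add_comm 1 j) (show 0 + 1 + j = j + 1 by omega)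
  exact h2.symm.trans ((congrArg (fun t => Abelian.Ext.comp t y0 (add_comm 1 j)) this.symm).trans h1)

end extzero
end Cech
end SkewLC

namespace SkewLC
namespace Cech
section extz
open CategoryTheory
variable {σ : Type} [Fintype σ] [DecidableEq σ] {M : Type} [AddCommGroup M] {wt : σ → M}

/-- restriction of a Laurent-linear map -/
def rst {V V' : Type} [AddCommGroup V] [Module (Lau σ) V] [Module (Pol σ) V]
  [IsScalarTower (Pol σ) (Lau σ) V] [AddCommGroup V'] [Module (Lau σ) V'] [Module (Pol σ) V']
  [IsScalarTower (Pol σ) (Lau σ) V'] (f : V' →ₗ[Lau σ] V) (N' : Submodule (Pol σ) V')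
  (N : Submodule (Pol σ) V) (hf : ∀ v ∈ N', f v ∈ N) : N' →ₗ[Pol σ] N :=
  (f.restrictScalars (Pol σ)).restrict hf

section pres
variable {V : Type} [AddCommGroup V] [Module (Lau σ) V] [Module (Pol σ) V]
  [IsScalarTower (Pol σ) (Lau σ) V]

lemma Rel_le {ι : Type} [Fintype ι] (g : ι → V) : Rel (σ := σ) g ≤ Sfree σ ι := inf_le_left

lemma pres_exact {ι : Type} [Fintype ι] (g : ι → V) :
    (presSC (Submodule.inclusion (Rel_le (σ := σ) g))
      (rst (lin g) (Sfree σ ι) (Submodule.span (Pol σ) (Set.range g)) (fun v hv => lin_mem g hv))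
      (fun x => Subtype.ext (mem_Rel.1 x.2).2)).ShortExact := by
  apply presSC_exact
  · exact Submodule.inclusion_injective _
  · rintro ⟨v, hv⟩
    obtain ⟨f, hf, rfl⟩ := exists_lin g hv
    exact ⟨⟨f, hf⟩, rfl⟩
  · rintro ⟨x, hx⟩ h
    exact ⟨⟨x, mem_Rel.2 ⟨hx, congrArg Subtype.val h⟩⟩, rfl⟩

lemma exists_gens' {N : Submodule (Pol σ) V} (hfg : N.FG) :
    ∃ (r : ℕ) (g : Fin r → V), Submodule.span (Pol σ) (Set.range g) = N := by
  obtain ⟨T, hT⟩ := hfg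
  refine ⟨T.card, fun i => (T.equivFin.symm i : V), ?_⟩
  rw [← hT]
  congr 1
  ext x
  constructor
  · rintro ⟨i, rfl⟩; exact (T.equivFin.symm i).2
  · intro hx; exact ⟨T.equivFin ⟨x, hx⟩, by simp⟩

end pres

instance sfree_proj (ι : Type) [Fintype ι] : Module.Projective (Pol σ) (Sfree σ ι) :=
  Module.Projective.of_equiv (freeEquiv σ ι)

theorem ext_zero (hfin : ∀ w : M, {a : σ → ℤ | (∀ p, 0 ≤ a p) ∧ wtE wt a = w}.Finite) :
    ∀ (j b : ℕ), b + (j + 1) = Fintype.card σ →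
    ∀ (V V' : Type) [AddCommGroup V] [Module (Lau σ) V] [Module (Pol σ) V]
      [IsScalarTower (Pol σ) (Lau σ) V] [AddCommGroup V'] [Module (Lau σ) V'] [Module (Pol σ) V']
      [IsScalarTower (Pol σ) (Lau σ) V'] (G : Gr wt V') (f : V' →ₗ[Lau σ] V)
      (N' : Submodule (Pol σ) V') (N : Submodule (Pol σ) V) (hf : ∀ v ∈ N', f v ∈ N),
      Graded G N' → N'.FG → N.FG → HZ f N' N b →
      ∀ y : Abelian.Ext.{0} (ModuleCat.of (Pol σ) N) (ModuleCat.of (Pol σ) (Pol σ)) (j+1),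
        (Abelian.Ext.mk₀ (ModuleCat.ofHom (rst f N' N hf))).comp y (zero_add _) = 0 := by
  intro j
  induction j with
  | zero =>
    intro b hb V V' _ _ _ _ _ _ _ _ G f N' N hf hG hN' hN H y
    obtain ⟨r', g', ω, hg', rfl⟩ := exists_gens G hG hN'
    obtain ⟨r, g, rfl⟩ := exists_gens' hN
    choose q hq1 hq2 using fun i => exists_lin g (hf (g' i) (Submodule.subset_span ⟨i, rfl⟩))
    have hlin : ∀ v : Fin r' → Lau σ, lin g (lin q v) = f (lin g' v) := by
      intro v
      simp only [lin_apply q, lin_apply g', map_sum, map_smul, hq2]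
    have hqS : ∀ v ∈ Sfree σ (Fin r'), lin q v ∈ Sfree σ (Fin r) := by
      intro v hv
      refine (Submodule.span_le.2 ?_) (lin_mem q hv)
      rintro _ ⟨i, rfl⟩; exact hq1 i
    have hqR : ∀ v ∈ Rel (σ := σ) g', lin q v ∈ Rel (σ := σ) g := by
      intro v hv
      rw [mem_Rel] at hv ⊢
      exact ⟨hqS v hv.1, by rw [hlin, hv.2, map_zero]⟩
    obtain ⟨y0, hy0⟩ := ext_step _ _ _ (pres_exact g) _ _ _ (pres_exact g')
      (rst (lin q) (Rel g') (Rel g) hqR) (rst (lin q) _ _ hqS) (rst f _ _ hf)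
      (fun x => rfl) (fun x => Subtype.ext (hlin x)) _ _ y
    rw [hy0]
    obtain ⟨α, rfl⟩ := (Abelian.Ext.mk₀_bijective _ _).2 y0
    obtain ⟨β, hβ⟩ := extend_hom hfin ω (Rel g') (Rel g) (Rel_le g') (Rel_graded G hg') (Rel_fg g')
      (lin q) hqR (by
        intro ξ hξ hneg
        have hξS : ξ ∈ loc (Sfree σ (Fin r')) Finset.univ := loc_mono_left (Rel_le g') _ hξ
        let c : Finset σ → Fin r' → Lau σ := trunc (b+1) (fun _ => ξ)
        have hcS : Supp c (b+1) := fun A hA => by simp only [c, trunc, if_neg hA]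
        have hcR : IsC (Rel g') c := by
          intro A
          by_cases hA : A.card = b + 1
          · have : A = Finset.univ := (Finset.card_eq_iff_eq_univ A).1 (by omega)
            simp only [c, trunc, if_pos hA]; rw [this]; exact hξ
          · rw [hcS A hA]; exact zero_mem _
        have hdc : dl c = 0 := by
          funext A
          refine hcS.dl A ?_
          have := Finset.card_le_univ A
          omega
        obtain ⟨d', hd', hdd, hds⟩ := exact_free c (fun A => loc_mono_left (Rel_le g') _ (hcR A)) hdc (by
          intro A i a ha
          by_cases hA : A.card = b + 1
          · simp only [c, trunc, if_pos hA]; exact hneg i a ha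
          · rw [hcS A hA]; rfl)
        obtain ⟨d, hd, hdd2⟩ := step g g' f (lin q) hqS hlin b H c d' hcR hd' (hds b hcS) hdd
        refine ⟨fun p => sgn p Finset.univ • d (Finset.univ.erase p), fun p => zsmul_mem (hd _) _, ?_⟩
        have := congrFun hdd2 Finset.univ
        have hcu : c Finset.univ = ξ := by
          simp only [c, trunc]; rw [if_pos]; rw [Finset.card_univ]; omega
        rw [hcu] at this
        exact this.symm) α.hom
    have h1 : ModuleCat.ofHom (rst (lin q) (Rel g') (Rel g) hqR) ≫ α =
        ModuleCat.ofHom (Submodule.inclusion (Rel_le (σ := σ) g')) ≫ (ModuleCat.ofHom β) := by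
      apply ModuleCat.hom_ext
      apply LinearMap.ext
      intro x
      exact (hβ x.1 x.2).symm
    rw [Abelian.Ext.mk₀_comp_mk₀, h1, ← Abelian.Ext.mk₀_comp_mk₀]
    exact ShortComplex.ShortExact.extClass_comp_assoc (pres_exact (σ := σ) g') _
  | succ j ih =>
    intro b hb V V' _ _ _ _ _ _ _ _ G f N' N hf hG hN' hN H y
    obtain ⟨r', g', ω, hg', rfl⟩ := exists_gens G hG hN'
    obtain ⟨r, g, rfl⟩ := exists_gens' hN
    choose q hq1 hq2 using fun i => exists_lin g (hf (g' i) (Submodule.subset_span ⟨i, rfl⟩))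
    have hlin : ∀ v : Fin r' → Lau σ, lin g (lin q v) = f (lin g' v) := by
      intro v
      simp only [lin_apply q, lin_apply g', map_sum, map_smul, hq2]
    have hqS : ∀ v ∈ Sfree σ (Fin r'), lin q v ∈ Sfree σ (Fin r) := by
      intro v hv
      refine (Submodule.span_le.2 ?_) (lin_mem q hv)
      rintro _ ⟨i, rfl⟩; exact hq1 i
    have hqR : ∀ v ∈ Rel (σ := σ) g', lin q v ∈ Rel (σ := σ) g := by
      intro v hv
      rw [mem_Rel] at hv ⊢
      exact ⟨hqS v hv.1, by rw [hlin, hv.2, map_zero]⟩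
    obtain ⟨y0, hy0⟩ := ext_step _ _ _ (pres_exact g) _ _ _ (pres_exact g')
      (rst (lin q) (Rel g') (Rel g) hqR) (rst (lin q) _ _ hqS) (rst f _ _ hf)
      (fun x => rfl) (fun x => Subtype.ext (hlin x)) _ _ y
    rw [hy0]
    have := ih (b+1) (by omega) _ _ (GrFree wt ω) (lin q) (Rel g') (Rel g) hqR (Rel_graded G hg')
      (Rel_fg g') (Rel_fg g) (by
        intro c hc hcb hdc
        obtain ⟨d', hd', hdd, hds⟩ := exact_free' c (fun A => loc_mono_left (Rel_le g') _ (hc A)) hdc hcb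
          (by omega)
        exact step g g' f (lin q) hqS hlin b H c d' hc hd' (hds b hcb) hdd) y0
    rw [this]
    exact Abelian.Ext.comp_zero _ _ _ _ _

end extz
end Cech
end SkewLC

namespace SkewLC
namespace Cech
section weyl

/-- Kronecker delta -/
def dlt {n : ℕ} (R : Type) [CommRing R] (i j : Fin n) : R := if i = j then 1 else 0

/-- a commutative algebra with skew-symmetric coordinates and partial derivatives -/
structure WD (n : ℕ) (R : Type) [CommRing R] [Algebra ℂ R] where
  X : Fin n → Fin n → R
  D : Fin n → Fin n → Derivation ℂ R R
  Xs : ∀ i j, X i j = - X j i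
  Ds : ∀ i j v, D i j v = - D j i v
  Dc : ∀ i j k l v, D i j (D k l v) = D k l (D i j v)
  DX : ∀ i j k l, D i j (X k l) = dlt R i k * dlt R j l - dlt R i l * dlt R j k

namespace WD
variable {n : ℕ} {R : Type} [CommRing R] [Algebra ℂ R] (w : WD n R)

lemma dlt_sum (i : Fin n) (f : Fin n → R) : ∑ k, dlt R i k * f k = f i := by
  simp [dlt]

lemma dlt_sum' (i : Fin n) (f : Fin n → R) : ∑ k, dlt R k i * f k = f i := by
  simp [dlt]

lemma dlt_comm (i j : Fin n) : dlt R i j = dlt R j i := by simp only [dlt, eq_comm]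

lemma dlt_map (d : Derivation ℂ R R) (i j : Fin n) : d (dlt R i j) = 0 := by
  unfold dlt; split_ifs <;> simp

/-- Euler type operators -/
def E (a b : Fin n) : Derivation ℂ R R := ∑ k, w.X a k • w.D b k

lemma E_apply (a b : Fin n) (v : R) : w.E a b v = ∑ k, w.X a k * w.D b k v := by
  have h : ∀ s : Finset (Fin n), (∑ k ∈ s, w.X a k • w.D b k) v = ∑ k ∈ s, w.X a k * w.D b k v := by
    intro s
    induction s using Finset.induction_on with
    | empty => simp
    | insert x s hx ih => rw [Finset.sum_insert hx, Finset.sum_insert hx, Derivation.add_apply, ih]; simp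
  exact h _

lemma EX (a b k l : Fin n) : w.E a b (w.X k l) = dlt R b k * w.X a l + dlt R b l * w.X k a := by
  rw [E_apply]
  simp only [w.DX, mul_sub, Finset.sum_sub_distrib]
  have h1 : ∑ q, w.X a q * (dlt R b k * dlt R q l) = dlt R b k * w.X a l := by
    rw [← dlt_sum' l (fun q => w.X a q), Finset.mul_sum]
    exact Finset.sum_congr rfl fun q _ => by ring
  have h2 : ∑ q, w.X a q * (dlt R b l * dlt R q k) = dlt R b l * w.X a k := by
    rw [← dlt_sum' k (fun q => w.X a q), Finset.mul_sum]
    exact Finset.sum_congr rfl fun q _ => by ring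
  rw [h1, h2, w.Xs k a]; ring

lemma DE (i j a b : Fin n) (v : R) :
    w.D i j (w.E a b v) = w.E a b (w.D i j v) + dlt R i a * w.D b j v + dlt R j a * w.D i b v := by
  simp only [E_apply, map_sum, Derivation.leibniz, smul_eq_mul, Finset.sum_add_distrib, w.DX, mul_sub,
    Finset.sum_sub_distrib]
  have h1 : ∑ q, w.D b q v * (dlt R i a * dlt R j q) = dlt R i a * w.D b j v := by
    rw [← dlt_sum j (fun q => w.D b q v), Finset.mul_sum]
    exact Finset.sum_congr rfl fun q _ => by ring
  have h2 : ∑ q, w.D b q v * (dlt R i q * dlt R j a) = dlt R j a * w.D b i v := by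
    rw [← dlt_sum i (fun q => w.D b q v), Finset.mul_sum]
    exact Finset.sum_congr rfl fun q _ => by ring
  rw [h1, h2, w.Ds i b]
  have h3 : ∑ q, w.X a q * w.D i j (w.D b q v) = ∑ q, w.X a q * w.D b q (w.D i j v) :=
    Finset.sum_congr rfl fun q _ => by rw [w.Dc]
  rw [h3]; ring

lemma EE (i j k l : Fin n) (v : R) :
    w.E i j (w.E k l v) = w.E k l (w.E i j v) + dlt R j k * w.E i l v - dlt R i l * w.E k j v := by
  have e1 : w.E i j (w.E k l v) = ∑ q, w.X k q * w.E i j (w.D l q v) + dlt R j k * w.E i l v + w.X k i * w.D l j v := by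
    rw [E_apply w k l, map_sum]
    simp only [Derivation.leibniz, smul_eq_mul, EX, Finset.sum_add_distrib]
    rw [E_apply w i l, Finset.mul_sum, add_assoc]
    congr 1
    rw [← dlt_sum j (fun q => w.X k i * w.D l q v), ← Finset.sum_add_distrib]
    exact Finset.sum_congr rfl fun q _ => by ring
  have e2 : w.E k l (w.E i j v) = ∑ q, w.X k q * w.E i j (w.D l q v) + dlt R i l * w.E k j v + w.X k i * w.D l j v := by
    rw [E_apply w k l]
    simp only [DE, mul_add, Finset.sum_add_distrib]
    rw [E_apply w k j, Finset.mul_sum]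
    congr 1
    · congr 1
      exact Finset.sum_congr rfl fun q _ => by rw [dlt_comm l i]; ring
    · rw [← dlt_sum' i (fun q => w.X k q * w.D l j v)]
      exact Finset.sum_congr rfl fun q _ => by ring
  rw [e1, e2]; ring

/-- the second order operators -/
def F (i j : Fin n) (v : R) : R := ∑ a, w.E a i (w.D a j v)

lemma F_add (i j : Fin n) (v v' : R) : w.F i j (v + v') = w.F i j v + w.F i j v' := by
  simp [F, Finset.sum_add_distrib]

lemma F_smul (i j : Fin n) (c : ℂ) (v : R) : w.F i j (c • v) = c • w.F i j v := by
  simp [F, Finset.smul_sum]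

lemma F_eq (i j : Fin n) (v : R) : w.F i j v = ∑ a, ∑ k, w.X a k * w.D i k (w.D a j v) := by
  simp only [F, E_apply]

lemma F_skew (i j : Fin n) (v : R) : w.F i j v = - w.F j i v := by
  rw [F_eq, F_eq, Finset.sum_comm, ← Finset.sum_neg_distrib]
  refine Finset.sum_congr rfl fun c _ => ?_
  rw [← Finset.sum_neg_distrib]
  refine Finset.sum_congr rfl fun k _ => ?_
  rw [w.Dc, w.Xs k c, w.Ds k j, w.Ds i c, map_neg]; ring

lemma FE (i j a b : Fin n) (v : R) :
    w.F i j (w.E a b v) = w.E a b (w.F i j v) + dlt R i a * w.F b j v + dlt R j a * w.F i b v := by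
  simp only [F, map_sum, Finset.mul_sum]
  simp only [DE, map_add, Derivation.leibniz, smul_eq_mul, dlt_map, mul_zero, add_zero, Finset.sum_add_distrib]
  have h1 : ∑ c, w.E c i (w.E a b (w.D c j v)) = ∑ c, w.E a b (w.E c i (w.D c j v)) +
      ∑ c, dlt R i a * w.E c b (w.D c j v) - w.E a i (w.D b j v) := by
    rw [← dlt_sum' b (fun c => w.E a i (w.D c j v)), ← Finset.sum_add_distrib, ← Finset.sum_sub_distrib]
    exact Finset.sum_congr rfl fun c _ => by rw [EE]
  rw [h1, dlt_sum' a (fun c => w.E c i (w.D b j v))]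
  ring

lemma F_mul (i j : Fin n) (f v : R) :
    w.F i j (f * v) = f * w.F i j v +
      ∑ a, (w.D a j f * w.E a i v - w.D a i f * w.E a j v) + w.F i j f * v := by
  have key : ∑ a, w.E a i f * w.D a j v = - ∑ a, w.D a i f * w.E a j v := by
    simp only [E_apply, Finset.sum_mul, Finset.mul_sum]
    rw [Finset.sum_comm, ← Finset.sum_neg_distrib]
    refine Finset.sum_congr rfl fun c _ => ?_
    rw [← Finset.sum_neg_distrib]
    refine Finset.sum_congr rfl fun k _ => ?_
    rw [w.Xs k c, w.Ds k j, w.Ds i c]; ring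
  simp only [F, Derivation.leibniz, map_add, smul_eq_mul, Finset.sum_add_distrib, Finset.sum_sub_distrib]
  rw [Finset.mul_sum, Finset.sum_mul]
  have h2 : ∑ a, w.D a j v * w.E a i f = - ∑ a, w.D a i f * w.E a j v := by
    rw [← key]; exact Finset.sum_congr rfl fun c _ => by ring
  rw [h2]
  have h3 : ∑ a, v * w.E a i (w.D a j f) = ∑ a, w.E a i (w.D a j f) * v :=
    Finset.sum_congr rfl fun c _ => by ring
  rw [h3]; ring

/-- the operators `B` -/
def B (t : ℂ) (i j : Fin n) (v : R) : R := w.F i j v - t • w.D i j v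

lemma B_add (t : ℂ) (i j : Fin n) (v v' : R) : w.B t i j (v + v') = w.B t i j v + w.B t i j v' := by
  simp only [B, F_add, map_add, smul_add]; ring

lemma B_smul (t : ℂ) (i j : Fin n) (c : ℂ) (v : R) : w.B t i j (c • v) = c • w.B t i j v := by
  simp only [B, F_smul, Derivation.map_smul, smul_sub]; rw [smul_comm]

/-- `B` as a linear map -/
def Bl (t : ℂ) (i j : Fin n) : R →ₗ[ℂ] R :=
  { toFun := w.B t i j
    map_add' := w.B_add t i j
    map_smul' := w.B_smul t i j }

lemma BE (t : ℂ) (i j a b : Fin n) (v : R) :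
    w.B t i j (w.E a b v) = w.E a b (w.B t i j v) + dlt R i a * w.B t b j v + dlt R j a * w.B t i b v := by
  simp only [B, FE, DE, map_sub, Derivation.map_smul, smul_add, mul_sub, mul_smul_comm]; ring

lemma B_mul (t : ℂ) (i j : Fin n) (f v : R) :
    w.B t i j (f * v) = f * w.B t i j v +
      ∑ a, (w.D a j f * w.E a i v - w.D a i f * w.E a j v) + w.B t i j f * v := by
  simp only [B, F_mul, Derivation.leibniz, smul_eq_mul, smul_add, mul_sub, sub_mul, mul_smul_comm, smul_mul_assoc]
  rw [mul_comm (w.D i j f) v]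
  ring

lemma FX (i j k l : Fin n) : w.F i j (w.X k l) = 0 := by
  unfold F
  refine Finset.sum_eq_zero fun a _ => ?_
  rw [w.DX]
  simp only [map_sub, Derivation.leibniz, dlt_map, smul_zero, add_zero, sub_zero]

lemma id1 (t : ℂ) (i : Fin n) (v : R) :
    ∑ j, w.X i j * w.B t i j v = ∑ a, w.E a i (w.E i a v) - ∑ a, w.E a a v + (1 - t) • w.E i i v := by
  have h1 : ∑ j, w.X i j * w.F i j v = ∑ a, w.E a i (w.E i a v) - ∑ a, w.E a a v + w.E i i v := by
    have h2 : ∀ a, w.E a i (w.E i a v) = ∑ j, w.X i j * w.E a i (w.D a j v) + w.E a a v + w.X i a * w.D a i v := by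
      intro a
      rw [E_apply w i a, map_sum]
      simp only [Derivation.leibniz, smul_eq_mul, EX, Finset.sum_add_distrib]
      rw [E_apply w a a, add_assoc]
      congr 1
      rw [← dlt_sum i (fun j => w.X i a * w.D a j v), ← Finset.sum_add_distrib]
      exact Finset.sum_congr rfl fun q _ => by simp only [dlt, if_true]; ring
    have h3 : ∑ a, w.X i a * w.D a i v = - w.E i i v := by
      rw [E_apply, ← Finset.sum_neg_distrib]
      exact Finset.sum_congr rfl fun q _ => by rw [w.Ds q i]; ring
    simp only [h2, Finset.sum_add_distrib, h3, F, Finset.mul_sum]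
    rw [Finset.sum_comm]; ring
  simp only [B, mul_sub, Finset.sum_sub_distrib, h1, mul_smul_comm, ← Finset.smul_sum, ← E_apply]
  rw [sub_smul, one_smul]; ring

lemma id2 (t : ℂ) (i : Fin n) (v : R) :
    ∑ j, w.B t i j (w.X i j * v) = ∑ a, w.E a i (w.E i a v) + ((n : ℂ) - 1 - t) • w.E i i v
      - (t * (n - 1)) • v := by
  simp only [B_mul, Finset.sum_add_distrib, id1, w.DX]
  have h1 : ∑ j, ∑ a, ((dlt R a i * dlt R j j - dlt R a j * dlt R j i) * w.E a i v -
      (dlt R a i * dlt R i j - dlt R a j * dlt R i i) * w.E a j v) =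
      ((n : ℂ) - 2) • w.E i i v + ∑ a, w.E a a v := by
    have h2 : ∀ j, ∑ a, ((dlt R a i * dlt R j j - dlt R a j * dlt R j i) * w.E a i v -
      (dlt R a i * dlt R i j - dlt R a j * dlt R i i) * w.E a j v) =
      w.E i i v - dlt R j i * w.E i i v - dlt R i j * w.E i i v + w.E j j v := by
      intro j
      have hj : dlt R j j = 1 := by simp [dlt]
      have hi : dlt R i i = 1 := by simp [dlt]
      rw [hj, hi]
      have : ∀ a, ((dlt R a i * 1 - dlt R a j * dlt R j i) * w.E a i v -
        (dlt R a i * dlt R i j - dlt R a j * 1) * w.E a j v) = dlt R a i * (w.E a i v) -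
          dlt R a j * (dlt R j i * w.E a i v) - dlt R a i * (dlt R i j * w.E a j v) +
          dlt R a j * w.E a j v := fun a => by ring
      simp only [this, Finset.sum_add_distrib, Finset.sum_sub_distrib, dlt_sum']
      by_cases hij : i = j
      · subst hij; simp [dlt]
      · simp [dlt, hij, Ne.symm hij]
    simp only [h2, Finset.sum_add_distrib, Finset.sum_sub_distrib, dlt_sum, dlt_sum']
    simp only [Finset.sum_const, Finset.card_univ, Fintype.card_fin]
    rw [sub_smul, ← Nat.cast_smul_eq_nsmul ℂ, two_smul]; ring
  have h3 : ∑ j, w.B t i j (w.X i j) * v = - (t * (n - 1)) • v := by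
    have : ∀ j, w.B t i j (w.X i j) * v = - (t • v) + dlt R i j * (t • v) := by
      intro j
      simp only [B, FX, w.DX]
      by_cases hij : i = j
      · subst hij; simp [dlt]
      · simp [dlt, hij, Ne.symm hij]
    simp only [this, Finset.sum_add_distrib, dlt_sum, Finset.sum_const, Finset.card_univ, Fintype.card_fin]
    rw [← Nat.cast_smul_eq_nsmul ℂ, smul_neg, smul_smul, neg_smul, mul_sub, sub_smul, mul_one, mul_comm]; ring
  rw [h1, h3]
  simp only [sub_smul, one_smul, neg_smul, two_smul]; ring

end WD
end weyl
end Cech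
end SkewLC

namespace SkewLC
namespace Cech
section wdinst

/-- antisymmetrization of a family indexed by pairs -/
def sk {n : ℕ} {V : Type} [AddCommGroup V] (x : SkewIdx n → V) (i j : Fin n) : V :=
  if h : i < j then x ⟨(i, j), h⟩ else if h' : j < i then - x ⟨(j, i), h'⟩ else 0

lemma sk_lt {n : ℕ} {V : Type} [AddCommGroup V] (x : SkewIdx n → V) {i j : Fin n} (h : i < j) :
    sk x i j = x ⟨(i, j), h⟩ := by simp [sk, h]

lemma sk_self {n : ℕ} {V : Type} [AddCommGroup V] (x : SkewIdx n → V) (i : Fin n) :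
    sk x i i = 0 := by simp [sk]

lemma sk_skew {n : ℕ} {V : Type} [AddCommGroup V] (x : SkewIdx n → V) (i j : Fin n) :
    sk x i j = - sk x j i := by
  rcases lt_trichotomy i j with h | h | h
  · simp [sk, h, h.not_gt]
  · subst h; simp [sk]
  · simp [sk, h, h.not_gt]

lemma sk_ind {n : ℕ} {V : Type} [AddCommGroup V] (x : SkewIdx n → V) {Q : Fin n → Fin n → V → Prop}
    (h0 : ∀ i, Q i i 0) (hs : ∀ i j v, Q i j v → Q j i (-v)) (hx : ∀ p : SkewIdx n, Q p.1.1 p.1.2 (x p)) (i j) :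
    Q i j (sk x i j) := by
  rcases lt_trichotomy i j with h | h | h
  · rw [sk_lt x h]; exact hx ⟨(i, j), h⟩
  · subst h; rw [sk_self]; exact h0 i
  · rw [sk_skew, sk_lt x h]; exact hs _ _ _ (hx ⟨(j, i), h⟩)

variable {n : ℕ} {R : Type} [CommRing R] [Algebra ℂ R]

/-- the Weyl datum of a system of coordinates -/
def mkWD (x : SkewIdx n → R) (d : SkewIdx n → Derivation ℂ R R)
    (hc : ∀ p q v, d p (d q v) = d q (d p v)) (hx : ∀ p q, d p (x q) = if p = q then 1 else 0) : WD n R where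
  X := sk x
  D := sk d
  Xs := sk_skew x
  Ds i j v := by rw [sk_skew d i j]; rfl
  Dc i j k l v := by
    refine sk_ind d (Q := fun i j D => D (sk d k l v) = sk d k l (D v)) (by simp) ?_ ?_ i j
    · intro i j D h; simp [h]
    · intro p
      refine sk_ind d (Q := fun i j D => d p (D v) = D (d p v)) (by simp) ?_ ?_ k l
      · intro i j D h; simp [h]
      · intro q; exact hc p q v
  DX i j k l := by
    refine sk_ind d (Q := fun i j D => D (sk x k l) = dlt R i k * dlt R j l - dlt R i l * dlt R j k) ?_ ?_ ?_ i j
    · intro i; rw [Derivation.zero_apply]; ring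
    · intro i j D h; simp only [Derivation.neg_apply, h]; ring
    · intro p
      refine sk_ind x (Q := fun k l y => d p y = dlt R p.1.1 k * dlt R p.1.2 l - dlt R p.1.1 l * dlt R p.1.2 k) ?_ ?_ ?_ k l
      · intro i; rw [map_zero]; ring
      · intro i j D h; simp only [map_neg, h]; ring
      · intro q
        rw [hx]
        obtain ⟨⟨p1, p2⟩, hp⟩ := p
        obtain ⟨⟨q1, q2⟩, hq⟩ := q
        simp only at hp hq
        have : ¬ (p1 = q2 ∧ p2 = q1) := by rintro ⟨rfl, rfl⟩; exact absurd hp hq.not_gt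
        simp only [dlt, Subtype.mk.injEq, Prod.mk.injEq]
        by_cases h1 : p1 = q1 <;> by_cases h2 : p2 = q2 <;> by_cases h3 : p1 = q2 <;> by_cases h4 : p2 = q1 <;>
          simp_all

lemma genEntry_eq (i j : Fin n) : genEntry n i j = sk (fun p => (MvPolynomial.X p : PS n)) i j := rfl

/-- Weyl datum of the polynomial ring -/
def wS (n : ℕ) : WD n (PS n) :=
  mkWD (fun p => MvPolynomial.X p) (fun p => MvPolynomial.pderiv p)
    (by
      intro p q v
      have h : ⁅(MvPolynomial.pderiv p : Derivation ℂ (PS n) (PS n)), (MvPolynomial.pderiv q : Derivation ℂ (PS n) (PS n))⁆ = 0 := by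
        apply MvPolynomial.derivation_ext
        intro i
        rw [Derivation.commutator_apply]
        simp [MvPolynomial.pderiv_X, Pi.single_apply, apply_ite]
      have := congrArg (fun D => D v) h
      simp only [Derivation.commutator_apply, Derivation.zero_apply] at this
      exact sub_eq_zero.mp this)
    (by intro p q; rw [MvPolynomial.pderiv_X, Pi.single_apply]; simp [eq_comm])

lemma wS_X (i j : Fin n) : (wS n).X i j = genEntry n i j := rfl

/-- partial derivative of Laurent polynomials, as a linear map -/
def dLl {σ : Type} [DecidableEq σ] (p : σ) : Lau σ →ₗ[ℂ] Lau σ where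
  toFun f := Finsupp.lsum ℂ (fun b : σ → ℤ => LinearMap.toSpanSingleton ℂ (Lau σ)
    ((b p : ℂ) • mon (b - Pi.single p 1))) f.coeff
  map_add' f g := by rw [AddMonoidAlgebra.coeff_add, map_add]
  map_smul' c f := by rw [AddMonoidAlgebra.coeff_smul, map_smul]; rfl

lemma dLl_mon {σ : Type} [DecidableEq σ] (p : σ) (a : σ → ℤ) :
    dLl p (mon a) = (a p : ℂ) • mon (a - Pi.single p 1) := by
  simp [dLl, mon]

/-- partial derivative of Laurent polynomials -/
def dL {σ : Type} [DecidableEq σ] (p : σ) : Derivation ℂ (Lau σ) (Lau σ) :=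
  Derivation.mk' (dLl p) (by
    intro f g
    refine lau_ind (motive := fun f => dLl p (f * g) = f • dLl p g + g • dLl p f) f (by simp) (fun x y hx hy => ?_) (fun a c => ?_)
    · rw [add_mul, map_add, hx, hy, map_add, add_smul, smul_add]; abel
    · refine lau_ind (motive := fun g => dLl p ((c • mon a) * g) = (c • mon a : Lau σ) • dLl p g + g • dLl p (c • mon a)) g (by simp) (fun x y hx hy => ?_) (fun b c' => ?_)
      · rw [mul_add, map_add, hx, hy, map_add, add_smul, smul_add]; abel
      · simp only [map_smul, dLl_mon, smul_eq_mul, smul_mul_assoc, mul_smul_comm, mon_mul, Pi.add_apply]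
        have e1 : a + (b - Pi.single p 1) = a + b - Pi.single p 1 := by abel
        have e2 : b + (a - Pi.single p 1) = a + b - Pi.single p 1 := by abel
        rw [e1, e2]
        push_cast
        rw [add_smul]
        simp only [smul_add, smul_smul]
        rw [add_comm]
        congr 2 <;> ring)

lemma dL_mon {σ : Type} [DecidableEq σ] (p : σ) (a : σ → ℤ) :
    dL p (mon a) = (a p : ℂ) • mon (a - Pi.single p 1) := dLl_mon p a

/-- Weyl datum of the Laurent ring -/
def wL (n : ℕ) : WD n (Lau (SkewIdx n)) :=
  mkWD (fun p => mon (Pi.single p 1)) (fun p => dL p)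
    (by
      intro p q v
      refine lau_ind (motive := fun v => dL p (dL q v) = dL q (dL p v)) v (by simp) (fun x y hx hy => by simp only [map_add, hx, hy]) (fun a c => ?_)
      simp only [Derivation.map_smul, dL_mon, smul_smul]
      by_cases h : p = q
      · subst h; rfl
      · have e : a - Pi.single q 1 - Pi.single p 1 = a - Pi.single p 1 - Pi.single q 1 := by abel
        rw [e]
        congr 1
        simp [Pi.single_apply, h, Ne.symm h]; ring)
    (by
      intro p q
      rw [dL_mon]
      by_cases h : p = q
      · subst h; simp [mon_zero]
      · simp [h, Pi.single_apply])

lemma wL_X (i j : Fin n) : (wL n).X i j = toL _ (genEntry n i j) := by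
  rw [genEntry_eq]
  refine sk_ind _ (Q := fun i j (y : PS n) => (wL n).X i j = toL _ y) ?_ ?_ ?_ i j
  · intro i; simp [wL, mkWD, sk_self]
  · intro i j v h; rw [(wL n).Xs, h, map_neg]
  · intro p; rw [toL_X]; exact sk_lt (fun p : SkewIdx n => (mon (Pi.single p 1) : Lau (SkewIdx n))) p.2

lemma toL_dp (p : SkewIdx n) (f : PS n) : toL _ (MvPolynomial.pderiv p f) = dL p (toL _ f) := by
  induction f using MvPolynomial.induction_on with
  | C a => 
    rw [MvPolynomial.pderiv_C, map_zero, ← MvPolynomial.algebraMap_eq, AlgHom.commutes, Derivation.map_algebraMap]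
  | add f g hf hg => simp [hf, hg]
  | mul_X f q hf =>
    rw [map_mul (toL _) f, Derivation.leibniz, Derivation.leibniz, map_add, smul_eq_mul, smul_eq_mul, map_mul, map_mul, hf,
      toL_X, dL_mon, MvPolynomial.pderiv_X]
    by_cases h : p = q
    · subst h; simp [mon_zero]
    · simp [h, Pi.single_apply, Ne.symm h]

lemma toL_D (i j : Fin n) (f : PS n) : toL _ ((wS n).D i j f) = (wL n).D i j (toL _ f) := by
  refine sk_ind _ (Q := fun i j (d : Derivation ℂ (PS n) (PS n)) => toL _ (d f) = (wL n).D i j (toL _ f)) ?_ ?_ ?_ i j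
  · intro i; simp [wL, mkWD, sk_self]
  · intro i j v h; rw [(wL n).Ds, ← h, ← map_neg]; rfl
  · intro p
    rw [toL_dp]
    change _ = sk (fun p => dL p) p.1.1 p.1.2 _
    rw [sk_lt _ p.2]

lemma toL_E (i j : Fin n) (f : PS n) : toL _ ((wS n).E i j f) = (wL n).E i j (toL _ f) := by
  rw [WD.E_apply, WD.E_apply, map_sum]
  exact Finset.sum_congr rfl fun k _ => by rw [map_mul, toL_D, wL_X, wS_X]

lemma toL_F (i j : Fin n) (f : PS n) : toL _ ((wS n).F i j f) = (wL n).F i j (toL _ f) := by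
  rw [WD.F, WD.F, map_sum]
  exact Finset.sum_congr rfl fun k _ => by rw [toL_E, toL_D]

lemma toL_B (t : ℂ) (i j : Fin n) (f : PS n) : toL _ ((wS n).B t i j f) = (wL n).B t i j (toL _ f) := by
  rw [WD.B, WD.B, map_sub, map_smul, toL_F, toL_D]

/-- the torus weights of the variables -/
def wtV (n : ℕ) (p : SkewIdx n) : Fin n → ℤ := Pi.single p.1.1 1 + Pi.single p.1.2 1

lemma der_mon {σ : Type} [Fintype σ] [DecidableEq σ] (d : Derivation ℂ (Lau σ) (Lau σ)) (c : σ → ℤ)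
    (h : ∀ p, d (mon (Pi.single p 1)) = (c p : ℂ) • mon (Pi.single p 1)) (a : σ → ℤ) :
    d (mon a) = ((∑ p, a p * c p : ℤ) : ℂ) • mon a := by
  let φ : (σ → ℤ) →+ Lau σ :=
    { toFun := fun a => d (mon a) * mon (-a)
      map_zero' := by simp [mon_zero]
      map_add' := by
        intro a b
        rw [← mon_mul, Derivation.leibniz, smul_eq_mul, smul_eq_mul, neg_add, ← mon_mul]
        have h1 := mon_mul_neg a
        have h2 := mon_mul_neg b
        linear_combination (d (mon b) * mon (-b)) * h1 + (d (mon a) * mon (-a)) * h2 }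
  have h1 : ∀ p, φ (Pi.single p 1) = (c p : ℂ) • 1 := by
    intro p
    change d _ * _ = _
    rw [h, smul_mul_assoc, mon_mul_neg]
  have h2 : φ a = ((∑ p, a p * c p : ℤ) : ℂ) • 1 := by
    have e : a = ∑ p, a p • (Pi.single p 1 : σ → ℤ) := by
      ext q
      simp [Finset.sum_apply, Pi.single_apply]
    conv_lhs => rw [e]
    rw [map_sum]
    simp only [map_zsmul, h1]
    push_cast
    rw [Finset.sum_smul]
    exact Finset.sum_congr rfl fun p _ => by rw [← Int.cast_smul_eq_zsmul ℂ, smul_smul]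
  have h3 : φ a * mon a = d (mon a) := by
    change d (mon a) * mon (-a) * mon a = _
    rw [mul_assoc, mul_comm (mon (-a)), mon_mul_neg, mul_one]
  rw [← h3, h2, smul_mul_assoc, one_mul]

lemma E_mon (i : Fin n) (a : SkewIdx n → ℤ) :
    (wL n).E i i (mon a) = ((wtE (wtV n) a i : ℤ) : ℂ) • mon a := by
  rw [der_mon ((wL n).E i i) (fun p => wtV n p i)]
  · simp [wtE]
  · intro p
    have hp : (mon (Pi.single p 1) : Lau (SkewIdx n)) = (wL n).X p.1.1 p.1.2 :=
      (sk_lt (fun p : SkewIdx n => (mon (Pi.single p 1) : Lau (SkewIdx n))) p.2).symm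
    rw [hp, WD.EX]
    have hne : p.1.1 ≠ p.1.2 := p.2.ne
    simp only [wtV, Pi.add_apply, Pi.single_apply, dlt]
    by_cases h1 : i = p.1.1
    · have : i ≠ p.1.2 := h1 ▸ hne
      simp [← h1, this]
    · by_cases h2 : i = p.1.2
      · simp [h1, ← h2]
      · simp [h1, h2]

/-- a homogeneous Laurent polynomial is an eigenvector -/
lemma E_comp (i : Fin n) (w : Fin n → ℤ) (v : Lau (SkewIdx n)) :
    (wL n).E i i ((GrL (wtV n)).comp w v) = ((w i : ℤ) : ℂ) • (GrL (wtV n)).comp w v := by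
  classical
  refine lau_ind (motive := fun v => (wL n).E i i ((GrL (wtV n)).comp w v) = ((w i : ℤ) : ℂ) • (GrL (wtV n)).comp w v) v (by simp) (fun x y hx hy => by simp only [map_add, hx, hy, smul_add]) (fun a c => ?_)
  have h1 := (GrL (wtV n)).comp_mon w c a 1
  have : (GrL (wtV n)).comp w (c • mon a) = if wtE (wtV n) a = w then c • mon a else 0 := by
    ext b
    simp only [GrL, AddMonoidHom.coe_mk, ZeroHom.coe_mk, fil_coeff]
    by_cases hb : b = a
    · subst hb
      by_cases h : wtE (wtV n) b = w <;> simp [h]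
    · have : (c • mon a : Lau (SkewIdx n)).coeff b = 0 := by
        simp [mon, Finsupp.single_apply, Ne.symm hb]
      rw [this]
      split_ifs <;> first | rfl | exact this.symm
  rw [this]
  split_ifs with h
  · rw [Derivation.map_smul, E_mon, h, smul_comm]
  · simp

end wdinst
end Cech
end SkewLC

namespace SkewLC
namespace Cech
section wts
variable {n : ℕ} {U : Type} [AddCommGroup U] [Module ℂ U]

/-- weight spaces of a commuting family -/
def Wt (h : Fin n → Module.End ℂ U) (w : Fin n → ℤ) : Submodule ℂ U where
  carrier := {u | ∀ i, h i u = ((w i : ℤ) : ℂ) • u}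
  zero_mem' := by intro i; simp
  add_mem' := by intro a b ha hb i; rw [map_add, ha i, hb i, smul_add]
  smul_mem' := by intro c a ha i; rw [map_smul, ha i, smul_comm]

variable {h : Fin n → Module.End ℂ U}

lemma wt_proj (Z : Submodule ℂ U) (hZ : ∀ i u, u ∈ Z → h i u ∈ Z) (T : Finset (Fin n → ℤ)) :
    ∀ (f : (Fin n → ℤ) → U), (∀ w, f w ∈ Wt h w) → ∑ w ∈ T, f w ∈ Z → ∀ w ∈ T, f w ∈ Z := by
  induction T using Finset.induction_on with
  | empty => intro f _ _ w hw; simp at hw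
  | insert w1 T hw1 ih =>
    intro f hf hs
    have key : ∀ w ∈ T, f w ∈ Z := by
      intro w hw
      have hne : w ≠ w1 := fun e => hw1 (e ▸ hw)
      obtain ⟨i, hi⟩ := Function.ne_iff.mp hne
      have h1 : ∑ w ∈ T, ((w i - w1 i : ℤ) : ℂ) • f w ∈ Z := by
        have h2 : h i (∑ w ∈ insert w1 T, f w) - ((w1 i : ℤ) : ℂ) • (∑ w ∈ insert w1 T, f w) ∈ Z :=
          Z.sub_mem (hZ i _ hs) (Z.smul_mem _ hs)
        rw [map_sum, Finset.smul_sum, ← Finset.sum_sub_distrib, Finset.sum_insert hw1] at h2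
        rw [hf w1 i, sub_self, zero_add] at h2
        convert h2 using 2 with w hw
        rw [hf w i]; push_cast; rw [sub_smul]
      have h3 := ih (fun w => ((w i - w1 i : ℤ) : ℂ) • f w) (fun w => (Wt h w).smul_mem _ (hf w)) h1 w hw
      have hc : ((w i - w1 i : ℤ) : ℂ) ≠ 0 := by exact_mod_cast sub_ne_zero.mpr hi
      exact (Submodule.smul_mem_iff _ hc).mp h3
    intro w hw
    rcases Finset.mem_insert.mp hw with rfl | hw
    · rw [Finset.sum_insert hw1] at hs
      exact (Submodule.add_mem_iff_left _ (Z.sum_mem key)).mp hs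
    · exact key w hw

lemma wt_dec (hd : ∀ u, u ∈ ⨆ w, Wt h w) (u : U) :
    ∃ (T : Finset (Fin n → ℤ)) (f : (Fin n → ℤ) → U), (∀ w, f w ∈ Wt h w) ∧ ∑ w ∈ T, f w = u := by
  obtain ⟨f, hf, hs⟩ := (Submodule.mem_iSup_iff_exists_finsupp _ _).mp (hd u)
  exact ⟨f.support, f, hf, hs⟩

lemma wt_ex (hd : ∀ u, u ∈ ⨆ w, Wt h w) (Z : Submodule ℂ U) (hZ : ∀ i u, u ∈ Z → h i u ∈ Z) (hne : Z ≠ ⊥) :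
    ∃ w u, u ∈ Z ∧ u ≠ 0 ∧ u ∈ Wt h w := by
  obtain ⟨u, hu, hu0⟩ := Submodule.exists_mem_ne_zero_of_ne_bot hne
  obtain ⟨T, f, hf, hs⟩ := wt_dec hd u
  have h1 := wt_proj Z hZ T f hf (hs ▸ hu)
  by_contra hcon
  push Not at hcon
  apply hu0
  rw [← hs]
  refine Finset.sum_eq_zero fun w hw => ?_
  by_contra hfw
  exact hcon w (f w) (h1 w hw) hfw (hf w)

lemma wt_max (hd : ∀ u, u ∈ ⨆ w, Wt h w) (Z : Submodule ℂ U) (hZ : ∀ i u, u ∈ Z → h i u ∈ Z) (hne : Z ≠ ⊥)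
    (φ : (Fin n → ℤ) → ℤ) (C : ℤ) (hC : ∀ w u, u ∈ Z → u ≠ 0 → u ∈ Wt h w → φ w ≤ C) :
    ∃ w u, u ∈ Z ∧ u ≠ 0 ∧ u ∈ Wt h w ∧ ∀ w' u', u' ∈ Z → u' ≠ 0 → u' ∈ Wt h w' → φ w' ≤ φ w := by
  obtain ⟨w, u, hu, hu0, huw⟩ := wt_ex hd Z hZ hne
  obtain ⟨ub, ⟨w1, u1, a1, a2, a3, rfl⟩, hmax⟩ := Int.exists_greatest_of_bdd
    (P := fun z => ∃ w u, u ∈ Z ∧ u ≠ 0 ∧ u ∈ Wt h w ∧ φ w = z)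
    ⟨C, by rintro z ⟨w, u, a, b, c, rfl⟩; exact hC w u a b c⟩ ⟨_, w, u, hu, hu0, huw, rfl⟩
  exact ⟨w1, u1, a1, a2, a3, fun w' u' b1 b2 b3 => hmax _ ⟨w', u', b1, b2, b3, rfl⟩⟩

lemma wt_indep (T : Finset (Fin n → ℤ)) (f : (Fin n → ℤ) → U) (hf : ∀ w, f w ∈ Wt h w) (w : Fin n → ℤ) (v : U)
    (hv : v ∈ Wt h w) (hs : ∑ w ∈ T, f w = v) (hv0 : v ≠ 0) : w ∈ T ∧ f w = v := by
  classical
  have h1 : ∑ w' ∈ insert w T, ((if w' ∈ T then f w' else 0) - (if w' = w then v else 0)) ∈ (⊥ : Submodule ℂ U) := by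
    rw [Finset.sum_sub_distrib, Finset.sum_ite_eq' (insert w T), if_pos (Finset.mem_insert_self _ _)]
    rw [Finset.sum_ite_mem]
    have : insert w T ∩ T = T := by ext; simp; tauto
    rw [this, hs]; simp
  have h2 := wt_proj (h := h) ⊥ (by intro i u hu; simp at hu; simp [hu]) _ _ ?_ h1 w (Finset.mem_insert_self _ _)
  · rw [if_pos rfl, Submodule.mem_bot, sub_eq_zero] at h2
    by_cases hw : w ∈ T
    · rw [if_pos hw] at h2; exact ⟨hw, h2⟩
    · rw [if_neg hw] at h2; exact absurd h2.symm hv0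
  · intro w'
    refine Submodule.sub_mem _ ?_ ?_
    · split_ifs
      · exact hf w'
      · exact Submodule.zero_mem _
    · split_ifs with e
      · rw [e]; exact hv
      · exact Submodule.zero_mem _

/-- shift lemma for root operators -/
lemma wt_E {E : Fin n → Fin n → Module.End ℂ U}
    (o3 : ∀ i j k l u, E i j (E k l u) = E k l (E i j u) + dlt ℂ j k • E i l u - dlt ℂ i l • E k j u)
    {w : Fin n → ℤ} {u : U} (hu : u ∈ Wt (fun i => E i i) w) (a b : Fin n) :
    E a b u ∈ Wt (fun i => E i i) (w + Pi.single a 1 - Pi.single b 1) := by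
  intro k
  have hk : E k k u = ((w k : ℤ) : ℂ) • u := hu k
  change E k k (E a b u) = _
  rw [o3, hk, map_smul]
  by_cases h1 : k = a <;> by_cases h2 : k = b <;> simp [dlt, h1, h2, Pi.single_apply, add_smul, sub_smul] <;> 
    subst_vars <;> simp_all [add_smul, sub_smul]

end wts

section S
variable {n : ℕ}

lemma genEntry_E (i a b : Fin n) : (wS n).E i i ((wS n).X a b) =
    ((((Pi.single a 1 + Pi.single b 1 : Fin n → ℤ) i : ℤ)) : ℂ) • (wS n).X a b := by
  rw [WD.EX]
  by_cases h1 : i = a <;> by_cases h2 : i = b <;> simp [dlt, h1, h2, Pi.single_apply, add_smul] <;>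
    subst_vars <;> simp_all [add_smul]

/-- `E` on polynomials as endomorphisms -/
def ES (n : ℕ) (a b : Fin n) : Module.End ℂ (PS n) := ((wS n).E a b : PS n →ₗ[ℂ] PS n)

lemma ES_apply (a b : Fin n) (f : PS n) : ES n a b f = (wS n).E a b f := rfl

lemma ES_o3 (i j k l : Fin n) (u : PS n) : ES n i j (ES n k l u) = ES n k l (ES n i j u) + dlt ℂ j k • ES n i l u
    - dlt ℂ i l • ES n k j u := by
  simp only [ES_apply]
  rw [WD.EE]
  have : ∀ i j : Fin n, ∀ f : PS n, dlt (PS n) i j * f = dlt ℂ i j • f := by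
    intro i j f; unfold dlt; split_ifs <;> simp
  rw [this, this]

lemma ES_monomial (i : Fin n) (a : SkewIdx n →₀ ℕ) (c : ℂ) :
    ES n i i (MvPolynomial.monomial a c) = ((wtE (wtV n) (expHom _ a) i : ℤ) : ℂ) • MvPolynomial.monomial a c := by
  apply toL_inj
  rw [ES_apply, toL_E, map_smul, toL_monomial, Derivation.map_smul, E_mon, smul_comm]

lemma monomial_Wt (a : SkewIdx n →₀ ℕ) (c : ℂ) :
    MvPolynomial.monomial a c ∈ Wt (fun i => ES n i i) (wtE (wtV n) (expHom _ a)) := fun i => ES_monomial i a c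

lemma S_dec (f : PS n) : f ∈ ⨆ w, Wt (fun i => ES n i i) w := by
  induction f using MvPolynomial.induction_on' with
  | monomial a c => exact Submodule.mem_iSup_of_mem _ (monomial_Wt a c)
  | add p q hp hq => exact Submodule.add_mem _ hp hq

lemma coeff_ES (i : Fin n) (f : PS n) (a : SkewIdx n →₀ ℕ) :
    MvPolynomial.coeff a (ES n i i f) = ((wtE (wtV n) (expHom _ a) i : ℤ) : ℂ) * MvPolynomial.coeff a f := by
  classical
  induction f using MvPolynomial.induction_on' with
  | monomial b c =>
    rw [ES_monomial, MvPolynomial.coeff_smul, MvPolynomial.coeff_monomial, smul_eq_mul]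
    split_ifs with h
    · rw [h]
    · simp
  | add p q hp hq => rw [map_add, MvPolynomial.coeff_add, MvPolynomial.coeff_add, hp, hq, mul_add]

lemma wt_of_mem_support {f : PS n} {w : Fin n → ℤ} (hf : f ∈ Wt (fun i => ES n i i) w) {a : SkewIdx n →₀ ℕ}
    (ha : MvPolynomial.coeff a f ≠ 0) : w = wtE (wtV n) (expHom _ a) := by
  ext i
  have h1 := congrArg (MvPolynomial.coeff a) (hf i)
  simp only [coeff_ES, MvPolynomial.coeff_smul, smul_eq_mul] at h1
  exact_mod_cast (mul_right_cancel₀ ha h1).symm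

lemma wtE_nonneg (a : SkewIdx n → ℤ) (ha : ∀ p, 0 ≤ a p) (i : Fin n) : 0 ≤ wtE (wtV n) a i := by
  rw [wtE, Finset.sum_apply]
  refine Finset.sum_nonneg fun p _ => ?_
  simp only [Pi.smul_apply, smul_eq_mul, wtV, Pi.add_apply]
  refine mul_nonneg (ha p) (add_nonneg ?_ ?_) <;> simp only [Pi.single_apply] <;> split_ifs <;> simp

lemma wtE_sum (a : SkewIdx n → ℤ) : ∑ i, wtE (wtV n) a i = 2 * ∑ p, a p := by
  simp only [wtE, Finset.sum_apply, Pi.smul_apply, smul_eq_mul, wtV, Pi.add_apply]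
  rw [Finset.sum_comm, Finset.mul_sum]
  refine Finset.sum_congr rfl fun p _ => ?_
  rw [← Finset.mul_sum, Finset.sum_add_distrib]
  simp [Pi.single_apply]; ring

lemma S_wt {f : PS n} {d : ℕ} (hh : f.IsHomogeneous d) (hf0 : f ≠ 0) {w : Fin n → ℤ}
    (hf : f ∈ Wt (fun i => ES n i i) w) : (∀ i, 0 ≤ w i) ∧ ∑ i, w i = 2 * d := by
  obtain ⟨a, ha⟩ := MvPolynomial.ne_zero_iff.mp hf0
  rw [wt_of_mem_support hf ha]
  refine ⟨wtE_nonneg _ (by intro p; simp [expHom]), ?_⟩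
  rw [wtE_sum]
  have h1 : a.degree = d := by
    by_contra hne
    exact ha (hh.coeff_eq_zero hne)
  rw [← h1, Finsupp.degree_eq_sum]
  simp [expHom]

lemma hom_D {f : PS n} {d : ℕ} (hf : f.IsHomogeneous (d + 1)) (i j : Fin n) : ((wS n).D i j f).IsHomogeneous d := by
  refine sk_ind _ (Q := fun i j (D : Derivation ℂ (PS n) (PS n)) => (D f).IsHomogeneous d) ?_ ?_ ?_ i j
  · intro i; exact MvPolynomial.isHomogeneous_zero _ _ _
  · intro i j D h; exact h.neg
  · intro p; exact hf.pderiv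

lemma hom_X (i j : Fin n) : ((wS n).X i j).IsHomogeneous 1 := by
  refine sk_ind _ (Q := fun i j (x : PS n) => x.IsHomogeneous 1) ?_ ?_ ?_ i j
  · intro i; exact MvPolynomial.isHomogeneous_zero _ _ _
  · intro i j D h; exact h.neg
  · intro p; exact MvPolynomial.isHomogeneous_X _ _

lemma hom_smul {f : PS n} {d : ℕ} (hf : f.IsHomogeneous d) (c : ℂ) : (c • f).IsHomogeneous d :=
  (MvPolynomial.homogeneousSubmodule _ ℂ d).smul_mem c hf

lemma hom_E {f : PS n} {d : ℕ} (hf : f.IsHomogeneous d) (i j : Fin n) : ((wS n).E i j f).IsHomogeneous d := by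
  cases d with
  | zero =>
    have : f = MvPolynomial.C (MvPolynomial.coeff 0 f) :=
      MvPolynomial.totalDegree_eq_zero_iff_eq_C.mp ((MvPolynomial.totalDegree_zero_iff_isHomogeneous (p := f)).mpr hf)
    rw [this, ← MvPolynomial.algebraMap_eq, Derivation.map_algebraMap]
    exact MvPolynomial.isHomogeneous_zero _ _ _
  | succ d =>
    rw [WD.E_apply]
    refine MvPolynomial.IsHomogeneous.sum _ _ _ fun k _ => ?_
    rw [add_comm]
    exact (hom_X i k).mul (hom_D hf j k)

lemma hom_B {f : PS n} {d : ℕ} (hf : f.IsHomogeneous (d + 1)) (t : ℂ) (i j : Fin n) :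
    ((wS n).B t i j f).IsHomogeneous d := by
  rw [WD.B]
  refine MvPolynomial.IsHomogeneous.sub ?_ (hom_smul (hom_D hf i j) t)
  rw [WD.F]
  exact MvPolynomial.IsHomogeneous.sum _ _ _ fun k _ => hom_E (hom_D hf k j) _ _

lemma propP {κ : ℤ} (hn : 0 < n) (hκ : (n : ℤ) - 1 < κ) {d : ℕ} (f : PS n) (hf : f.IsHomogeneous (d + 1))
    (hB : ∀ i j, (wS n).B (-(κ : ℂ)) i j f = 0) : f = 0 := by
  by_contra hf0
  let Z : Submodule ℂ (PS n) := MvPolynomial.homogeneousSubmodule _ ℂ (d + 1) ⊓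
    ⨅ i, ⨅ j, LinearMap.ker ((wS n).Bl (-(κ : ℂ)) i j)
  have memZ : ∀ g, g ∈ Z ↔ g.IsHomogeneous (d + 1) ∧ ∀ i j, (wS n).B (-(κ : ℂ)) i j g = 0 := by
    intro g
    simp only [Z, Submodule.mem_inf, Submodule.mem_iInf, LinearMap.mem_ker]
    rfl
  have hZE : ∀ a b g, g ∈ Z → ES n a b g ∈ Z := by
    intro a b g hg
    rw [memZ] at hg ⊢
    refine ⟨hom_E hg.1 _ _, fun i j => ?_⟩
    rw [ES_apply, WD.BE, hg.2, hg.2, hg.2]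
    simp
  have hZne : Z ≠ ⊥ := fun e => hf0 (by
    have : f ∈ Z := (memZ f).mpr ⟨hf, hB⟩
    rw [e] at this; simpa using this)
  have hwt : ∀ w g, g ∈ Z → g ≠ 0 → g ∈ Wt (fun i => ES n i i) w → (∀ i, 0 ≤ w i) ∧ ∑ i, w i = 2 * ((d + 1 : ℕ) : ℤ) :=
    fun w g hg hg0 hgw => S_wt ((memZ g).mp hg).1 hg0 hgw
  obtain ⟨w0, g0, hg0, hg00, hgw0⟩ := wt_ex (h := fun i => ES n i i) S_dec Z (fun i u hu => hZE i i u hu) hZne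
  obtain ⟨ub, ⟨i, w, g, hg, hgne, hgw, rfl⟩, hmax⟩ := Int.exists_greatest_of_bdd
    (P := fun z => ∃ i w g, g ∈ Z ∧ g ≠ 0 ∧ g ∈ Wt (fun i => ES n i i) w ∧ w i = z)
    ⟨2 * ((d + 1 : ℕ) : ℤ), by
      rintro z ⟨i, w, g, a, b, c, rfl⟩
      obtain ⟨h1, h2⟩ := hwt w g a b c
      rw [← h2]
      exact Finset.single_le_sum (fun i _ => h1 i) (Finset.mem_univ i)⟩
    ⟨_, ⟨0, hn⟩, w0, g0, hg0, hg00, hgw0, rfl⟩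
  obtain ⟨h1, h2⟩ := hwt w g hg hgne hgw
  have hE : ∀ a, a ≠ i → ES n i a g = 0 := by
    intro a ha
    by_contra hne
    have h3 := hmax _ ⟨i, _, _, hZE i a g hg, hne, wt_E ES_o3 hgw i a, rfl⟩
    simp [Pi.single_apply, Ne.symm ha] at h3
  have hEE : ∀ a, ES n a a g = ((w a : ℤ) : ℂ) • g := fun a => hgw a
  have hid := (wS n).id1 (-(κ : ℂ)) i g
  simp only [((memZ g).mp hg).2, mul_zero, Finset.sum_const_zero, ← ES_apply] at hid
  rw [Finset.sum_eq_single i (fun a _ ha => by rw [hE a ha, map_zero]) (by simp)] at hid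
  simp only [hEE, map_smul, smul_smul, ← Finset.sum_smul, ← sub_smul, ← add_smul] at hid
  have h4 := (smul_eq_zero.mp hid.symm).resolve_right hgne
  have h5 : w i * w i - ∑ a, w a + (1 + κ) * w i = 0 := by
    have : ((w i * w i - ∑ a, w a + (1 + κ) * w i : ℤ) : ℂ) = 0 := by
      rw [← h4]; push_cast; ring
    exact_mod_cast this
  have h6 : ∑ a, w a ≤ n * w i := by
    have : ∑ a, w a ≤ ∑ a : Fin n, w i := Finset.sum_le_sum fun a _ => hmax _ ⟨a, w, g, hg, hgne, hgw, rfl⟩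
    simpa using this
  have h7 := h1 i
  have h8 : w i = 0 := by
    rcases h7.eq_or_lt with h | h
    · exact h.symm
    · nlinarith
  rw [h2, h8] at h6
  push_cast at h6
  linarith

end S
end Cech
end SkewLC

namespace SkewLC
namespace Cech
section ops

/-- A module with compatible operators. -/
structure Ops (n : ℕ) (t : ℤ) (U : Type) [AddCommGroup U] [Module ℂ U] where
  mul : PS n →ₐ[ℂ] Module.End ℂ U
  E : Fin n → Fin n → Module.End ℂ U
  B : Fin n → Fin n → Module.End ℂ U
  o2 : ∀ a b f u, E a b (mul f u) = mul f (E a b u) + mul ((wS n).E a b f) u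
  o3 : ∀ i j k l u, E i j (E k l u) = E k l (E i j u) + dlt ℂ j k • E i l u - dlt ℂ i l • E k j u
  o4 : ∀ i j a b u, B i j (E a b u) = E a b (B i j u) + dlt ℂ i a • B b j u + dlt ℂ j a • B i b u
  o5 : ∀ i j f u, B i j (mul f u) = mul f (B i j u) +
    ∑ a, (mul ((wS n).D a j f) (E a i u) - mul ((wS n).D a i f) (E a j u)) + mul ((wS n).B t i j f) u
  o6 : ∀ i u, ∑ j, B i j (mul ((wS n).X i j) u) = ∑ a, E a i (E i a u) + ((n : ℂ) - 1 - t) • E i i u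
      - ((t : ℂ) * (n - 1)) • u
  hd : ∀ u, u ∈ ⨆ w, Wt (fun i => E i i) w
  hb : ∃ C : ℤ, ∀ w u, u ≠ 0 → u ∈ Wt (fun i => E i i) w → ∀ i, w i ≤ C

namespace Ops
variable {n : ℕ} {t : ℤ} {U : Type} [AddCommGroup U] [Module ℂ U] (O : Ops n t U)

lemma wt_X {w : Fin n → ℤ} {u : U} (hu : u ∈ Wt (fun i => O.E i i) w) (a b : Fin n) :
    O.mul ((wS n).X a b) u ∈ Wt (fun i => O.E i i) (w + Pi.single a 1 + Pi.single b 1) := by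
  intro k
  have hk : O.E k k u = ((w k : ℤ) : ℂ) • u := hu k
  change O.E k k (O.mul _ u) = _
  rw [O.o2, hk, map_smul, genEntry_E, map_smul, LinearMap.smul_apply, ← add_smul]
  congr 1
  push_cast [Pi.add_apply]
  ring

lemma X_self (i : Fin n) : (wS n).X i i = 0 := by
  rw [wS_X, genEntry_eq, sk_self]

lemma maxl (Z : Submodule ℂ U) (hX : ∀ i j u, u ∈ Z → O.mul ((wS n).X i j) u ∈ Z)
    (hE : ∀ i j u, u ∈ Z → O.E i j u ∈ Z) (i : Fin n) (w : Fin n → ℤ) (u : U) (hu : u ∈ Z) (hu0 : u ≠ 0)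
    (huw : u ∈ Wt (fun i => O.E i i) w)
    (hmax : ∀ w' u', u' ∈ Z → u' ≠ 0 → u' ∈ Wt (fun i => O.E i i) w' → w' i ≤ w i) :
    w i = t ∨ w i = - (n - 1) := by
  have h1 : ∀ j, O.mul ((wS n).X i j) u = 0 := by
    intro j
    by_cases hj : j = i
    · rw [hj, X_self, map_zero]; rfl
    · by_contra hne
      have := hmax _ _ (hX i j u hu) hne (O.wt_X huw i j)
      simp [Pi.single_apply, Ne.symm hj] at this
  have h2 : ∀ a, a ≠ i → O.E i a u = 0 := by
    intro a ha
    by_contra hne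
    have := hmax _ _ (hE i a u hu) hne (wt_E O.o3 huw i a)
    simp [Pi.single_apply, Ne.symm ha] at this
  have hid := O.o6 i u
  simp only [h1, map_zero, Finset.sum_const_zero] at hid
  rw [Finset.sum_eq_single i (fun a _ ha => by rw [h2 a ha, map_zero]) (by simp)] at hid
  have hEE : O.E i i u = ((w i : ℤ) : ℂ) • u := huw i
  simp only [hEE, map_smul, smul_smul, ← sub_smul, ← add_smul] at hid
  have h4 := (smul_eq_zero.mp hid.symm).resolve_right hu0
  have h5 : (w i - t) * (w i + (n - 1)) = 0 := by
    have : (((w i - t) * (w i + (n - 1)) : ℤ) : ℂ) = 0 := by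
      rw [← h4]; push_cast; ring
    exact_mod_cast this
  rcases mul_eq_zero.mp h5 with h | h
  · left; linarith
  · right; linarith

lemma max_bd (Z : Submodule ℂ U) (hX : ∀ i j u, u ∈ Z → O.mul ((wS n).X i j) u ∈ Z)
    (hE : ∀ i j u, u ∈ Z → O.E i j u ∈ Z) (i : Fin n) (w : Fin n → ℤ) (u : U) (hu : u ∈ Z) (hu0 : u ≠ 0)
    (huw : u ∈ Wt (fun i => O.E i i) w) :
    ∃ w1 u1, u1 ∈ Z ∧ u1 ≠ 0 ∧ u1 ∈ Wt (fun i => O.E i i) w1 ∧ w i ≤ w1 i ∧ (w1 i = t ∨ w1 i = -(n - 1)) := by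
  obtain ⟨C, hC⟩ := O.hb
  have hne : Z ≠ ⊥ := by rintro rfl; exact hu0 (by simpa using hu)
  obtain ⟨w1, u1, a1, a2, a3, a4⟩ := wt_max (h := fun i => O.E i i) O.hd Z (fun i u hu => hE i i u hu) hne
    (fun w => w i) C (fun w u _ h0 hw => hC w u h0 hw i)
  exact ⟨w1, u1, a1, a2, a3, a4 w u hu hu0 huw, O.maxl Z hX hE i w1 u1 a1 a2 a3 a4⟩

/-- the vector annihilated by everything generates a faithful module -/
def W (u : U) : ℕ → Submodule ℂ U
  | 0 => ⊥
  | 1 => Submodule.span ℂ {u}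
  | (d + 2) => Submodule.span ℂ {x | ∃ i j, ∃ v ∈ W u (d + 1), x = O.B i j v}

lemma W_B (u : U) (d : ℕ) (i j : Fin n) (v : U) (hv : v ∈ O.W u d) : O.B i j v ∈ O.W u (d + 1) := by
  cases d with
  | zero =>
    have : v = 0 := by simpa [W] using hv
    rw [this, map_zero]; exact Submodule.zero_mem _
  | succ d => exact Submodule.subset_span ⟨i, j, v, hv, rfl⟩

variable {c : ℂ} {u : U}

lemma W_E (hE : ∀ i j, O.E i j u = (c * dlt ℂ i j) • u) (d : ℕ) : ∀ a b v, v ∈ O.W u d → O.E a b v ∈ O.W u d := by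
  induction d with
  | zero =>
    intro a b v hv
    have : v = 0 := by simpa [W] using hv
    rw [this, map_zero]; exact Submodule.zero_mem _
  | succ d ih =>
    cases d with
    | zero =>
      intro a b v hv
      obtain ⟨z, rfl⟩ := Submodule.mem_span_singleton.mp hv
      rw [map_smul, hE]
      exact Submodule.smul_mem _ _ (Submodule.smul_mem _ _ (Submodule.mem_span_singleton_self u))
    | succ d =>
      intro a b v hv
      refine Submodule.span_induction (p := fun v _ => O.E a b v ∈ O.W u (d + 2)) ?_ ?_ ?_ ?_ hv
      · rintro x ⟨i, j, v, hv, rfl⟩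
        have h := O.o4 i j a b v
        have h2 : O.E a b (O.B i j v) = O.B i j (O.E a b v) - dlt ℂ i a • O.B b j v - dlt ℂ j a • O.B i b v := by
          rw [h]; abel
        rw [h2]
        refine Submodule.sub_mem _ (Submodule.sub_mem _ ?_ ?_) ?_
        · exact O.W_B u _ _ _ _ (ih a b v hv)
        · exact Submodule.smul_mem _ _ (O.W_B u _ _ _ _ hv)
        · exact Submodule.smul_mem _ _ (O.W_B u _ _ _ _ hv)
      · rw [map_zero]; exact Submodule.zero_mem _
      · intro x y _ _ hx hy; rw [map_add]; exact Submodule.add_mem _ hx hy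
      · intro z x _ hx; rw [map_smul]; exact Submodule.smul_mem _ _ hx

lemma dltS (i j : Fin n) : dlt (PS n) i j = algebraMap ℂ (PS n) (dlt ℂ i j) := by
  unfold dlt; split_ifs <;> simp

lemma mul_algebraMap (z : ℂ) (v : U) : O.mul (algebraMap ℂ (PS n) z) v = z • v := by
  rw [AlgHom.commutes]; rfl

lemma DX_mul (i j k l : Fin n) (v : U) : ∃ z : ℂ, O.mul ((wS n).D i j ((wS n).X k l)) v = z • v := by
  rw [(wS n).DX, dltS, dltS, dltS, dltS, ← map_mul, ← map_mul, ← map_sub]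
  exact ⟨_, O.mul_algebraMap _ v⟩

lemma W_X (hX : ∀ i j, O.mul ((wS n).X i j) u = 0) (hE : ∀ i j, O.E i j u = (c * dlt ℂ i j) • u) (d : ℕ) :
    ∀ k l v, v ∈ O.W u (d + 1) → O.mul ((wS n).X k l) v ∈ O.W u d := by
  induction d with
  | zero =>
    intro k l v hv
    obtain ⟨z, rfl⟩ := Submodule.mem_span_singleton.mp hv
    rw [map_smul, hX, smul_zero]; exact Submodule.zero_mem _
  | succ d ih =>
    intro k l v hv
    refine Submodule.span_induction (p := fun v _ => O.mul ((wS n).X k l) v ∈ O.W u (d + 1)) ?_ ?_ ?_ ?_ hv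
    · rintro x ⟨i, j, v, hv, rfl⟩
      have h := O.o5 i j ((wS n).X k l) v
      have h2 : O.mul ((wS n).X k l) (O.B i j v) = O.B i j (O.mul ((wS n).X k l) v) -
        ∑ a, (O.mul ((wS n).D a j ((wS n).X k l)) (O.E a i v) - O.mul ((wS n).D a i ((wS n).X k l)) (O.E a j v))
        - O.mul ((wS n).B t i j ((wS n).X k l)) v := by rw [h]; abel
      rw [h2]
      refine Submodule.sub_mem _ (Submodule.sub_mem _ ?_ (Submodule.sum_mem _ fun a _ => Submodule.sub_mem _ ?_ ?_)) ?_
      · exact O.W_B u d _ _ _ (ih k l v hv)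
      · obtain ⟨z, hz⟩ := O.DX_mul a j k l (O.E a i v)
        rw [hz]; exact Submodule.smul_mem _ _ (O.W_E hE _ _ _ _ hv)
      · obtain ⟨z, hz⟩ := O.DX_mul a i k l (O.E a j v)
        rw [hz]; exact Submodule.smul_mem _ _ (O.W_E hE _ _ _ _ hv)
      · rw [WD.B, WD.FX, zero_sub, map_neg, map_smul, LinearMap.neg_apply, LinearMap.smul_apply]
        obtain ⟨z, hz⟩ := O.DX_mul i j k l v
        rw [hz]
        exact Submodule.neg_mem _ (Submodule.smul_mem _ _ (Submodule.smul_mem _ _ hv))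
    · rw [map_zero]; exact Submodule.zero_mem _
    · intro x y _ _ hx hy; rw [map_add]; exact Submodule.add_mem _ hx hy
    · intro z x _ hx; rw [map_smul]; exact Submodule.smul_mem _ _ hx

lemma W_hom (hX : ∀ i j, O.mul ((wS n).X i j) u = 0) (hE : ∀ i j, O.E i j u = (c * dlt ℂ i j) • u) (k d : ℕ)
    (f : PS n) (hf : f.IsHomogeneous k) (v : U) (hv : v ∈ O.W u (d + k)) : O.mul f v ∈ O.W u d := by
  have hmon : ∀ a : SkewIdx n →₀ ℕ, ∀ d v, v ∈ O.W u (d + a.degree) →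
      O.mul (MvPolynomial.monomial a 1) v ∈ O.W u d := by
    intro a
    induction a using Finsupp.induction_linear with
    | zero =>
      intro d v hv
      have : (MvPolynomial.monomial (0 : SkewIdx n →₀ ℕ) (1 : ℂ)) = 1 := rfl
      rw [this, map_one]
      simpa using hv
    | add a b ha hb =>
      intro d v hv
      have : MvPolynomial.monomial (a + b) (1 : ℂ) = MvPolynomial.monomial a 1 * MvPolynomial.monomial b 1 := by
        rw [MvPolynomial.monomial_mul, one_mul]
      rw [this, map_mul, Module.End.mul_apply]
      apply ha
      apply hb
      rw [map_add] at hv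
      rwa [add_assoc]
    | single p m =>
      rw [Finsupp.degree_single, ← MvPolynomial.X_pow_eq_monomial]
      induction m with
      | zero => intro d v hv; simpa using hv
      | succ m ih =>
        intro d v hv
        rw [pow_succ, map_mul, Module.End.mul_apply]
        apply ih
        have hx : (MvPolynomial.X p : PS n) = (wS n).X p.1.1 p.1.2 :=
          (sk_lt (fun p : SkewIdx n => (MvPolynomial.X p : PS n)) p.2).symm
        rw [hx]
        exact O.W_X hX hE _ _ _ _ (by rwa [add_assoc])
  rw [f.as_sum, map_sum, LinearMap.sum_apply]
  refine Submodule.sum_mem _ fun a ha => ?_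
  have hdeg : a.degree = k := by
    by_contra hne
    exact (MvPolynomial.mem_support_iff.mp ha) (hf.coeff_eq_zero hne)
  have : MvPolynomial.monomial a (MvPolynomial.coeff a f) = MvPolynomial.coeff a f • MvPolynomial.monomial a 1 := by
    rw [MvPolynomial.smul_monomial, smul_eq_mul, mul_one]
  rw [this, map_smul, LinearMap.smul_apply]
  exact Submodule.smul_mem _ _ (hmon a d v (hdeg ▸ hv))

lemma faith (hn : 0 < n) (ht : -((n : ℤ) - 1) < t) (hu : u ≠ 0) (hX : ∀ i j, O.mul ((wS n).X i j) u = 0)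
    (hE : ∀ i j, O.E i j u = (-((n : ℂ) - 1) * dlt ℂ i j) • u) (d : ℕ) :
    ∀ f : PS n, f.IsHomogeneous d → (∀ v ∈ O.W u (d + 1), O.mul f v = 0) → f = 0 := by
  induction d with
  | zero =>
    intro f hf h
    have : f = MvPolynomial.C (MvPolynomial.coeff 0 f) :=
      MvPolynomial.totalDegree_eq_zero_iff_eq_C.mp ((MvPolynomial.totalDegree_zero_iff_isHomogeneous (p := f)).mpr hf)
    have h1 := h u (Submodule.mem_span_singleton_self u)
    rw [this, ← MvPolynomial.algebraMap_eq, mul_algebraMap] at h1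
    have h2 := (smul_eq_zero.mp h1).resolve_right hu
    rw [this, h2, map_zero]
  | succ d ih =>
    intro f hf h
    refine propP (κ := 2 * (n - 1) + t) hn (by linarith) f hf fun i j => ?_
    apply ih _ (hom_B hf _ i j)
    intro v hv
    have h1 := h _ (O.W_B u _ i j v hv)
    have h2 := O.o5 i j f v
    rw [h1] at h2
    have h3 : O.mul f v = 0 := by
      have := O.W_hom hX hE (d + 1) 0 f hf v (by simpa using hv)
      simpa [W] using this
    rw [h3, map_zero, zero_add] at h2
    have h4 : ∀ i j, ∑ a, O.mul ((wS n).D a j f) (O.E a i v) =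
        (-((n : ℂ) - 1)) • O.mul ((wS n).D i j f) v - O.mul ((wS n).F i j f) v := by
      intro i j
      rw [WD.F, map_sum, LinearMap.sum_apply]
      have h5 : ∀ a, O.mul ((wS n).D a j f) (O.E a i v) = dlt ℂ a i • ((-((n : ℂ) - 1)) • O.mul ((wS n).D a j f) v)
          - O.mul ((wS n).E a i ((wS n).D a j f)) v := by
        intro a
        rw [eq_sub_iff_add_eq, ← O.o2]
        have h6 := O.W_hom hX hE d 1 _ (hom_D hf a j) v (by rwa [add_comm])
        obtain ⟨z, hz⟩ := Submodule.mem_span_singleton.mp h6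
        rw [← hz, map_smul, hE, smul_smul, smul_smul, smul_smul]
        congr 1; ring
      simp only [h5, Finset.sum_sub_distrib]
      congr 1
      simp [dlt]
    rw [Finset.sum_sub_distrib, h4, h4] at h2
    rw [WD.F_skew _ j i, (wS n).Ds j i] at h2
    rw [WD.B, map_sub, map_smul, LinearMap.sub_apply, LinearMap.smul_apply] at h2
    rw [WD.B, map_sub, map_smul, LinearMap.sub_apply, LinearMap.smul_apply]
    simp only [map_neg, LinearMap.neg_apply, smul_neg] at h2
    push_cast
    have : O.mul ((wS n).F i j f) v - (-(2 * ((n : ℂ) - 1) + (t : ℂ))) • O.mul ((wS n).D i j f) v =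
      - ((-((n : ℂ) - 1)) • O.mul ((wS n).D i j f) v - O.mul ((wS n).F i j f) v - (- ((-((n : ℂ) - 1)) • O.mul ((wS n).D i j f) v) - -O.mul ((wS n).F i j f) v) + (O.mul ((wS n).F i j f) v - (t : ℂ) • O.mul ((wS n).D i j f) v)) := by
      module
    rw [this, ← h2, neg_zero]

end Ops

theorem lieMain {n : ℕ} (hn : 0 < n) {t' t'' : ℤ} {U' U'' : Type} [AddCommGroup U'] [Module ℂ U']
    [AddCommGroup U''] [Module ℂ U''] (O' : Ops n t' U') (O : Ops n t'' U'') (htt : t' < t'') (ht : -((n : ℤ) - 1) < t'')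
    (τ : U' →ₗ[ℂ] U'') (hm : ∀ f u, τ (O'.mul f u) = O.mul f (τ u)) (hE : ∀ i j u, τ (O'.E i j u) = O.E i j (τ u))
    {d : ℕ} (f : PS n) (hf : f.IsHomogeneous d) (hf0 : f ≠ 0) (hk : ∀ u, O.mul f u = 0) : τ = 0 := by
  by_contra hτ
  -- weights of U'
  have s1 : ∀ w u, u ≠ 0 → u ∈ Wt (fun i => O'.E i i) w → ∀ i, w i < t'' := by
    intro w u hu0 huw i
    obtain ⟨w1, u1, -, -, -, h1, h2⟩ := O'.max_bd ⊤ (by simp) (by simp) i w u trivial hu0 huw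
    rcases h2 with h2 | h2 <;> linarith
  let T := LinearMap.range τ
  have TX : ∀ i j u, u ∈ T → O.mul ((wS n).X i j) u ∈ T := by
    rintro i j _ ⟨u, rfl⟩; exact ⟨_, hm _ u⟩
  have TE : ∀ i j u, u ∈ T → O.E i j u ∈ T := by
    rintro i j _ ⟨u, rfl⟩; exact ⟨_, hE i j u⟩
  have s2 : ∀ w u, u ∈ T → u ≠ 0 → u ∈ Wt (fun i => O.E i i) w → ∀ i, w i < t'' := by
    rintro w _ ⟨u, rfl⟩ hu0 huw i
    obtain ⟨F, g, hg, hs⟩ := wt_dec (h := fun i => O'.E i i) O'.hd u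
    have h1 := wt_indep (h := fun i => O.E i i) F (fun w => τ (g w)) (fun w i => by
      change O.E i i (τ (g w)) = _
      rw [← hE, show O'.E i i (g w) = _ from hg w i, map_smul]) w _ huw (by rw [← map_sum, hs]) hu0
    refine s1 w (g w) ?_ (hg w) i
    intro h0
    apply hu0
    rw [← h1.2, h0, map_zero]
  have hTne : T ≠ ⊥ := fun e => hτ (LinearMap.range_eq_bot.mp e)
  let Z : Submodule ℂ U'' := T ⊓ ⨅ i, ⨅ j, LinearMap.ker (O.mul ((wS n).X i j))
  have memZ : ∀ u, u ∈ Z ↔ u ∈ T ∧ ∀ i j, O.mul ((wS n).X i j) u = 0 := by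
    intro u
    simp only [Z, Submodule.mem_inf, Submodule.mem_iInf, LinearMap.mem_ker]
  have ZX : ∀ i j u, u ∈ Z → O.mul ((wS n).X i j) u ∈ Z := by
    intro i j u hu
    rw [((memZ u).mp hu).2]; exact Z.zero_mem
  have ZE : ∀ i j u, u ∈ Z → O.E i j u ∈ Z := by
    intro a b u hu
    rw [memZ] at hu ⊢
    refine ⟨TE a b u hu.1, fun i j => ?_⟩
    have h := O.o2 a b ((wS n).X i j) u
    rw [hu.2, map_zero, WD.EX, Ops.dltS, Ops.dltS, map_add, map_mul, map_mul, LinearMap.add_apply,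
      Module.End.mul_apply, Module.End.mul_apply, hu.2, hu.2, map_zero, map_zero, add_zero, add_zero] at h
    exact h.symm
  have hZne : Z ≠ ⊥ := by
    obtain ⟨C, hC⟩ := O.hb
    obtain ⟨w, u, a1, a2, a3, a4⟩ := wt_max (h := fun i => O.E i i) O.hd T (fun i u hu => TE i i u hu) hTne
      (fun w => ∑ i, w i) (n * C) (fun w u _ h0 hw => by
        have : ∑ i, w i ≤ ∑ i : Fin n, C := Finset.sum_le_sum fun i _ => hC w u h0 hw i
        simpa using this)
    intro e
    have : u ∈ Z := by
      rw [memZ]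
      refine ⟨a1, fun i j => ?_⟩
      by_contra hne
      have h := a4 _ _ (TX i j u a1) hne (O.wt_X a3 i j)
      simp [Finset.sum_add_distrib] at h
    rw [e] at this
    exact a2 (by simpa using this)
  have s3 : ∀ w u, u ∈ Z → u ≠ 0 → u ∈ Wt (fun i => O.E i i) w → ∀ i, w i ≤ -((n : ℤ) - 1) := by
    intro w u hu hu0 huw i
    obtain ⟨w1, u1, b1, b2, b3, h1, h2⟩ := O.max_bd Z ZX ZE i w u hu hu0 huw
    rcases h2 with h2 | h2
    · have := s2 w1 u1 ((memZ u1).mp b1).1 b2 b3 i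
      omega
    · linarith
  obtain ⟨w, u, a1, a2, a3, a4⟩ := wt_max (h := fun i => O.E i i) O.hd Z (fun i u hu => ZE i i u hu) hZne
      (fun w => ∑ i : Fin n, ((n : ℤ) - i.1) * w i) 0 (fun w u hu h0 hw => by
        refine Finset.sum_nonpos fun i _ => ?_
        have h1 := s3 w u hu h0 hw i
        have h2 := i.2
        exact mul_nonpos_of_nonneg_of_nonpos (by omega) (by omega))
  have hup : ∀ i j, i < j → O.E i j u = 0 := by
    intro i j hij
    by_contra hne
    have h := a4 _ _ (ZE i j u a1) hne (wt_E O.o3 a3 i j)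
    have e : ∑ k : Fin n, ((n : ℤ) - k.1) * (w + Pi.single i 1 - Pi.single j 1 : Fin n → ℤ) k =
        ∑ k : Fin n, ((n : ℤ) - k.1) * w k + ((n : ℤ) - i.1) - ((n : ℤ) - j.1) := by
      simp only [Pi.sub_apply, Pi.add_apply, mul_sub, mul_add, Finset.sum_sub_distrib, Finset.sum_add_distrib]
      simp [Pi.single_apply]
    rw [e] at h
    have : i.1 < j.1 := hij
    omega
  have hww : ∀ k : ℕ, ∀ i : Fin n, i.1 = k → w i = -((n : ℤ) - 1) := by
    intro k
    induction k using Nat.strong_induction_on with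
    | _ k ih =>
      intro i hik
      have hEE : ∀ a, O.E a a u = ((w a : ℤ) : ℂ) • u := fun a => a3 a
      have hid := O.o6 i u
      simp only [((memZ u).mp a1).2, map_zero, Finset.sum_const_zero] at hid
      have h1 : ∀ a, O.E a i (O.E i a u) = (if a < i then (-((n : ℂ) - 1) - w i) else 0) • u +
          (if a = i then ((w i : ℂ) * w i) else 0) • u := by
        intro a
        rcases lt_trichotomy a i with h | h | h
        · rw [if_pos h, if_neg h.ne, O.o3, hup a i h, map_zero, hEE, hEE, ih a.1 (by rw [← hik]; exact h) a rfl]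
          simp [dlt, sub_smul, add_smul]
        · subst h
          rw [if_neg (lt_irrefl _), if_pos rfl, hEE, map_smul, hEE]
          simp [smul_smul]
        · rw [if_neg h.not_gt, if_neg h.ne', hup i a h, map_zero]; simp
      simp only [h1, Finset.sum_add_distrib, ← Finset.sum_smul, hEE, smul_smul, ← add_smul, ← sub_smul] at hid
      have h4 := (smul_eq_zero.mp hid.symm).resolve_right a2
      have h5 : ∑ a : Fin n, (if a < i then (-((n : ℂ) - 1) - w i) else 0) = (i.1 : ℂ) * (-((n : ℂ) - 1) - w i) := by
        rw [← Finset.sum_filter, Finset.sum_const, nsmul_eq_mul]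
        congr 2
        have : (Finset.univ.filter fun a : Fin n => a < i) = Finset.Iio i := by ext; simp
        rw [this, Fin.card_Iio]
      rw [h5] at h4
      simp only [Finset.sum_ite_eq', Finset.mem_univ, if_true] at h4
      have h6 : (w i + (n - 1)) * (w i - t'' - i.1) = 0 := by
        have : (((w i + (n - 1)) * (w i - t'' - i.1) : ℤ) : ℂ) = 0 := by
          rw [← h4]; push_cast; ring
        exact_mod_cast this
      have h7 := s3 w u a1 a2 a3 i
      rcases mul_eq_zero.mp h6 with h | h
      · linarith
      · omega
  have hwi : ∀ i, w i = -((n : ℤ) - 1) := fun i => hww i.1 i rfl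
  have hEu : ∀ i j, O.E i j u = (-((n : ℂ) - 1) * dlt ℂ i j) • u := by
    intro i j
    by_cases hij : i = j
    · subst hij
      rw [show O.E i i u = _ from a3 i, hwi]
      simp [dlt]
    · have : O.E i j u = 0 := by
        by_contra hne
        have h := s3 _ _ (ZE i j u a1) hne (wt_E O.o3 a3 i j) i
        simp [Pi.single_apply, hij, hwi] at h
      rw [this]; simp [dlt, hij]
  exact hf0 (O.faith hn ht a2 ((memZ u).mp a1).2 hEu d f hf fun v _ => hk v)

end ops
end Cech
end SkewLC

namespace SkewLC
namespace Cech
section coh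

variable {σ : Type} [Fintype σ] [DecidableEq σ]

lemma smulC_mem (N : Submodule (Pol σ) (Lau σ)) (c : ℂ) {v : Lau σ} (hv : v ∈ N) : c • v ∈ N := by
  rw [← one_smul (Pol σ) v, ← smul_assoc]; exact N.smul_mem _ hv

/-- cocycles -/
def Zc (N : Submodule (Pol σ) (Lau σ)) (b : ℕ) : Submodule ℂ (Finset σ → Lau σ) where
  carrier := {c | IsC N c ∧ Supp c b ∧ dl c = 0}
  zero_mem' := ⟨fun A => zero_mem _, fun A _ => rfl, dl_zero⟩
  add_mem' := by
    rintro c d ⟨h1, h2, h3⟩ ⟨k1, k2, k3⟩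
    exact ⟨h1.add k1, fun A hA => by rw [Pi.add_apply, h2 A hA, k2 A hA, add_zero], by rw [dl_add, h3, k3, add_zero]⟩
  smul_mem' := by
    rintro x c ⟨h1, h2, h3⟩
    refine ⟨fun A => smulC_mem _ _ (h1 A), fun A hA => by rw [Pi.smul_apply, h2 A hA, smul_zero], ?_⟩
    have := dl_map (DistribSMul.toAddMonoidHom (Lau σ) x) c
    refine this.trans ?_
    rw [h3]; ext A; simp

/-- coboundaries -/
def Bc (N : Submodule (Pol σ) (Lau σ)) (b : ℕ) : Submodule ℂ (Zc N b) where
  carrier := {c | ∃ d, IsC N d ∧ dl d = c.1}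
  zero_mem' := ⟨0, fun A => zero_mem _, dl_zero⟩
  add_mem' := by
    rintro c c' ⟨d, h1, h2⟩ ⟨d', k1, k2⟩
    exact ⟨d + d', h1.add k1, by rw [dl_add, h2, k2]; rfl⟩
  smul_mem' := by
    rintro x c ⟨d, h1, h2⟩
    refine ⟨x • d, fun A => smulC_mem _ _ (h1 A), ?_⟩
    have := dl_map (DistribSMul.toAddMonoidHom (Lau σ) x) d
    refine this.trans ?_
    rw [h2]; rfl

/-- operators preserving the Čech complex -/
def Good (N : Submodule (Pol σ) (Lau σ)) : Subalgebra ℂ (Module.End ℂ (Lau σ)) where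
  carrier := {P | ∀ A v, v ∈ loc N A → P v ∈ loc N A}
  mul_mem' := fun {P Q} hP hQ A v hv => hP A _ (hQ A v hv)
  add_mem' := fun {P Q} hP hQ A v hv => add_mem (hP A v hv) (hQ A v hv)
  algebraMap_mem' := fun c A v hv => smulC_mem _ c hv

lemma good_isC {N : Submodule (Pol σ) (Lau σ)} (P : Good N) {c : Finset σ → Lau σ} (hc : IsC N c) :
    IsC N (fun A => P.1 (c A)) := fun A => P.2 A _ (hc A)

lemma dl_lin (P : Module.End ℂ (Lau σ)) (c : Finset σ → Lau σ) : dl (fun A => P (c A)) = fun A => P (dl c A) :=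
  dl_map P.toAddMonoidHom c

/-- action on cocycles -/
def actZ (N : Submodule (Pol σ) (Lau σ)) (b : ℕ) (P : Good N) : Module.End ℂ (Zc N b) where
  toFun c := ⟨fun A => P.1 (c.1 A), good_isC P c.2.1, fun A hA => by change P.1 (c.1 A) = 0; rw [c.2.2.1 A hA, map_zero], by
    rw [dl_lin, c.2.2.2]; ext A; simp⟩
  map_add' c d := by apply Subtype.ext; ext1 A; exact map_add P.1 _ _
  map_smul' x d := by apply Subtype.ext; ext1 A; exact map_smul P.1 _ _

lemma actZ_Bc (N : Submodule (Pol σ) (Lau σ)) (b : ℕ) (P : Good N) : Bc N b ≤ (Bc N b).comap (actZ N b P) := by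
  rintro c ⟨d, h1, h2⟩
  exact ⟨fun A => P.1 (d A), good_isC P h1, by rw [dl_lin, h2]; rfl⟩

/-- cohomology -/
abbrev Hc (N : Submodule (Pol σ) (Lau σ)) (b : ℕ) : Type := Zc N b ⧸ Bc N b

/-- action on cohomology -/
def act (N : Submodule (Pol σ) (Lau σ)) (b : ℕ) : Good N →ₐ[ℂ] Module.End ℂ (Hc N b) where
  toFun P := (Bc N b).mapQ (Bc N b) (actZ N b P) (actZ_Bc N b P)
  map_one' := by
    refine Submodule.linearMap_qext _ (LinearMap.ext fun c => ?_)
    rfl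
  map_zero' := by
    refine Submodule.linearMap_qext _ (LinearMap.ext fun c => ?_)
    rfl
  map_mul' P Q := by
    refine Submodule.linearMap_qext _ (LinearMap.ext fun c => ?_)
    rfl
  map_add' P Q := by
    refine Submodule.linearMap_qext _ (LinearMap.ext fun c => ?_)
    rfl
  commutes' x := by
    refine Submodule.linearMap_qext _ (LinearMap.ext fun c => ?_)
    rfl

lemma act_mk (N : Submodule (Pol σ) (Lau σ)) (b : ℕ) (P : Good N) (c : Zc N b) :
    act N b P ((Bc N b).mkQ c) = (Bc N b).mkQ (actZ N b P c) := rfl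

/-- inclusion of cocycles -/
def tauZ {N' N : Submodule (Pol σ) (Lau σ)} (h : N' ≤ N) (b : ℕ) : Zc N' b →ₗ[ℂ] Zc N b where
  toFun c := ⟨c.1, fun A => loc_mono_left h A (c.2.1 A), c.2.2⟩
  map_add' c d := rfl
  map_smul' c d := rfl

/-- the map on cohomology -/
def tau {N' N : Submodule (Pol σ) (Lau σ)} (h : N' ≤ N) (b : ℕ) : Hc N' b →ₗ[ℂ] Hc N b :=
  (Bc N' b).mapQ (Bc N b) (tauZ h b) (by
    rintro c ⟨d, h1, h2⟩
    exact ⟨d, fun A => loc_mono_left h A (h1 A), h2⟩)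

lemma tau_act {N' N : Submodule (Pol σ) (Lau σ)} (h : N' ≤ N) (b : ℕ) (P : Module.End ℂ (Lau σ)) (h1 : P ∈ Good N')
    (h2 : P ∈ Good N) (u : Hc N' b) : tau h b (act N' b ⟨P, h1⟩ u) = act N b ⟨P, h2⟩ (tau h b u) := by
  obtain ⟨c, rfl⟩ := Submodule.mkQ_surjective _ u
  rfl

lemma tau_zero {N' N : Submodule (Pol σ) (Lau σ)} (h : N' ≤ N) (b : ℕ) (h0 : tau h b = 0) :
    HZ (LinearMap.id : Lau σ →ₗ[Lau σ] Lau σ) N' N b := by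
  intro c h1 h2 h3
  have := LinearMap.congr_fun h0 ((Bc N' b).mkQ ⟨c, h1, h2, h3⟩)
  have h4 : (Bc N b).mkQ (tauZ h b ⟨c, h1, h2, h3⟩) = 0 := this
  rw [Submodule.mkQ_apply, Submodule.Quotient.mk_eq_zero] at h4
  exact h4

end coh

section ideal
variable {n : ℕ}

/-- an ideal inside the Laurent ring -/
def idL (I : Ideal (PS n)) : Submodule (Pol (SkewIdx n)) (Lau (SkewIdx n)) :=
  Submodule.map (Algebra.linearMap (PS n) (Lau (SkewIdx n))) I

lemma mem_idL {I : Ideal (PS n)} {v : Lau (SkewIdx n)} : v ∈ idL I ↔ ∃ f ∈ I, toL _ f = v := by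
  simp only [idL, Submodule.mem_map]; rfl

lemma idL_mono {I J : Ideal (PS n)} (h : I ≤ J) : idL I ≤ idL J := Submodule.map_mono h

lemma toL_mul_mem {N : Submodule (Pol (SkewIdx n)) (Lau (SkewIdx n))} (f : PS n) {v : Lau (SkewIdx n)} (hv : v ∈ N) :
    toL _ f * v ∈ N := N.smul_mem f hv

lemma good_M (N : Submodule (Pol (SkewIdx n)) (Lau (SkewIdx n))) (f : PS n) :
    LinearMap.mulLeft ℂ (toL _ f) ∈ Good N := fun A v hv => toL_mul_mem f hv

lemma locE (I : Ideal (PS n)) (hE : ∀ a b f, f ∈ I → (wS n).E a b f ∈ I) (a b : Fin n) (A : Finset (SkewIdx n)) (v : Lau (SkewIdx n)) (hv : v ∈ loc (idL I) A) :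
    (wL n).E a b v ∈ loc (idL I) A := by
  obtain ⟨h, hh⟩ := id hv
  rw [smul_def', mem_idL] at hh
  obtain ⟨f, hf, hfe⟩ := hh
  have h1 : (wL n).E a b (toL _ f) ∈ loc (idL I) A := by
    rw [← toL_E]
    exact le_loc _ _ (mem_idL.2 ⟨_, hE a b f hf, rfl⟩)
  rw [hfe, Derivation.leibniz, smul_eq_mul, smul_eq_mul, ← toL_E] at h1
  have h2 : toL _ (XA A ^ h) * (wL n).E a b v ∈ loc (idL I) A := by
    have h3 := toL_mul_mem ((wS n).E a b (XA A ^ h)) hv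
    have := sub_mem h1 h3
    rwa [mul_comm v, add_sub_cancel_right] at this
  exact loc_loc _ _ h h2

lemma locB (I : Ideal (PS n)) (hE : ∀ a b f, f ∈ I → (wS n).E a b f ∈ I) (t : ℂ)
    (hB : ∀ a b f, f ∈ I → (wS n).B t a b f ∈ I) (a b : Fin n) (A : Finset (SkewIdx n)) (v : Lau (SkewIdx n))
    (hv : v ∈ loc (idL I) A) : (wL n).B t a b v ∈ loc (idL I) A := by
  obtain ⟨h, hh⟩ := id hv
  rw [smul_def', mem_idL] at hh
  obtain ⟨f, hf, hfe⟩ := hh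
  have h1 : (wL n).B t a b (toL _ f) ∈ loc (idL I) A := by
    rw [← toL_B]
    exact le_loc _ _ (mem_idL.2 ⟨_, hB a b f hf, rfl⟩)
  rw [hfe, WD.B_mul, ← toL_B] at h1
  have h2 : toL _ (XA A ^ h) * (wL n).B t a b v ∈ loc (idL I) A := by
    have h3 := toL_mul_mem ((wS n).B t a b (XA A ^ h)) hv
    have h4 : ∑ c, ((wL n).D c b (toL _ (XA A ^ h)) * (wL n).E c a v -
        (wL n).D c a (toL _ (XA A ^ h)) * (wL n).E c b v) ∈ loc (idL I) A := by
      refine Submodule.sum_mem _ fun c _ => sub_mem ?_ ?_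
      · rw [← toL_D]; exact toL_mul_mem _ (locE I hE _ _ A v hv)
      · rw [← toL_D]; exact toL_mul_mem _ (locE I hE _ _ A v hv)
    have := sub_mem (sub_mem h1 h3) h4
    rwa [add_sub_cancel_right, add_sub_cancel_right] at this
  exact loc_loc _ _ h h2

/-- `E` as a good operator -/
def gE (I : Ideal (PS n)) (hE : ∀ a b f, f ∈ I → (wS n).E a b f ∈ I) (a b : Fin n) : Good (idL I) :=
  ⟨((wL n).E a b : Lau (SkewIdx n) →ₗ[ℂ] Lau (SkewIdx n)), locE I hE a b⟩

/-- `B` as a good operator -/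
def gB (I : Ideal (PS n)) (hE : ∀ a b f, f ∈ I → (wS n).E a b f ∈ I) (t : ℂ)
    (hB : ∀ a b f, f ∈ I → (wS n).B t a b f ∈ I) (a b : Fin n) : Good (idL I) :=
  ⟨(wL n).Bl t a b, locB I hE t hB a b⟩

/-- multiplication as a good operator -/
def gM (N : Submodule (Pol (SkewIdx n)) (Lau (SkewIdx n))) : PS n →ₐ[ℂ] Good N where
  toFun f := ⟨LinearMap.mulLeft ℂ (toL _ f), good_M N f⟩
  map_one' := by
    refine Subtype.ext (LinearMap.ext fun v => ?_)
    change toL _ 1 * v = v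
    rw [map_one, one_mul]
  map_zero' := by
    refine Subtype.ext (LinearMap.ext fun v => ?_)
    change toL _ 0 * v = 0
    rw [map_zero, zero_mul]
  map_mul' f g := by
    refine Subtype.ext (LinearMap.ext fun v => ?_)
    change toL _ (f * g) * v = toL _ f * (toL _ g * v)
    rw [map_mul, mul_assoc]
  map_add' f g := by
    refine Subtype.ext (LinearMap.ext fun v => ?_)
    change toL _ (f + g) * v = toL _ f * v + toL _ g * v
    rw [map_add, add_mul]
  commutes' c := by
    refine Subtype.ext (LinearMap.ext fun v => ?_)
    change toL _ (algebraMap ℂ (PS n) c) * v = c • v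
    rw [AlgHom.commutes, ← Algebra.smul_def]

lemma dltL (i j : Fin n) (v : Lau (SkewIdx n)) : dlt (Lau (SkewIdx n)) i j * v = dlt ℂ i j • v := by
  unfold dlt; split_ifs <;> simp

lemma act_sum (N : Submodule (Pol (SkewIdx n)) (Lau (SkewIdx n))) (b : ℕ) {ι : Type} (s : Finset ι) (P : ι → Good N)
    (u : Hc N b) : act N b (∑ i ∈ s, P i) u = ∑ i ∈ s, act N b (P i) u := by
  rw [map_sum, LinearMap.sum_apply]

lemma coe_sum_apply (N : Submodule (Pol (SkewIdx n)) (Lau (SkewIdx n))) {ι : Type} (s : Finset ι) (P : ι → Good N)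
    (v : Lau (SkewIdx n)) : (∑ i ∈ s, P i).1 v = ∑ i ∈ s, (P i).1 v := by
  have : (∑ i ∈ s, P i).1 = ∑ i ∈ s, (P i).1 := map_sum (Good N).val P s
  rw [this, LinearMap.sum_apply]

lemma idL_graded (I : Ideal (PS n)) (hE : ∀ a b f, f ∈ I → (wS n).E a b f ∈ I) : Graded (GrL (wtV n)) (idL I) := by
  intro v hv δ
  obtain ⟨T, hT⟩ := (GrL (wtV n)).fin v
  let Z : Submodule ℂ (Lau (SkewIdx n)) := (idL I).restrictScalars ℂ
  have := wt_proj (h := fun i => ((wL n).E i i : Lau (SkewIdx n) →ₗ[ℂ] Lau (SkewIdx n))) Z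
    (by
      intro i u hu
      obtain ⟨f, hf, rfl⟩ := mem_idL.1 (show u ∈ idL I from hu)
      exact mem_idL.2 ⟨_, hE i i f hf, toL_E i i f⟩) T (fun w => (GrL (wtV n)).comp w v)
    (fun w i => E_comp i w v) (by rw [hT]; exact hv)
  by_cases hδ : δ ∈ T
  · exact this δ hδ
  · have h0 : (GrL (wtV n)).comp δ v = 0 := by
      rw [← hT, map_sum]
      refine Finset.sum_eq_zero fun w hw => ?_
      rw [(GrL (wtV n)).comp_comp, if_neg]
      rintro rfl; exact hδ hw
    rw [h0]; exact zero_mem _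

/-- weight components of a cocycle -/
def cmpZ (I : Ideal (PS n)) (hE : ∀ a b f, f ∈ I → (wS n).E a b f ∈ I) (b : ℕ) (w : Fin n → ℤ) (c : Zc (idL I) b) :
    Zc (idL I) b :=
  ⟨fun A => (GrL (wtV n)).comp w (c.1 A), fun A => (idL_graded I hE).loc (c.2.1 A) w,
    fun A hA => by
      change (GrL (wtV n)).comp w (c.1 A) = 0
      rw [c.2.2.1 A hA, map_zero], by
    rw [dl_map, c.2.2.2]; ext A; simp⟩

lemma cmpZ_wt (I : Ideal (PS n)) (hE : ∀ a b f, f ∈ I → (wS n).E a b f ∈ I) (b : ℕ) (w : Fin n → ℤ) (c : Zc (idL I) b) :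
    (Bc (idL I) b).mkQ (cmpZ I hE b w c) ∈ Wt (fun i => act (idL I) b (gE I hE i i)) w := by
  intro i
  change act (idL I) b (gE I hE i i) _ = _
  rw [act_mk, ← map_smul]
  congr 1
  apply Subtype.ext
  ext1 A
  exact E_comp i w (c.1 A)

lemma cmpZ_sum (I : Ideal (PS n)) (hE : ∀ a b f, f ∈ I → (wS n).E a b f ∈ I) (b : ℕ) (c : Zc (idL I) b) :
    ∃ T : Finset (Fin n → ℤ), ∑ w ∈ T, cmpZ I hE b w c = c := by
  classical
  choose T hT using fun A => (GrL (wtV n)).fin (c.1 A)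
  refine ⟨Finset.univ.biUnion T, ?_⟩
  apply Subtype.ext
  have h1 : (∑ w ∈ Finset.univ.biUnion T, cmpZ I hE b w c).1 = ∑ w ∈ Finset.univ.biUnion T, (cmpZ I hE b w c).1 :=
    map_sum (Zc (idL I) b).subtype _ _
  rw [h1]
  ext1 A
  rw [Finset.sum_apply]
  conv_rhs => rw [← hT A]
  refine (Finset.sum_subset (Finset.subset_biUnion_of_mem T (Finset.mem_univ A)) fun w _ hw => ?_).symm
  change (GrL (wtV n)).comp w (c.1 A) = 0
  rw [← hT A, map_sum]
  refine Finset.sum_eq_zero fun w' hw' => ?_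
  rw [(GrL (wtV n)).comp_comp, if_neg]
  rintro rfl; exact hw hw'

section helpers
variable (N : Submodule (Pol (SkewIdx n)) (Lau (SkewIdx n)))
lemma cmul (P Q : Good N) (v : Lau (SkewIdx n)) : (P * Q).1 v = P.1 (Q.1 v) := rfl
lemma cadd (P Q : Good N) (v : Lau (SkewIdx n)) : (P + Q).1 v = P.1 v + Q.1 v := rfl
lemma csub (P Q : Good N) (v : Lau (SkewIdx n)) : (P - Q).1 v = P.1 v - Q.1 v := rfl
lemma csmul (x : ℂ) (Q : Good N) (v : Lau (SkewIdx n)) : (x • Q).1 v = x • Q.1 v := rfl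
lemma cone (v : Lau (SkewIdx n)) : (1 : Good N).1 v = v := rfl
lemma gM_apply (f : PS n) (v : Lau (SkewIdx n)) : (gM N f).1 v = toL _ f * v := rfl
lemma gE_apply (I : Ideal (PS n)) (hE : ∀ a b f, f ∈ I → (wS n).E a b f ∈ I) (a b : Fin n) (v : Lau (SkewIdx n)) :
    (gE I hE a b).1 v = (wL n).E a b v := rfl
lemma gB_apply (I : Ideal (PS n)) (hE : ∀ a b f, f ∈ I → (wS n).E a b f ∈ I) (t : ℂ)
    (hB : ∀ a b f, f ∈ I → (wS n).B t a b f ∈ I) (a b : Fin n) (v : Lau (SkewIdx n)) :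
    (gB I hE t hB a b).1 v = (wL n).B t a b v := rfl
lemma amul (b : ℕ) (P Q : Good N) (u : Hc N b) : act N b (P * Q) u = act N b P (act N b Q u) := by
  obtain ⟨c, rfl⟩ := Submodule.mkQ_surjective _ u
  rfl
lemma aadd (b : ℕ) (P Q : Good N) (u : Hc N b) : act N b (P + Q) u = act N b P u + act N b Q u := by
  obtain ⟨c, rfl⟩ := Submodule.mkQ_surjective _ u
  rfl
lemma asub (b : ℕ) (P Q : Good N) (u : Hc N b) : act N b (P - Q) u = act N b P u - act N b Q u := by
  obtain ⟨c, rfl⟩ := Submodule.mkQ_surjective _ u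
  rfl
lemma asmul (b : ℕ) (x : ℂ) (Q : Good N) (u : Hc N b) : act N b (x • Q) u = x • act N b Q u := by
  obtain ⟨c, rfl⟩ := Submodule.mkQ_surjective _ u
  rfl
lemma aone (b : ℕ) (u : Hc N b) : act N b 1 u = u := by
  obtain ⟨c, rfl⟩ := Submodule.mkQ_surjective _ u
  rfl
end helpers

lemma hO5 (I : Ideal (PS n)) (hE : ∀ a b f, f ∈ I → (wS n).E a b f ∈ I) (t : ℂ)
    (hB : ∀ a b f, f ∈ I → (wS n).B t a b f ∈ I) (b : ℕ) (i j : Fin n) (f : PS n) (u : Hc (idL I) b) :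
    act (idL I) b (gB I hE t hB i j) (act (idL I) b (gM (idL I) f) u) =
      act (idL I) b (gM (idL I) f) (act (idL I) b (gB I hE t hB i j) u) +
      ∑ a, (act (idL I) b (gM (idL I) ((wS n).D a j f)) (act (idL I) b (gE I hE a i) u) -
        act (idL I) b (gM (idL I) ((wS n).D a i f)) (act (idL I) b (gE I hE a j) u)) +
      act (idL I) b (gM (idL I) ((wS n).B t i j f)) u := by
    have : gB I hE t hB i j * gM (idL I) f = gM (idL I) f * gB I hE t hB i j +
        ∑ a, (gM (idL I) ((wS n).D a j f) * gE I hE a i - gM (idL I) ((wS n).D a i f) * gE I hE a j) +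
        gM (idL I) ((wS n).B t i j f) := by
      refine Subtype.ext (LinearMap.ext fun v => ?_)
      rw [cadd, cadd, coe_sum_apply, cmul, cmul]
      simp only [csub, cmul, gM_apply, gE_apply, gB_apply]
      simp only [toL_B, toL_D]
      exact (wL n).B_mul t i j (toL _ f) v
    have h2 := LinearMap.congr_fun (congrArg (act (idL I) b) this) u
    rw [aadd, aadd, act_sum] at h2
    simp only [asub, amul] at h2
    exact h2

lemma hO6 (I : Ideal (PS n)) (hE : ∀ a b f, f ∈ I → (wS n).E a b f ∈ I) (t : ℂ)
    (hB : ∀ a b f, f ∈ I → (wS n).B t a b f ∈ I) (b : ℕ) (i : Fin n) (u : Hc (idL I) b) :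
    ∑ j, act (idL I) b (gB I hE t hB i j) (act (idL I) b (gM (idL I) ((wS n).X i j)) u) =
      ∑ a, act (idL I) b (gE I hE a i) (act (idL I) b (gE I hE i a) u) +
      ((n : ℂ) - 1 - t) • act (idL I) b (gE I hE i i) u - (t * (n - 1)) • u := by
    have : ∑ j, gB I hE t hB i j * gM (idL I) ((wS n).X i j) = ∑ a, gE I hE a i * gE I hE i a +
        ((n : ℂ) - 1 - t) • gE I hE i i - (t * (n - 1)) • 1 := by
      refine Subtype.ext (LinearMap.ext fun v => ?_)
      rw [csub, cadd, coe_sum_apply, coe_sum_apply, csmul, csmul, cone]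
      simp only [cmul, gM_apply, gE_apply, gB_apply]
      rw [← (wL n).id2 t i v]
      simp only [wL_X, wS_X]
    have h2 := LinearMap.congr_fun (congrArg (act (idL I) b) this) u
    rw [act_sum, asub, aadd, asmul, asmul, aone, act_sum] at h2
    simp only [amul] at h2
    exact h2

/-- the operators on cohomology -/
def opsH (I : Ideal (PS n)) (hE : ∀ a b f, f ∈ I → (wS n).E a b f ∈ I) (t : ℤ)
    (hB : ∀ a b f, f ∈ I → (wS n).B t a b f ∈ I) (b : ℕ) (hb : b ≤ Fintype.card (SkewIdx n)) :
    Ops n t (Hc (idL I) b) where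
  mul := (act (idL I) b).comp (gM (idL I))
  E i j := act (idL I) b (gE I hE i j)
  B i j := act (idL I) b (gB I hE t hB i j)
  o2 := by
    intro a c f u
    have : gE I hE a c * gM (idL I) f = gM (idL I) f * gE I hE a c + gM (idL I) ((wS n).E a c f) := by
      refine Subtype.ext (LinearMap.ext fun v => ?_)
      change (wL n).E a c (toL _ f * v) = toL _ f * (wL n).E a c v + toL _ ((wS n).E a c f) * v
      rw [Derivation.leibniz, toL_E, smul_eq_mul, smul_eq_mul, mul_comm v]
    have h2 := LinearMap.congr_fun (congrArg (act (idL I) b) this) u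
    rw [amul, aadd, amul] at h2
    exact h2
  o3 := by
    intro i j k l u
    have : gE I hE i j * gE I hE k l = gE I hE k l * gE I hE i j + dlt ℂ j k • gE I hE i l - dlt ℂ i l • gE I hE k j := by
      refine Subtype.ext (LinearMap.ext fun v => ?_)
      change (wL n).E i j ((wL n).E k l v) = (wL n).E k l ((wL n).E i j v) + dlt ℂ j k • (wL n).E i l v - dlt ℂ i l • (wL n).E k j v
      rw [WD.EE, dltL, dltL]
    have h2 := LinearMap.congr_fun (congrArg (act (idL I) b) this) u
    rw [amul, asub, aadd, amul, asmul, asmul] at h2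
    exact h2
  o4 := by
    intro i j a c u
    have : gB I hE t hB i j * gE I hE a c = gE I hE a c * gB I hE t hB i j + dlt ℂ i a • gB I hE t hB c j + dlt ℂ j a • gB I hE t hB i c := by
      refine Subtype.ext (LinearMap.ext fun v => ?_)
      change (wL n).B t i j ((wL n).E a c v) = (wL n).E a c ((wL n).B t i j v) + dlt ℂ i a • (wL n).B t c j v + dlt ℂ j a • (wL n).B t i c v
      rw [WD.BE, dltL, dltL]
    have h2 := LinearMap.congr_fun (congrArg (act (idL I) b) this) u
    rw [amul, aadd, aadd, amul, asmul, asmul] at h2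
    exact h2
  o5 := fun i j f u => hO5 I hE t hB b i j f u
  o6 := fun i u => hO6 I hE t hB b i u
  hd := by
    intro u
    obtain ⟨c, rfl⟩ := Submodule.mkQ_surjective _ u
    obtain ⟨T, hT⟩ := cmpZ_sum I hE b c
    rw [← hT, map_sum]
    exact Submodule.sum_mem _ fun w _ => Submodule.mem_iSup_of_mem w (cmpZ_wt I hE b w c)
  hb := by
    have hfg : (idL I).FG := (IsNoetherian.noetherian I).map _
    have h1 : ∀ i : Fin n, ∃ C : ℤ, ∀ (c : Finset (SkewIdx n) → Lau (SkewIdx n)) (w : Fin n → ℤ), IsC (idL I) c → Supp c b → dl c = 0 →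
        (∀ A, (GrL (wtV n)).comp w (c A) = c A) → C < w i → ∃ d, IsC (idL I) d ∧ dl d = c := by
      intro i
      exact crude (Pi.evalAddMonoidHom (fun _ : Fin n => ℤ) i) (by
        intro p
        simp only [Pi.evalAddMonoidHom_apply, wtV, Pi.add_apply, Pi.single_apply]
        split_ifs <;> simp) (Fintype.card (SkewIdx n) - b) b (by omega) _ (GrL (wtV n)) (idL I) (idL_graded I hE) hfg
    choose C hC using h1
    refine ⟨∑ i, |C i|, fun w u hu0 hu i => ?_⟩
    obtain ⟨c, rfl⟩ := Submodule.mkQ_surjective _ u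
    obtain ⟨T, hT⟩ := cmpZ_sum I hE b c
    have h2 := (wt_indep T (fun w => (Bc (idL I) b).mkQ (cmpZ I hE b w c)) (fun w => cmpZ_wt I hE b w c) w _ hu
      (by rw [← map_sum, hT]) hu0).2
    by_contra hlt
    push Not at hlt
    have h3 : |C i| ≤ ∑ i, |C i| := Finset.single_le_sum (f := fun i => |C i|) (fun i _ => abs_nonneg _) (Finset.mem_univ i)
    have h4 := le_abs_self (C i)
    let c' := cmpZ I hE b w c
    obtain ⟨d, hd1, hd2⟩ := hC i c'.1 w c'.2.1 c'.2.2.1 c'.2.2.2 (fun A => by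
      change (GrL (wtV n)).comp w ((GrL (wtV n)).comp w _) = (GrL (wtV n)).comp w _
      rw [(GrL (wtV n)).comp_comp, if_pos rfl]) (by linarith)
    apply hu0
    rw [← h2]
    change (Bc (idL I) b).mkQ c' = 0
    rw [Submodule.mkQ_apply, Submodule.Quotient.mk_eq_zero]
    exact ⟨d, hd1, hd2⟩

lemma kill (I : Ideal (PS n)) (b : ℕ) (hb : b < Fintype.card (SkewIdx n)) (f : PS n) (hf : f ∈ I) (u : Hc (idL I) b) :
    act (idL I) b (gM (idL I) f) u = 0 := by
  obtain ⟨c, rfl⟩ := Submodule.mkQ_surjective _ u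
  have hle : ∀ A (v : Lau (SkewIdx n)), v ∈ loc (idL I) A → (fun _ : Unit => v) ∈ loc (Sfree (SkewIdx n) Unit) A := by
    rintro A v ⟨h, hh⟩
    refine ⟨h, fun _ => ?_⟩
    obtain ⟨g, _, hg⟩ := mem_idL.1 hh
    exact ⟨g, hg⟩
  obtain ⟨d, hd1, hd2, -⟩ := exact_free' (ι := Unit) (fun A _ => c.1 A) (fun A => hle A _ (c.2.1 A))
    (by
      ext A i : 2
      have := congrFun c.2.2.2 A
      simpa [dl, Finset.sum_apply] using this) (b := b)
    (fun A hA => by ext1 i; exact c.2.2.1 A hA) hb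
  rw [act_mk, Submodule.mkQ_apply, Submodule.Quotient.mk_eq_zero]
  refine ⟨fun A => toL _ f * d A (), fun A => ?_, ?_⟩
  · obtain ⟨h, hh⟩ := hd1 A
    obtain ⟨g, hg⟩ := hh ()
    refine ⟨h, mem_idL.2 ⟨g * f, I.mul_mem_left g hf, ?_⟩⟩
    rw [map_mul, hg, smul_def', Pi.smul_apply, smul_def']
    ring
  · have h1 := dl_lin (LinearMap.mulLeft ℂ (toL _ f)) (fun A => d A ())
    refine h1.trans ?_
    ext1 A
    have h2 := congrFun (congrFun hd2 A) ()
    change toL _ f * dl (fun A => d A ()) A = toL _ f * c.1 A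
    congr 1
    rw [← h2]
    simp [dl, Finset.sum_apply]

theorem cohZero (hn : 0 < n) (I' I : Ideal (PS n)) (hle : I' ≤ I)
    (hE' : ∀ a b f, f ∈ I' → (wS n).E a b f ∈ I') (hE : ∀ a b f, f ∈ I → (wS n).E a b f ∈ I) (t' t : ℤ)
    (hB' : ∀ a b f, f ∈ I' → (wS n).B t' a b f ∈ I') (hB : ∀ a b f, f ∈ I → (wS n).B t a b f ∈ I)
    (htt : t' < t) (ht : -((n : ℤ) - 1) < t) {d : ℕ} (f : PS n) (hf : f.IsHomogeneous d) (hf0 : f ≠ 0) (hfI : f ∈ I)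
    (b : ℕ) (hb : b < Fintype.card (SkewIdx n)) :
    HZ (LinearMap.id : Lau (SkewIdx n) →ₗ[Lau (SkewIdx n)] Lau (SkewIdx n)) (idL I') (idL I) b := by
  refine tau_zero (idL_mono hle) b ?_
  exact lieMain hn (opsH I' hE' t' hB' b hb.le) (opsH I hE t hB b hb.le) htt ht (tau (idL_mono hle) b)
    (fun f u => tau_act (idL_mono hle) b _ _ _ u) (fun i j u => tau_act (idL_mono hle) b _ _ _ u) f hf hf0
    (fun u => kill I b hb f hfI u)

end ideal
end Cech
end SkewLC

namespace SkewLC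
namespace Cech
section pfB
variable {n : ℕ} {R : Type} [CommRing R] [Algebra ℂ R] (w : WD n R)

lemma F_pf (A : Finset (Fin n)) (q : R) (hD : ∀ a, a ∉ A → ∀ j, w.D a j q = 0)
    (hE : ∀ a ∈ A, ∀ b, w.E a b q = dlt R a b * q) (i j : Fin n) :
    w.F i j q = (2 - (A.card : ℂ)) • w.D i j q := by
  by_cases hi : i ∈ A
  · by_cases hj : j ∈ A
    · have h1 : w.F i j q = ∑ a ∈ A, w.E a i (w.D a j q) := by
        rw [WD.F]
        refine (Finset.sum_subset (Finset.subset_univ A) fun a _ ha => ?_).symm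
        rw [hD a ha, map_zero]
      have h2 : ∀ a ∈ A, w.E a i (w.D a j q) = dlt R i a * w.D a j q - w.D i j q - dlt R j a * w.D a i q := by
        intro a ha
        have := w.DE a j a i q
        rw [hE a ha, Derivation.leibniz, WD.dlt_map, smul_zero, add_zero, smul_eq_mul] at this
        have h3 : dlt R a a = 1 := by simp [dlt]
        rw [h3, WD.dlt_comm a i] at this
        rw [this]; ring
      rw [h1, Finset.sum_congr rfl h2, Finset.sum_sub_distrib, Finset.sum_sub_distrib, Finset.sum_const]
      simp only [dlt, ite_mul, one_mul, zero_mul, Finset.sum_ite_eq, hi, hj, if_true]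
      rw [w.Ds j i, sub_smul, ← Nat.cast_smul_eq_nsmul ℂ, two_smul]; ring
    · rw [w.Ds i j, hD j hj, neg_zero, smul_zero, WD.F]
      refine Finset.sum_eq_zero fun a _ => ?_
      rw [w.Ds a j, hD j hj, neg_zero, map_zero]
  · rw [hD i hi, smul_zero, WD.F_eq]
    refine Finset.sum_eq_zero fun a _ => Finset.sum_eq_zero fun k _ => ?_
    rw [w.Dc, hD i hi, map_zero, mul_zero]

lemma B_pf (A : Finset (Fin n)) (q : R) (hD : ∀ a, a ∉ A → ∀ j, w.D a j q = 0)
    (hE : ∀ a ∈ A, ∀ b, w.E a b q = dlt R a b * q) (i j : Fin n) (e : ℕ) (he : 1 ≤ e) :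
    w.B ((e : ℂ) + 1 - A.card) i j (q ^ e) = 0 := by
  obtain ⟨m, rfl⟩ : ∃ m, e = m + 1 := ⟨e - 1, by omega⟩
  have h1 : w.F i j (q ^ (m + 1)) = (((m : ℂ) + 1) * (m + 2 - A.card)) • (q ^ m * w.D i j q) := by
    have h2 : ∀ a, w.E a i (w.D a j (q ^ (m + 1))) =
        ((m : ℂ) + 1) • (q ^ m * w.E a i (w.D a j q)) + (((m : ℂ) + 1) * m) • (q ^ m * (dlt R a i * w.D a j q)) := by
      intro a
      rw [Derivation.leibniz_pow, Nat.add_sub_cancel, map_nsmul, ← Nat.cast_smul_eq_nsmul ℂ]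
      push_cast
      by_cases ha : a ∈ A
      · rw [smul_eq_mul, Derivation.leibniz, Derivation.leibniz_pow, hE a ha, smul_add, mul_smul]
        congr 2
        rw [← Nat.cast_smul_eq_nsmul ℂ]
        rcases m with _ | k
        · simp
        · rw [Nat.add_sub_cancel, pow_succ]
          simp only [smul_eq_mul, Algebra.mul_smul_comm]
          congr 1
          ring
      · simp [hD a ha]
    rw [WD.F, Finset.sum_congr rfl fun a _ => h2 a, Finset.sum_add_distrib, ← Finset.smul_sum, ← Finset.smul_sum,
      ← Finset.mul_sum, ← Finset.mul_sum, WD.dlt_sum' i (fun a => w.D a j q)]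
    have h3 : ∑ a, w.E a i (w.D a j q) = _ := F_pf w A q hD hE i j
    rw [h3, Algebra.mul_smul_comm, smul_smul, ← add_smul]
    congr 1; ring
  rw [WD.B, h1, Derivation.leibniz_pow, Nat.add_sub_cancel, ← Nat.cast_smul_eq_nsmul ℂ, smul_smul, smul_eq_mul, ← sub_smul]
  push_cast
  rw [show ((m : ℂ) + 1) * (m + 2 - A.card) - (m + 1 + 1 - A.card) * (m + 1) = 0 by ring, zero_smul]

end pfB
section gl
variable {n : ℕ}

lemma glMap_X (g : Matrix (Fin n) (Fin n) ℂ) (i j : Fin n) :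
    glMap n g ((wS n).X i j) = ∑ a, ∑ b, (g i a * g j b) • (wS n).X a b := by
  refine sk_ind (fun p => (MvPolynomial.X p : PS n)) (Q := fun i j (y : PS n) => glMap n g y = ∑ a, ∑ b, (g i a * g j b) • (wS n).X a b) ?_ ?_ ?_ i j
  · intro i
    rw [map_zero]
    have h : ∑ a, ∑ b, (g i a * g i b) • (wS n).X a b = - ∑ a, ∑ b, (g i a * g i b) • (wS n).X a b := by
      conv_lhs => rw [Finset.sum_comm]
      rw [← Finset.sum_neg_distrib]
      refine Finset.sum_congr rfl fun a _ => ?_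
      rw [← Finset.sum_neg_distrib]
      refine Finset.sum_congr rfl fun b _ => ?_
      rw [(wS n).Xs b a, smul_neg, mul_comm]
    exact (self_eq_neg.mp h).symm
  · intro i j v hv
    rw [map_neg, hv, Finset.sum_comm, ← Finset.sum_neg_distrib]
    refine Finset.sum_congr rfl fun a _ => ?_
    rw [← Finset.sum_neg_distrib]
    refine Finset.sum_congr rfl fun b _ => ?_
    rw [(wS n).Xs b a, smul_neg, neg_neg, mul_comm]
  · intro p
    rw [glMap, MvPolynomial.aeval_X]; rfl

lemma glMap_comp (h g : Matrix (Fin n) (Fin n) ℂ) (f : PS n) : glMap n h (glMap n g f) = glMap n (g * h) f := by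
  have : (glMap n h).comp (glMap n g) = glMap n (g * h) := by
    apply MvPolynomial.algHom_ext
    intro p
    have hp : (MvPolynomial.X p : PS n) = (wS n).X p.1.1 p.1.2 := (sk_lt (fun p => (MvPolynomial.X p : PS n)) p.2).symm
    rw [hp, AlgHom.comp_apply, glMap_X, glMap_X, map_sum]
    simp only [map_sum, map_smul, glMap_X, Matrix.mul_apply, Finset.sum_mul_sum, Finset.sum_smul, Finset.smul_sum, smul_smul]
    rw [Finset.sum_comm_cycle]
    refine Finset.sum_congr rfl fun c _ => ?_
    rw [Finset.sum_comm_cycle]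
    refine Finset.sum_congr rfl fun d _ => Finset.sum_congr rfl fun a _ => Finset.sum_congr rfl fun b _ => ?_
    congr 1; ring
  exact AlgHom.congr_fun this f

lemma D_gl (g : Matrix (Fin n) (Fin n) ℂ) (i j : Fin n) (f : PS n) :
    (wS n).D i j (glMap n g f) = ∑ k, ∑ l, (g k i * g l j) • glMap n g ((wS n).D k l f) := by
  induction f using MvPolynomial.induction_on with
  | C a =>
    rw [← MvPolynomial.algebraMap_eq, AlgHom.commutes, Derivation.map_algebraMap]
    simp
  | add f h hf hh => 
    simp only [map_add, hf, hh, smul_add, Finset.sum_add_distrib]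
  | mul_X f p hf =>
    have hp : (MvPolynomial.X p : PS n) = (wS n).X p.1.1 p.1.2 := (sk_lt (fun p => (MvPolynomial.X p : PS n)) p.2).symm
    have hX : (wS n).D i j (glMap n g ((wS n).X p.1.1 p.1.2)) = ∑ k, ∑ l, (g k i * g l j) • glMap n g ((wS n).D k l ((wS n).X p.1.1 p.1.2)) := by
      have e1 : (wS n).D i j (glMap n g ((wS n).X p.1.1 p.1.2)) = algebraMap ℂ (PS n) (g p.1.1 i * g p.1.2 j - g p.1.1 j * g p.1.2 i) := by
        rw [glMap_X]
        simp only [map_sum, Derivation.map_smul, (wS n).DX]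
        simp only [dlt, mul_ite, mul_one, mul_zero, smul_sub, smul_ite, smul_zero, Finset.sum_sub_distrib, Finset.sum_ite_eq, Finset.mem_univ, if_true]
        simp [Finset.sum_ite_eq, Algebra.smul_def]
      have e2 : ∑ k, ∑ l, (g k i * g l j) • glMap n g ((wS n).D k l ((wS n).X p.1.1 p.1.2)) = algebraMap ℂ (PS n) (g p.1.1 i * g p.1.2 j - g p.1.1 j * g p.1.2 i) := by
        have hd : ∀ a b : Fin n, glMap n g (dlt (PS n) a b) = dlt (PS n) a b := by
          intro a b; unfold dlt; split_ifs <;> simp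
        simp only [(wS n).DX, map_sub, map_mul, hd]
        simp only [dlt, mul_ite, mul_one, mul_zero, smul_sub, smul_ite, smul_zero, Finset.sum_sub_distrib, Finset.sum_ite_eq, Finset.sum_ite_eq', Finset.mem_univ, if_true]
        simp [Finset.sum_ite_eq, Algebra.smul_def]
        ring
      rw [e1, e2]
    rw [hp, map_mul, Derivation.leibniz, hf, hX]
    simp only [Derivation.leibniz, smul_eq_mul, map_add, map_mul, smul_add, Finset.sum_add_distrib, Finset.mul_sum, Algebra.mul_smul_comm]

lemma D2_gl (g : Matrix (Fin n) (Fin n) ℂ) (i j i' j' : Fin n) (f : PS n) :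
    (wS n).D i j ((wS n).D i' j' (glMap n g f)) = ∑ k', ∑ l', ∑ k, ∑ l, (g k' i' * g l' j' * (g k i * g l j)) • glMap n g ((wS n).D k l ((wS n).D k' l' f)) := by
  rw [D_gl]
  simp only [map_sum, Derivation.map_smul, D_gl, Finset.smul_sum, smul_smul]

lemma F_gl (g : Matrix (Fin n) (Fin n) ℂ) (i j : Fin n) (f : PS n) :
    (wS n).F i j (glMap n g f) = ∑ k, ∑ l, (g k i * g l j) • glMap n g ((wS n).F k l f) := by
  have h1 : (wS n).F i j (glMap n g f) = ∑ a, ∑ b, ∑ k', ∑ l', ∑ k, ∑ l, (g k' a * g l' j * (g k i * g l b)) •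
      ((wS n).X a b * glMap n g ((wS n).D k l ((wS n).D k' l' f))) := by
    rw [WD.F_eq]
    refine Finset.sum_congr rfl fun a _ => Finset.sum_congr rfl fun b _ => ?_
    rw [D2_gl]
    simp only [Finset.mul_sum, Algebra.mul_smul_comm]
  have h2 : ∑ k, ∑ l, (g k i * g l j) • glMap n g ((wS n).F k l f) = ∑ k, ∑ l', ∑ k', ∑ l, ∑ a, ∑ b,
      (g k' a * g l' j * (g k i * g l b)) • ((wS n).X a b * glMap n g ((wS n).D k l ((wS n).D k' l' f))) := by
    refine Finset.sum_congr rfl fun k _ => Finset.sum_congr rfl fun l' _ => ?_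
    simp only [WD.F_eq, map_sum, map_mul, glMap_X, Finset.smul_sum, Finset.sum_mul, smul_mul_assoc, smul_smul]
    refine Finset.sum_congr rfl fun a _ => Finset.sum_congr rfl fun b _ => Finset.sum_congr rfl fun c _ => Finset.sum_congr rfl fun d _ => ?_
    congr 1; ring
  rw [h1, h2]
  simp only [← Finset.sum_product', Finset.univ_product_univ]
  refine Fintype.sum_equiv ⟨fun x => (x.2.2.2.2.1, x.2.2.2.1, x.2.2.1, x.2.2.2.2.2, x.1, x.2.1),
    fun x => (x.2.2.2.2.1, x.2.2.2.2.2, x.2.2.1, x.2.1, x.1, x.2.2.2.1), fun x => rfl, fun x => rfl⟩ _ _ ?_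
  rintro ⟨a, b, c, d, e, f⟩
  simp only [Equiv.coe_fn_mk]

lemma B_gl (t : ℂ) (g : Matrix (Fin n) (Fin n) ℂ) (i j : Fin n) (f : PS n) :
    (wS n).B t i j (glMap n g f) = ∑ k, ∑ l, (g k i * g l j) • glMap n g ((wS n).B t k l f) := by
  simp only [WD.B, F_gl, D_gl, map_sub, map_smul, smul_sub, Finset.sum_sub_distrib, Finset.smul_sum]
  congr 1
  refine Finset.sum_congr rfl fun a _ => Finset.sum_congr rfl fun b _ => ?_
  rw [smul_comm]

lemma coeff_mem_of_eval (I : Ideal (PS n)) (P : Polynomial (PS n)) (T : Set ℂ) (hT : T.Infinite)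
    (h : ∀ t ∈ T, P.eval (algebraMap ℂ (PS n) t) ∈ I) (k : ℕ) : P.coeff k ∈ I := by
  let V := PS n ⧸ (I.restrictScalars ℂ : Submodule ℂ (PS n))
  have h0 : ∀ φ : Module.Dual ℂ V, φ (Submodule.mkQ _ (P.coeff k)) = 0 := by
    intro φ
    let ψ : PS n →ₗ[ℂ] ℂ := φ.comp (Submodule.mkQ _)
    have hψ : ∀ f ∈ I, ψ f = 0 := by
      intro f hf
      have : (I.restrictScalars ℂ : Submodule ℂ (PS n)).mkQ f = 0 := by
        rw [Submodule.mkQ_apply, Submodule.Quotient.mk_eq_zero]; exact hf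
      change φ _ = 0
      rw [this, map_zero]
    let Q : Polynomial ℂ := ∑ i ∈ Finset.range (P.natDegree + 1), Polynomial.monomial i (ψ (P.coeff i))
    have hQ : Q = 0 := by
      apply Polynomial.eq_zero_of_infinite_isRoot
      refine hT.mono fun t ht => ?_
      have h1 := hψ _ (h t ht)
      rw [Polynomial.eval_eq_sum_range, map_sum] at h1
      change Q.eval t = 0
      rw [Polynomial.eval_finset_sum, ← h1]
      refine Finset.sum_congr rfl fun i _ => ?_
      rw [Polynomial.eval_monomial, ← map_pow, mul_comm (P.coeff i), ← Algebra.smul_def, map_smul, smul_eq_mul, mul_comm]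
    by_cases hk : k ∈ Finset.range (P.natDegree + 1)
    · have h2 : Q.coeff k = ψ (P.coeff k) := by
        simp only [Q, Polynomial.finset_sum_coeff, Polynomial.coeff_monomial]
        rw [Finset.sum_ite_eq' , if_pos hk]
      rw [hQ, Polynomial.coeff_zero] at h2
      exact h2.symm
    · have : P.coeff k = 0 := Polynomial.coeff_eq_zero_of_natDegree_lt (by simpa [Nat.lt_succ_iff] using hk)
      rw [this, map_zero, map_zero]
  have h1 := (Module.forall_dual_apply_eq_zero_iff ℂ _).1 h0
  rw [Submodule.mkQ_apply, Submodule.Quotient.mk_eq_zero] at h1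
  exact h1

/-- the one-parameter path -/
def path (i j : Fin n) : PS n →ₐ[ℂ] Polynomial (PS n) :=
  MvPolynomial.aeval fun p : SkewIdx n =>
    Polynomial.C ((wS n).X p.1.1 p.1.2) + Polynomial.X * Polynomial.C ((wS n).E j i ((wS n).X p.1.1 p.1.2))

lemma path_coeff (i j : Fin n) (f : PS n) : (path i j f).coeff 0 = f ∧ (path i j f).coeff 1 = (wS n).E j i f := by
  induction f using MvPolynomial.induction_on with
  | C a =>
    rw [← MvPolynomial.algebraMap_eq, AlgHom.commutes, Derivation.map_algebraMap, Polynomial.algebraMap_apply]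
    simp [Polynomial.coeff_C]
  | add f h hf hh => 
    simp only [map_add, Polynomial.coeff_add, hf, hh, and_self]
  | mul_X f p hf =>
    have hp : (MvPolynomial.X p : PS n) = (wS n).X p.1.1 p.1.2 := (sk_lt (fun p => (MvPolynomial.X p : PS n)) p.2).symm
    have h1 : path i j (MvPolynomial.X p) = Polynomial.C ((wS n).X p.1.1 p.1.2) + Polynomial.X * Polynomial.C ((wS n).E j i ((wS n).X p.1.1 p.1.2)) := by
      rw [path, MvPolynomial.aeval_X]
    have c0 : (path i j (MvPolynomial.X p)).coeff 0 = (wS n).X p.1.1 p.1.2 := by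
      rw [h1]; simp
    have c1 : (path i j (MvPolynomial.X p)).coeff 1 = (wS n).E j i ((wS n).X p.1.1 p.1.2) := by
      rw [h1, Polynomial.coeff_add, Polynomial.coeff_C, Polynomial.coeff_mul_C, Polynomial.coeff_X_one]
      simp
    rw [map_mul, Polynomial.mul_coeff_zero, Polynomial.mul_coeff_one, hf.1, hf.2, c0, c1, hp, Derivation.leibniz]
    refine ⟨rfl, ?_⟩
    simp only [smul_eq_mul]; ring

lemma sum_two {M : Type} [AddCommGroup M] [Module ℂ M] (x : Fin n → M) (k j : Fin n) (s : ℂ) :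
    ∑ a, ((if k = a then (1 : ℂ) else 0) + s * (if j = a then 1 else 0)) • x a = x k + s • x j := by
  simp only [add_smul, mul_smul, Finset.sum_add_distrib, ite_smul, one_smul, zero_smul, ← Finset.smul_sum,
    Finset.sum_ite_eq, Finset.mem_univ, if_true]

lemma sum_four {M : Type} [AddCommGroup M] [Module ℂ M] (x : Fin n → Fin n → M) (k l j : Fin n) (s s' : ℂ) :
    ∑ a, ∑ b, (((if k = a then (1 : ℂ) else 0) + s * (if j = a then 1 else 0)) *
      ((if l = b then (1 : ℂ) else 0) + s' * (if j = b then 1 else 0))) • x a b =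
      x k l + s' • x k j + s • (x j l + s' • x j j) := by
  simp only [mul_smul, ← Finset.smul_sum, sum_two]

lemma path_eval (i j : Fin n) (t : ℂ) (f : PS n) :
    (path i j f).eval (algebraMap ℂ (PS n) t) = glMap n (1 + t • Matrix.single i j 1) f := by
  have : ((Polynomial.aeval (algebraMap ℂ (PS n) t) : Polynomial (PS n) →ₐ[PS n] PS n).restrictScalars ℂ).comp (path i j) =
      glMap n (1 + t • Matrix.single i j 1) := by
    apply MvPolynomial.algHom_ext
    intro p
    rw [AlgHom.comp_apply, path, MvPolynomial.aeval_X, glMap, MvPolynomial.aeval_X]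
    simp only [AlgHom.restrictScalars_apply, map_add, map_mul, map_pow, Polynomial.aeval_X, Polynomial.aeval_C, Algebra.algebraMap_self, RingHom.id_apply, WD.EX]
    simp only [Matrix.add_apply, Matrix.smul_apply, Matrix.single_apply, Matrix.one_apply, dlt, ← wS_X]
    have e : ∀ k l : Fin n, ∑ a, ∑ b, (((if k = a then (1 : ℂ) else 0) + t • (if i = k ∧ j = a then 1 else 0)) * ((if l = b then (1 : ℂ) else 0) + t • (if i = l ∧ j = b then 1 else 0))) • (wS n).X a b =
       (wS n).X k l + t • ((if i = k then (wS n).X j l else 0) + (if i = l then (wS n).X k j else 0)) := by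
      intro k l
      have h1 : ∀ k a : Fin n, t • (if i = k ∧ j = a then (1 : ℂ) else 0) = (if i = k then t else 0) * (if j = a then 1 else 0) := by
        intro k a
        by_cases h : i = k <;> simp [h]
      simp only [h1]
      rw [sum_four, Ops.X_self, smul_zero, add_zero]
      simp only [ite_smul, zero_smul, smul_add, smul_ite, smul_zero]
      abel
    rw [e]
    simp only [Algebra.smul_def, ite_mul, one_mul, zero_mul]
  rw [← this]
  rfl

lemma gl_single_unit (i j : Fin n) (t : ℂ) (ht : t ≠ -1) : IsUnit (1 + t • Matrix.single i j (1 : ℂ) : Matrix (Fin n) (Fin n) ℂ) := by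
  rw [Matrix.isUnit_iff_isUnit_det, isUnit_iff_ne_zero]
  have h := Matrix.det_one_add_mul_comm (Matrix.of fun (a : Fin n) (_ : Unit) => if a = i then t else 0) (Matrix.of fun (_ : Unit) (a : Fin n) => if a = j then (1 : ℂ) else 0)
  have h1 : (Matrix.of fun (a : Fin n) (_ : Unit) => if a = i then t else 0) * (Matrix.of fun (_ : Unit) (a : Fin n) => if a = j then (1 : ℂ) else 0) = t • Matrix.single i j (1 : ℂ) := by
    ext a b
    simp [Matrix.mul_apply, Matrix.single_apply]
    by_cases h1 : a = i <;> by_cases h2 : b = j <;> simp [h1, h2, eq_comm]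
    · intro h; exact absurd h.symm h2
    · intro h; exact absurd h.symm h1
    · intro h; exact absurd h.symm h1
  rw [h1] at h
  rw [h]
  simp [Matrix.mul_apply]
  split_ifs
  · intro h; apply ht; linear_combination h
  · simp

/-- GL-stability of invariant ideals -/
lemma inv_gl (z : ℕ → ℕ) (g : Matrix.GeneralLinearGroup (Fin n) ℂ) (f : PS n) (hf : f ∈ invIdeal n z) :
    glMap n g.val f ∈ invIdeal n z := by
  refine Submodule.span_induction (p := fun f _ => glMap n g.val f ∈ invIdeal n z) ?_ ?_ ?_ ?_ hf
  · rintro x ⟨h, rfl⟩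
    rw [glMap_comp]
    exact Ideal.subset_span ⟨h * g, by rw [Units.val_mul]⟩
  · rw [map_zero]; exact zero_mem _
  · intro x y _ _ hx hy; rw [map_add]; exact add_mem hx hy
  · intro a x _ hx
    rw [smul_eq_mul, map_mul]; exact Ideal.mul_mem_left _ _ hx

lemma inv_E (z : ℕ → ℕ) (a b : Fin n) (f : PS n) (hf : f ∈ invIdeal n z) : (wS n).E a b f ∈ invIdeal n z := by
  rw [← (path_coeff b a f).2]
  refine coeff_mem_of_eval _ _ {t | t ≠ -1} ?_ (fun t ht => ?_) 1
  · exact Set.Finite.infinite_compl (Set.finite_singleton (-1 : ℂ))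
  · rw [path_eval]
    obtain ⟨u, hu⟩ := gl_single_unit b a t ht
    rw [← hu]
    exact inv_gl z u f hf

lemma inv_B (z : ℕ → ℕ) (t : ℂ) (h0 : ∀ i j, (wS n).B t i j (hwVector n z) = 0) (a b : Fin n) (f : PS n)
    (hf : f ∈ invIdeal n z) : (wS n).B t a b f ∈ invIdeal n z := by
  refine Submodule.span_induction (p := fun f _ => (wS n).B t a b f ∈ invIdeal n z) ?_ ?_ ?_ ?_ hf
  · rintro x ⟨h, rfl⟩
    rw [B_gl]
    simp [h0]
  · have : (wS n).B t a b 0 = 0 := ((wS n).Bl t a b).map_zero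
    rw [this]; exact zero_mem _
  · intro x y _ _ hx hy; rw [WD.B_add]; exact add_mem hx hy
  · intro s x hx' hx
    rw [smul_eq_mul, WD.B_mul]
    refine add_mem (add_mem (Ideal.mul_mem_left _ _ hx) (Submodule.sum_mem _ fun c _ => sub_mem ?_ ?_)) (Ideal.mul_mem_left _ _ hx')
    · exact Ideal.mul_mem_left _ _ (inv_E z _ _ x hx')
    · exact Ideal.mul_mem_left _ _ (inv_E z _ _ x hx')

end gl
end Cech
end SkewLC

namespace SkewLC
namespace Cech
section pfaff
variable {n : ℕ}

lemma der_prod {R : Type} [CommRing R] [Algebra ℂ R] (d : Derivation ℂ R R) {T : Type} [DecidableEq T] (s : Finset T)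
    (f : T → R) : d (∏ i ∈ s, f i) = ∑ i ∈ s, (∏ k ∈ s.erase i, f k) * d (f i) := by
  induction s using Finset.induction_on with
  | empty => simp
  | insert x s hx ih =>
    rw [Finset.prod_insert hx, Derivation.leibniz, ih, Finset.sum_insert hx, Finset.erase_insert hx, smul_eq_mul, smul_eq_mul,
      Finset.mul_sum, add_comm]
    congr 1
    refine Finset.sum_congr rfl fun i hi => ?_
    have hne : x ≠ i := fun h => hx (h ▸ hi)
    rw [Finset.erase_insert_of_ne hne, Finset.prod_insert (fun h => hx (Finset.mem_of_mem_erase h)), mul_assoc]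

/-- matching monomial -/
def mo {T : Type} [Fintype T] (s : T × Fin 2 → Fin n) : PS n := ∏ i : T, (wS n).X (s (i, 0)) (s (i, 1))

/-- unnormalised Pfaffian -/
def PF {T : Type} [Fintype T] [DecidableEq T] (ι : T × Fin 2 → Fin n) : PS n :=
  ∑ σ : Equiv.Perm (T × Fin 2), (Equiv.Perm.sign σ : ℤ) • mo (ι ∘ σ)

variable {T : Type} [Fintype T] [DecidableEq T]

lemma PF_zero (ι : T × Fin 2 → Fin n) (p q : T × Fin 2) (hpq : p ≠ q) (h : ι p = ι q) : PF ι = 0 := by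
  have h1 : PF ι = - PF ι := by
    conv_lhs => rw [PF]
    rw [PF, ← Finset.sum_neg_distrib]
    refine Fintype.sum_equiv (Equiv.mulLeft (Equiv.swap p q)) _ _ fun σ => ?_
    rw [Equiv.coe_mulLeft, Equiv.Perm.sign_mul, Equiv.Perm.sign_swap hpq]
    have : ι ∘ ⇑(Equiv.swap p q * σ) = ι ∘ ⇑σ := by
      funext x
      simp only [Function.comp, Equiv.Perm.mul_apply]
      rw [Equiv.swap_apply_def]
      split_ifs with h1 h2
      · rw [h1, h]
      · rw [h2, h]
      · rfl
    rw [this]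
    simp
  exact self_eq_neg.mp h1

lemma E_mo (a b : Fin n) (s : T × Fin 2 → Fin n) :
    (wS n).E a b (mo s) = ∑ p, dlt (PS n) b (s p) * mo (Function.update s p a) := by
  rw [mo, der_prod, Fintype.sum_prod_type]
  refine Finset.sum_congr rfl fun i _ => ?_
  rw [WD.EX, Fin.sum_univ_two]
  have h0 : ∀ c : Fin 2, mo (Function.update s (i, c) a) = (∏ k ∈ Finset.univ.erase i, (wS n).X (s (k, 0)) (s (k, 1))) *
      (wS n).X (Function.update s (i, c) a (i, 0)) (Function.update s (i, c) a (i, 1)) := by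
    intro c
    rw [mo, ← Finset.prod_erase_mul _ _ (Finset.mem_univ i)]
    congr 1
    refine Finset.prod_congr rfl fun k hk => ?_
    have hk' := Finset.ne_of_mem_erase hk
    rw [Function.update_of_ne (by simp [hk']), Function.update_of_ne (by simp [hk'])]
  rw [h0, h0, Function.update_self, Function.update_self, Function.update_of_ne (by simp), Function.update_of_ne (by simp)]
  ring

lemma E_PF (a b : Fin n) (ι : T × Fin 2 → Fin n) :
    (wS n).E a b (PF ι) = ∑ q, dlt (PS n) b (ι q) * PF (Function.update ι q a) := by
  simp only [PF, map_sum, Finset.mul_sum]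
  rw [Finset.sum_comm]
  refine Finset.sum_congr rfl fun σ _ => ?_
  rw [map_zsmul, E_mo, Finset.smul_sum]
  refine Fintype.sum_equiv σ _ _ fun p => ?_
  rw [Function.update_comp_equiv, Equiv.symm_apply_apply, mul_smul_comm]
  rfl

lemma E_PF' (ι : T × Fin 2 → Fin n) (hι : Function.Injective ι) (p : T × Fin 2) (b : Fin n) :
    (wS n).E (ι p) b (PF ι) = dlt (PS n) (ι p) b * PF ι := by
  rw [E_PF]
  have h : ∀ q, dlt (PS n) b (ι q) * PF (Function.update ι q (ι p)) = if q = p then dlt (PS n) (ι p) b * PF ι else 0 := by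
    intro q
    split_ifs with h
    · rw [h, Function.update_eq_self, WD.dlt_comm]
    · rw [PF_zero (Function.update ι q (ι p)) q p h (by rw [Function.update_self, Function.update_of_ne (Ne.symm h)]), mul_zero]
  rw [Finset.sum_congr rfl fun q _ => h q]
  simp

lemma D_mo (a b : Fin n) (s : T × Fin 2 → Fin n) :
    (wS n).D a b (mo s) = ∑ i, (∏ k ∈ Finset.univ.erase i, (wS n).X (s (k, 0)) (s (k, 1))) *
      (dlt (PS n) a (s (i, 0)) * dlt (PS n) b (s (i, 1)) - dlt (PS n) a (s (i, 1)) * dlt (PS n) b (s (i, 0))) := by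
  rw [mo, der_prod]
  simp only [(wS n).DX]

lemma D_PF_zero (ι : T × Fin 2 → Fin n) (a j : Fin n) (ha : ∀ p, ι p ≠ a) : (wS n).D a j (PF ι) = 0 := by
  rw [PF, map_sum]
  refine Finset.sum_eq_zero fun σ _ => ?_
  rw [map_zsmul, D_mo]
  have : ∀ p, dlt (PS n) a (ι p) = 0 := fun p => by simp [dlt, (ha p).symm]
  simp [this]

lemma PF_equiv {T' : Type} [Fintype T'] [DecidableEq T'] (e : T ≃ T') (ι : T' × Fin 2 → Fin n) :
    PF (fun p : T × Fin 2 => ι (e p.1, p.2)) = PF ι := by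
  rw [PF, PF]
  refine Fintype.sum_equiv (Equiv.permCongr (e.prodCongr (Equiv.refl _))) _ _ fun σ => ?_
  rw [Equiv.Perm.sign_permCongr, mo, mo]
  congr 1
  refine Fintype.prod_equiv e _ _ fun i => ?_
  simp [Function.comp, Equiv.permCongr_apply]
  rfl

/-- the term in the expansion -/
def GT (ι : Option T × Fin 2 → Fin n) (σ : Equiv.Perm (Option T × Fin 2)) : PS n :=
  (∏ k : T, (wS n).X (ι (σ (some k, 0))) (ι (σ (some k, 1)))) *
   (dlt (PS n) (ι (none, 0)) (ι (σ (none, 0))) * dlt (PS n) (ι (none, 1)) (ι (σ (none, 1))))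

lemma D_PF_aux (ι : Option T × Fin 2 → Fin n) :
    (wS n).D (ι (none, 0)) (ι (none, 1)) (PF ι) =
     ((2 * (Fintype.card T + 1) : ℕ) : ℂ) • ∑ σ : Equiv.Perm (Option T × Fin 2), (Equiv.Perm.sign σ : ℤ) • GT ι σ := by
  have h1 : ∀ i : Option T, ∑ σ : Equiv.Perm (Option T × Fin 2), (Equiv.Perm.sign σ : ℤ) •
      ((∏ k ∈ Finset.univ.erase i, (wS n).X (ι (σ (k, 0))) (ι (σ (k, 1)))) *
       (dlt (PS n) (ι (none, 0)) (ι (σ (i, 0))) * dlt (PS n) (ι (none, 1)) (ι (σ (i, 1))))) =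
      ∑ σ : Equiv.Perm (Option T × Fin 2), (Equiv.Perm.sign σ : ℤ) • GT ι σ := by
    intro i
    let π : Equiv.Perm (Option T × Fin 2) := Equiv.swap (i, 0) (none, 0) * Equiv.swap (i, 1) (none, 1)
    have hs : Equiv.Perm.sign π = 1 := by
      by_cases hi : i = none
      · simp [π, hi]
      · rw [Equiv.Perm.sign_mul, Equiv.Perm.sign_swap (by simp [hi]), Equiv.Perm.sign_swap (by simp [hi])]; simp
    have h0 : ∀ k, π (k, 0) = (Equiv.swap i none k, 0) := by
      intro k
      simp only [π, Equiv.Perm.mul_apply, Equiv.swap_apply_def, Prod.mk.injEq]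
      split_ifs <;> simp_all
    have h1 : ∀ k, π (k, 1) = (Equiv.swap i none k, 1) := by
      intro k
      simp only [π, Equiv.Perm.mul_apply, Equiv.swap_apply_def, Prod.mk.injEq]
      split_ifs <;> simp_all
    symm
    refine Fintype.sum_equiv (Equiv.mulRight π) _ _ fun σ => ?_
    rw [Equiv.coe_mulRight, Equiv.Perm.sign_mul, hs, mul_one]
    simp only [Equiv.Perm.mul_apply, h0, h1, Equiv.swap_apply_left, GT]
    congr 2
    have h2 : ∏ k : T, (wS n).X (ι (σ (some k, 0))) (ι (σ (some k, 1))) =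
        ∏ k ∈ (Finset.univ : Finset (Option T)).erase none, (wS n).X (ι (σ (k, 0))) (ι (σ (k, 1))) := by
      have := Finset.prod_erase_mul (Finset.univ : Finset (Option T)) (fun k => (wS n).X (ι (σ (k, 0))) (ι (σ (k, 1)))) (Finset.mem_univ none)
      have e : (Finset.univ : Finset (Option T)).erase none = Finset.univ.map Function.Embedding.some := by
        ext x; cases x <;> simp
      rw [e, Finset.prod_map]; rfl
    rw [h2]
    refine Finset.prod_equiv (Equiv.swap i none) ?_ ?_
    · intro k
      simp only [Finset.mem_erase, Finset.mem_univ, and_true]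
      rw [not_iff_not, Equiv.swap_apply_eq_iff, Equiv.swap_apply_left]
    · intro k _
      simp
  have h2 : ∀ i : Option T, ∑ σ : Equiv.Perm (Option T × Fin 2), (Equiv.Perm.sign σ : ℤ) •
      ((∏ k ∈ Finset.univ.erase i, (wS n).X (ι (σ (k, 0))) (ι (σ (k, 1)))) *
       (dlt (PS n) (ι (none, 0)) (ι (σ (i, 1))) * dlt (PS n) (ι (none, 1)) (ι (σ (i, 0))))) =
      - ∑ σ : Equiv.Perm (Option T × Fin 2), (Equiv.Perm.sign σ : ℤ) • GT ι σ := by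
    intro i
    rw [← h1 i, ← Finset.sum_neg_distrib]
    refine Fintype.sum_equiv (Equiv.mulRight (Equiv.swap (i, 0) (i, 1))) _ _ fun σ => ?_
    rw [Equiv.coe_mulRight, Equiv.Perm.sign_mul, Equiv.Perm.sign_swap (by simp)]
    simp only [Equiv.Perm.mul_apply, Equiv.swap_apply_left, Equiv.swap_apply_right]
    have hp : ∏ k ∈ Finset.univ.erase i, (wS n).X (ι (σ ((Equiv.swap (i, (0 : Fin 2)) (i, 1)) (k, 0)))) (ι (σ ((Equiv.swap (i, (0 : Fin 2)) (i, 1)) (k, 1)))) =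
        ∏ k ∈ Finset.univ.erase i, (wS n).X (ι (σ (k, 0))) (ι (σ (k, 1))) := by
      refine Finset.prod_congr rfl fun k hk => ?_
      have hk' := Finset.ne_of_mem_erase hk
      rw [Equiv.swap_apply_of_ne_of_ne (by simp [hk']) (by simp [hk']), Equiv.swap_apply_of_ne_of_ne (by simp [hk']) (by simp [hk'])]
    rw [hp]
    simp
  rw [PF, map_sum]
  simp only [map_zsmul, D_mo, Function.comp, mul_sub, Finset.sum_sub_distrib, smul_sub]
  set Z := ∑ σ : Equiv.Perm (Option T × Fin 2), (Equiv.Perm.sign σ : ℤ) • GT ι σ with hZ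
  simp only [Finset.smul_sum]
  rw [Finset.sum_comm, Finset.sum_congr rfl fun i _ => h1 i]
  conv_lhs => 
    arg 2
    rw [Finset.sum_comm, Finset.sum_congr rfl fun i _ => h2 i]
  simp only [Finset.sum_const, Finset.card_univ, Fintype.card_option]
  rw [Nat.cast_smul_eq_nsmul ℂ, smul_neg, sub_neg_eq_add, ← two_nsmul, smul_smul]

/-- splitting off a pair -/
def ee (T : Type) : (T × Fin 2) ⊕ Fin 2 ≃ Option T × Fin 2 where
  toFun x := Sum.elim (fun p => (some p.1, p.2)) (fun b => (none, b)) x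
  invFun p := match p with
    | (some t, b) => Sum.inl (t, b)
    | (none, b) => Sum.inr b
  left_inv x := by rcases x with ⟨t, b⟩ | b <;> rfl
  right_inv p := by rcases p with ⟨_ | t, b⟩ <;> rfl

lemma D_PF (ι : Option T × Fin 2 → Fin n) (hι : Function.Injective ι) :
    (wS n).D (ι (none, 0)) (ι (none, 1)) (PF ι) =
     ((2 * (Fintype.card T + 1) : ℕ) : ℂ) • PF (fun p : T × Fin 2 => ι (some p.1, p.2)) := by
  rw [D_PF_aux]
  congr 1
  rw [PF]
  symm
  let ex : Equiv.Perm (T × Fin 2) → Equiv.Perm (Option T × Fin 2) := fun τ => (ee T).permCongr (Equiv.Perm.sumCongr τ 1)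
  have e1 : ∀ τ p, ex τ (some p.1, p.2) = (some (τ p).1, (τ p).2) := fun τ p => rfl
  have e2 : ∀ τ b, ex τ (none, b) = (none, b) := fun τ p => rfl
  have einj : Function.Injective ex := by
    intro τ τ' h
    ext1 p
    have := congrArg (fun s => s (some p.1, p.2)) h
    simp only [e1, Prod.mk.injEq, Option.some.injEq] at this
    exact Prod.ext this.1 this.2
  refine Finset.sum_of_injOn ex einj.injOn (fun _ _ => Finset.mem_univ _) ?_ ?_
  · intro σ _ hσ
    by_cases hc : σ (none, 0) = (none, 0) ∧ σ (none, 1) = (none, 1)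
    · exfalso
      apply hσ
      have hm : Set.MapsTo ((ee T).symm.permCongr σ) (Set.range Sum.inr) (Set.range Sum.inr) := by
        rintro _ ⟨b, rfl⟩
        refine ⟨b, ?_⟩
        rw [Equiv.permCongr_apply]
        have : σ (none, b) = (none, b) := by
          fin_cases b
          · exact hc.1
          · exact hc.2
        change _ = (ee T).symm (σ (none, b))
        rw [this]; rfl
      have hm' : Set.MapsTo ((ee T).symm.permCongr σ) (Set.range Sum.inl) (Set.range Sum.inl) := by
        rintro _ ⟨p, rfl⟩
        rcases hh : (ee T).symm.permCongr σ (Sum.inl p) with q | b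
        · exact ⟨q, rfl⟩
        · exfalso
          have h3 : (ee T).symm.permCongr σ (Sum.inr b) = Sum.inr b := by
            rw [Equiv.permCongr_apply]
            have : σ (none, b) = (none, b) := by
              fin_cases b
              · exact hc.1
              · exact hc.2
            change (ee T).symm (σ (none, b)) = _
            rw [this]; rfl
          rw [← h3] at hh
          exact Sum.inl_ne_inr (Equiv.injective _ hh)
      obtain ⟨⟨τ, τ'⟩, hτ⟩ := Equiv.Perm.mem_sumCongrHom_range_of_perm_mapsTo_inl hm'
      have hτ' : Equiv.Perm.sumCongr τ τ' = (ee T).symm.permCongr σ := hτ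
      refine ⟨τ, Finset.mem_coe.2 (Finset.mem_univ _), ?_⟩
      apply Equiv.ext
      rintro ⟨_ | t, b⟩
      · rw [e2]
        fin_cases b
        · exact hc.1.symm
        · exact hc.2.symm
      · rw [e1 τ (t, b)]
        have := congrArg (fun s => (ee T) (s (Sum.inl (t, b)))) hτ'
        simp only [Equiv.permCongr_apply, Equiv.symm_symm, Equiv.apply_symm_apply] at this
        exact this
    · rw [GT]
      rw [not_and_or] at hc
      have : dlt (PS n) (ι (none, 0)) (ι (σ (none, 0))) * dlt (PS n) (ι (none, 1)) (ι (σ (none, 1))) = 0 := by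
        rcases hc with hc | hc
        · have : dlt (PS n) (ι (none, 0)) (ι (σ (none, 0))) = 0 := by
            rw [dlt, if_neg]; intro h; exact hc (hι h).symm
          rw [this, zero_mul]
        · have : dlt (PS n) (ι (none, 1)) (ι (σ (none, 1))) = 0 := by
            rw [dlt, if_neg]; intro h; exact hc (hι h).symm
          rw [this, mul_zero]
      rw [this, mul_zero, smul_zero]
  · intro τ _
    have hs : Equiv.Perm.sign (ex τ) = Equiv.Perm.sign τ := by
      simp only [ex]
      rw [Equiv.Perm.sign_permCongr, Equiv.Perm.sign_sumCongr, map_one, mul_one]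
    rw [hs, GT, e2, e2, mo]
    simp only [dlt, if_true, mul_one, Function.comp]
    rfl

end pfaff
end Cech
end SkewLC

namespace SkewLC
namespace Cech
section pfblock
variable {n : ℕ}

/-- standard enumeration of a principal block -/
def io (r : ℕ) (h : 2 * r ≤ n) (p : Fin r × Fin 2) : Fin n :=
  ⟨2 * p.1.1 + p.2.1, by have := p.1.2; have := p.2.2; omega⟩

lemma io_inj (r : ℕ) (h : 2 * r ≤ n) : Function.Injective (io r h) := by
  rintro ⟨a, b⟩ ⟨a', b'⟩ hh
  have := congrArg Fin.val hh
  simp only [io] at this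
  have h1 := b.2
  have h2 := b'.2
  refine Prod.ext (Fin.ext ?_) (Fin.ext ?_) <;> simp only <;> omega

/-- pairs equivalence -/
def pe (r : ℕ) : Fin r × Fin 2 ≃ Fin (2 * r) where
  toFun p := ⟨2 * p.1.1 + p.2.1, by have := p.1.2; have := p.2.2; omega⟩
  invFun x := (⟨x.1 / 2, by have := x.2; omega⟩, ⟨x.1 % 2, by omega⟩)
  left_inv p := by
    have h1 := p.2.2
    refine Prod.ext (Fin.ext ?_) (Fin.ext ?_) <;> simp only <;> omega
  right_inv x := by
    apply Fin.ext; simp only; omega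

lemma pfBlock_eq (r : ℕ) (h : 2 * r ≤ n) :
    pfBlock n r = (((2 ^ r * r.factorial : ℕ) : ℂ))⁻¹ • PF (io r h) := by
  rw [pfBlock, dif_pos h]
  congr 1
  rw [PF]
  symm
  refine Fintype.sum_equiv (Equiv.permCongr (pe r)) _ _ fun σ => ?_
  rw [Equiv.Perm.sign_permCongr, mo]
  congr 1
  refine Finset.prod_congr rfl fun i _ => ?_
  rw [wS_X]
  have h0 : (⟨2 * i.1, by have := i.isLt; omega⟩ : Fin (2 * r)) = pe r (i, 0) := rfl
  have h1 : (⟨2 * i.1 + 1, by have := i.isLt; omega⟩ : Fin (2 * r)) = pe r (i, 1) := rfl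
  rw [h0, h1, Equiv.permCongr_apply, Equiv.permCongr_apply, Equiv.symm_apply_apply, Equiv.symm_apply_apply]
  rfl

lemma hom_q (r : ℕ) (h : 2 * r ≤ n) : (pfBlock n r).IsHomogeneous r := by
  rw [pfBlock_eq r h]
  refine hom_smul (MvPolynomial.IsHomogeneous.sum _ _ _ fun σ _ => ?_) _
  rw [← Int.cast_smul_eq_zsmul ℂ]
  refine hom_smul ?_ _
  rw [mo]
  have := MvPolynomial.IsHomogeneous.prod (Finset.univ : Finset (Fin r)) (fun i => (wS n).X ((io r h ∘ σ) (i, 0)) ((io r h ∘ σ) (i, 1))) (fun _ => 1)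
    (fun i _ => hom_X _ _)
  simpa using this

lemma io_surj (r : ℕ) (h : 2 * r ≤ n) (a : Fin n) (ha : a.1 < 2 * r) : ∃ p, io r h p = a :=
  ⟨(⟨a.1 / 2, by omega⟩, ⟨a.1 % 2, by omega⟩), Fin.ext (by simp only [io]; omega)⟩

lemma qE (r : ℕ) (h : 2 * r ≤ n) (a b : Fin n) (ha : a.1 < 2 * r) :
    (wS n).E a b (pfBlock n r) = dlt (PS n) a b * pfBlock n r := by
  obtain ⟨p, rfl⟩ := io_surj r h a ha
  rw [pfBlock_eq r h, Derivation.map_smul, E_PF' _ (io_inj r h), mul_smul_comm]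

lemma qD (r : ℕ) (h : 2 * r ≤ n) (a b : Fin n) (ha : ¬ a.1 < 2 * r) :
    (wS n).D a b (pfBlock n r) = 0 := by
  rw [pfBlock_eq r h, Derivation.map_smul, D_PF_zero, smul_zero]
  rintro p rfl
  apply ha
  have := p.1.2
  have := p.2.2
  simp only [io]; omega

lemma qB (r : ℕ) (h : 2 * r ≤ n) (e : ℕ) (he : 1 ≤ e) (i j : Fin n) :
    (wS n).B (((e : ℤ) + 1 - 2 * r : ℤ) : ℂ) i j (pfBlock n r ^ e) = 0 := by
  have hc : (Finset.univ.filter fun a : Fin n => a.1 < 2 * r).card = 2 * r := by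
    rw [Fin.card_filter_val_lt]; omega
  have := B_pf (wS n) (Finset.univ.filter fun a : Fin n => a.1 < 2 * r) (pfBlock n r)
    (fun a ha j => qD r h a j (by simpa using ha)) (fun a ha b => qE r h a b (by simpa using ha)) i j e he
  rw [hc] at this
  push_cast at this ⊢
  exact this

lemma qDD (r : ℕ) (h : 2 * (r + 1) ≤ n) :
    ∃ c : ℂ, (wS n).D ⟨2 * r, by omega⟩ ⟨2 * r + 1, by omega⟩ (pfBlock n (r + 1)) = c • pfBlock n r := by
  rw [pfBlock_eq (r + 1) h, pfBlock_eq r (by omega), Derivation.map_smul]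
  let ι : Option (Fin r) × Fin 2 → Fin n := fun p => io (r + 1) h ((finSuccEquivLast (n := r)).symm p.1, p.2)
  have hι : Function.Injective ι := by
    rintro ⟨a, b⟩ ⟨a', b'⟩ hh
    have := io_inj _ _ hh
    simpa using this
  have h1 : PF ι = PF (io (r + 1) h) := PF_equiv (finSuccEquivLast (n := r)).symm (io (r + 1) h)
  have h2 := D_PF ι hι
  rw [h1] at h2
  have h3 : (fun p : Fin r × Fin 2 => ι (some p.1, p.2)) = io r (by omega) := by
    funext p
    simp [ι, io]
  have h4 : ι (none, 0) = ⟨2 * r, by omega⟩ := by simp [ι, io]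
  have h5 : ι (none, 1) = ⟨2 * r + 1, by omega⟩ := by simp [ι, io]
  rw [h3, h4, h5] at h2
  rw [h2]
  refine ⟨(((2 ^ (r + 1) * (r + 1).factorial : ℕ) : ℂ))⁻¹ * ((2 * (Fintype.card (Fin r) + 1) : ℕ) : ℂ) * ((2 ^ r * r.factorial : ℕ) : ℂ), ?_⟩
  have hne : ((2 ^ r * r.factorial : ℕ) : ℂ) ≠ 0 := by
    rw [Nat.cast_ne_zero]; positivity
  rw [smul_smul, smul_smul, mul_inv_cancel_right₀ hne]

lemma c_rel (r : ℕ) (h : 2 * (r + 1) ≤ n) (b j : Fin n) (hb : b ≠ ⟨2 * r, by omega⟩) :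
    (wS n).E ⟨2 * r, by omega⟩ b ((wS n).D j ⟨2 * r + 1, by omega⟩ (pfBlock n (r + 1))) =
     - (dlt (PS n) j ⟨2 * r, by omega⟩ * (wS n).D b ⟨2 * r + 1, by omega⟩ (pfBlock n (r + 1))) := by
  have := (wS n).DE j ⟨2 * r + 1, by omega⟩ ⟨2 * r, by omega⟩ b (pfBlock n (r + 1))
  rw [qE (r + 1) h _ _ (by simp only; omega)] at this
  have h1 : dlt (PS n) (⟨2 * r, by omega⟩ : Fin n) b = 0 := by rw [dlt, if_neg (Ne.symm hb)]
  have h2 : dlt (PS n) (⟨2 * r + 1, by omega⟩ : Fin n) ⟨2 * r, by omega⟩ = 0 := by rw [dlt, if_neg (by simp)]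
  rw [h1, h2, zero_mul, zero_mul, map_zero, add_zero] at this
  linear_combination -this

lemma q_exp (r : ℕ) (h : 2 * (r + 1) ≤ n) :
    pfBlock n (r + 1) = - ∑ k, (wS n).X ⟨2 * r + 1, by omega⟩ k * (wS n).D k ⟨2 * r + 1, by omega⟩ (pfBlock n (r + 1)) := by
  have h1 := qE (r + 1) h ⟨2 * r + 1, by omega⟩ ⟨2 * r + 1, by omega⟩ (by simp only; omega)
  rw [dlt, if_pos rfl, one_mul, WD.E_apply] at h1
  conv_lhs => rw [← h1]
  rw [← Finset.sum_neg_distrib]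
  refine Finset.sum_congr rfl fun k _ => ?_
  rw [(wS n).Ds, mul_neg]

lemma q_ne (r : ℕ) (h : 2 * (r + 1) ≤ n) (hq : pfBlock n (r + 1) ≠ 0) : pfBlock n r ≠ 0 := by
  intro h0
  apply hq
  obtain ⟨c, hc⟩ := qDD r h
  rw [h0, smul_zero] at hc
  rw [q_exp r h, Finset.sum_eq_zero, neg_zero]
  intro b _
  by_cases hb : b = ⟨2 * r, by omega⟩
  · rw [hb, hc, mul_zero]
  · have := c_rel r h b ⟨2 * r, by omega⟩ hb
    rw [hc, map_zero, dlt, if_pos rfl, one_mul] at this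
    rw [neg_eq_zero.1 this.symm, mul_zero]

lemma q_ne' (r : ℕ) (s : ℕ) : 2 * (r + s) ≤ n → pfBlock n (r + s) ≠ 0 → pfBlock n r ≠ 0 := by
  induction s with
  | zero => intro _ h; exact h
  | succ s ih => 
    intro h1 h2
    exact ih (by omega) (q_ne (r + s) h1 h2)

lemma q_incl (r : ℕ) (h : 2 * (r + 1) ≤ n) (e : ℕ) (I : Ideal (PS n))
    (hE : ∀ a b f, f ∈ I → (wS n).E a b f ∈ I) (hq : pfBlock n r ^ e ∈ I) : pfBlock n (r + 1) ^ e ∈ I := by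
  set J : Fin n := ⟨2 * r, by omega⟩ with hJ
  set l : Fin n := ⟨2 * r + 1, by omega⟩ with hl
  set q := pfBlock n (r + 1) with hqd
  obtain ⟨c0, hc0⟩ := qDD r h
  have key : ∀ L : List (Fin n), (∀ x ∈ L, x ≠ J) → ∀ k, k + L.length = e →
      (wS n).D J l q ^ k * (L.map fun x => (wS n).D x l q).prod ∈ I := by
    intro L
    induction L with
    | nil =>
      intro _ k hk
      simp only [List.length_nil, add_zero] at hk
      rw [List.map_nil, List.prod_nil, mul_one, hc0, smul_pow, hk, ← mul_one (pfBlock n r ^ e), Algebra.smul_def]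
      rw [mul_one]
      exact Ideal.mul_mem_left _ _ hq
    | cons b L ih =>
      intro hL k hk
      have hb : b ≠ J := hL b (by simp)
      have hL' : ∀ x ∈ L, x ≠ J := fun x hx => hL x (by simp [hx])
      have h1 := hE J b _ (ih hL' (k + 1) (by simp at hk; omega))
      have h2 : ∀ L : List (Fin n), (∀ x ∈ L, x ≠ J) → (wS n).E J b (L.map fun x => (wS n).D x l q).prod = 0 := by
        intro L
        induction L with
        | nil => intro _; simp
        | cons x L ih =>
          intro hx
          rw [List.map_cons, List.prod_cons, Derivation.leibniz, ih (fun y hy => hx y (by simp [hy])), c_rel r h b x hb, dlt,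
            if_neg (hx x (by simp))]
          simp
      rw [Derivation.leibniz, h2 L hL', smul_zero, zero_add, Derivation.leibniz_pow, Nat.add_sub_cancel, c_rel r h b J hb, dlt,
        if_pos rfl, one_mul, ← Nat.cast_smul_eq_nsmul ℂ] at h1
      have h3 : (wS n).D J l q ^ k * ((b :: L).map fun x => (wS n).D x l q).prod =
          algebraMap ℂ (PS n) (-(((k + 1 : ℕ) : ℂ)⁻¹)) * ((L.map fun x => (wS n).D x l q).prod • ((k + 1 : ℕ) : ℂ) • (wS n).D J l q ^ k • -((wS n).D b l q)) := by
        have hne : ((k + 1 : ℕ) : ℂ) ≠ 0 := by rw [Nat.cast_ne_zero]; omega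
        rw [← Algebra.smul_def, smul_eq_mul, smul_eq_mul, mul_smul_comm, smul_smul, neg_mul, inv_mul_cancel₀ hne, neg_one_smul,
          List.map_cons, List.prod_cons]
        ring
      rw [h3]
      exact Ideal.mul_mem_left _ _ h1
  have key2 : ∀ s, ∀ k, ∀ L : List (Fin n), (∀ x ∈ L, x ≠ J) → k + L.length + s = e →
      (wS n).D J l q ^ k * (L.map fun x => (wS n).D x l q).prod * q ^ s ∈ I := by
    intro s
    induction s with
    | zero => 
      intro k L hL hk
      rw [pow_zero, mul_one]
      exact key L hL k hk
    | succ s ih =>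
      intro k L hL hk
      have h1 : (wS n).D J l q ^ k * (L.map fun x => (wS n).D x l q).prod * q ^ (s + 1) =
          - ∑ b, (wS n).X l b * ((wS n).D J l q ^ k * (L.map fun x => (wS n).D x l q).prod * q ^ s * (wS n).D b l q) := by
        have h2 : q ^ (s + 1) = q ^ s * - ∑ k, (wS n).X l k * (wS n).D k l q := by
          rw [pow_succ]
          congr 1
          exact q_exp r h
        rw [h2, mul_neg, mul_neg, Finset.mul_sum, Finset.mul_sum]
        congr 1
        refine Finset.sum_congr rfl fun b _ => ?_
        ring
      rw [h1]
      refine neg_mem (Submodule.sum_mem _ fun b _ => Ideal.mul_mem_left _ _ ?_)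
      by_cases hb : b = J
      · have := ih (k + 1) L hL (by omega)
        rw [hb]
        convert this using 1
        ring
      · have := ih k (b :: L) (by simpa [hb] using hL) (by simp; omega)
        convert this using 1
        rw [List.map_cons, List.prod_cons]
        ring
  have := key2 e 0 [] (by simp) (by simp)
  simpa using this

lemma hw_rect (r e : ℕ) (hr : 1 ≤ r) (hr2 : 2 * r ≤ n) : hwVector n (rect r e) = pfBlock n r ^ e := by
  obtain ⟨s, rfl⟩ : ∃ s, r = s + 1 := ⟨r - 1, by omega⟩
  rw [hwVector, Finset.prod_eq_single s]
  · simp [rect]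
  · intro i _ hi
    have : rect (s + 1) e i - rect (s + 1) e (i + 1) = 0 := by
      simp only [rect]; split_ifs <;> omega
    rw [this, pow_zero]
  · intro h
    exfalso; apply h
    rw [Finset.mem_range]; omega

lemma gl_one (f : PS n) : glMap n 1 f = f := by
  have : glMap n 1 = AlgHom.id ℂ (PS n) := by
    apply MvPolynomial.algHom_ext
    intro p
    have hp : (MvPolynomial.X p : PS n) = (wS n).X p.1.1 p.1.2 := (sk_lt (fun p => (MvPolynomial.X p : PS n)) p.2).symm
    rw [hp, glMap_X]
    have := sum_four (fun a b => (wS n).X a b) p.1.1 p.1.2 p.1.1 0 0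
    simp only [zero_mul, add_zero, zero_smul] at this
    simp only [Matrix.one_apply]
    exact this
  rw [this]; rfl

lemma hw_mem (z : ℕ → ℕ) : hwVector n z ∈ invIdeal n z :=
  Ideal.subset_span ⟨1, by rw [Units.val_one, gl_one]⟩

lemma inv_le (r e : ℕ) (hr : 1 ≤ r) (h : 2 * (r + 1) ≤ n) : invIdeal n (rect (r + 1) e) ≤ invIdeal n (rect r e) := by
  rw [invIdeal, Ideal.span_le]
  rintro _ ⟨g, rfl⟩
  apply inv_gl
  rw [hw_rect (r + 1) e (by omega) h]
  apply q_incl r h e _ (fun a b f hf => inv_E _ a b f hf)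
  rw [← hw_rect r e hr (by omega)]
  exact hw_mem _

end pfblock
end Cech
end SkewLC

namespace SkewLC
namespace Cech
section assembly
open CategoryTheory
variable {n : ℕ}

lemma card_idx (n : ℕ) : Fintype.card (SkewIdx n) = n.choose 2 := by
  rw [Fintype.card_subtype, Finset.card_filter, Fintype.sum_prod_type, Finset.sum_comm]
  have h : ∀ y : Fin n, ∑ x : Fin n, (if x < y then 1 else 0) = y.1 := by
    intro y
    rw [← Finset.card_filter]
    have : (Finset.univ.filter fun x => x < y) = Finset.Iio y := by ext; simp
    rw [this, Fin.card_Iio]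
  rw [Finset.sum_congr rfl fun y _ => h y, Fin.sum_univ_eq_sum_range (fun i => i) n, Finset.sum_range_id, Nat.choose_two_right]

lemma fin_wt (w : Fin n → ℤ) : {a : SkewIdx n → ℤ | (∀ p, 0 ≤ a p) ∧ wtE (wtV n) a = w}.Finite := by
  refine (Set.finite_Icc (0 : SkewIdx n → ℤ) (fun _ => ∑ i, w i)).subset ?_
  rintro a ⟨h0, hw⟩
  refine ⟨fun p => h0 p, fun p => ?_⟩
  have h1 := wtE_sum a
  rw [hw] at h1
  have h2 : a p ≤ ∑ p, a p := Finset.single_le_sum (fun p _ => h0 p) (Finset.mem_univ p)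
  have h3 := h0 p
  change a p ≤ ∑ i, w i
  omega

lemma toL_alg_inj : Function.Injective (Algebra.linearMap (PS n) (Lau (SkewIdx n))) := fun _ _ h => toL_inj h

lemma factor_zero {R : Type} [CommRing R] {A B C D Y : ModuleCat.{0} R} (u : A ⟶ B) (r : B ⟶ C) (v : C ⟶ D) (g : A ⟶ D)
    (hg : g = u ≫ r ≫ v) (j : ℕ)
    (h : ∀ y : Abelian.Ext.{0} C Y j, (Abelian.Ext.mk₀ r).comp y (zero_add _) = 0)
    (y : Abelian.Ext.{0} D Y j) : (Abelian.Ext.mk₀ g).comp y (zero_add _) = 0 := by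
  rw [hg, ← Abelian.Ext.mk₀_comp_mk₀_assoc, ← Abelian.Ext.mk₀_comp_mk₀_assoc, h, Abelian.Ext.comp_zero]

theorem incl_ext (r e : ℕ) (hr : 1 ≤ r) (h : 2 * (r + 1) ≤ n) (he : 1 ≤ e) (hq : pfBlock n r ≠ 0)
    (j : ℕ) (hj : j + 1 ≤ n.choose 2)
    (y : Abelian.Ext.{0} (ModuleCat.of (PS n) (idL (invIdeal n (rect r e)))) (ModuleCat.of (PS n) (PS n)) (j + 1)) :
    (Abelian.Ext.mk₀ (ModuleCat.ofHom (rst (LinearMap.id : Lau (SkewIdx n) →ₗ[Lau (SkewIdx n)] Lau (SkewIdx n))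
      (idL (invIdeal n (rect (r + 1) e))) (idL (invIdeal n (rect r e))) (idL_mono (inv_le r e hr h))))).comp y (zero_add _) = 0 := by
  rw [← card_idx] at hj
  refine ext_zero (wt := wtV n) fin_wt j (Fintype.card (SkewIdx n) - (j + 1)) (by omega) _ _ (GrL (wtV n)) _ _ _ _
    (idL_graded _ fun a b f hf => inv_E _ a b f hf) ((IsNoetherian.noetherian (invIdeal n (rect (r + 1) e))).map _)
      ((IsNoetherian.noetherian (invIdeal n (rect r e))).map _) ?_ y
  refine cohZero (by omega) _ _ (inv_le r e hr h) (fun a b f hf => inv_E _ a b f hf) (fun a b f hf => inv_E _ a b f hf)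
    ((e : ℤ) + 1 - 2 * (r + 1 : ℕ)) ((e : ℤ) + 1 - 2 * r) (fun a b f hf => inv_B _ _ ?_ a b f hf)
    (fun a b f hf => inv_B _ _ ?_ a b f hf) (by push_cast; omega) (by omega) (pfBlock n r ^ e) ((hom_q r (by omega)).pow e)
    (pow_ne_zero _ hq) ?_ _ (by omega)
  · intro i j
    rw [hw_rect (r + 1) e (by omega) h]
    exact qB (r + 1) h e he i j
  · intro i j
    rw [hw_rect r e hr (by omega)]
    exact qB r (by omega) e he i j
  · rw [← hw_rect r e hr (by omega)]
    exact hw_mem _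

theorem main (m n k j e : ℕ) (hn : n = 2 * m) (hk1 : 1 ≤ k) (hk2 : k < m) (hj2 : j + 1 ≤ n.choose 2) (he : 1 ≤ e)
    (hle : NMod n (k - 1) e ≤ NMod n k e)
    (y : Abelian.Ext.{0} (ModuleCat.of (PS n) (NMod n k e)) (ModuleCat.of (PS n) (PS n)) (j + 1)) :
    (Abelian.Ext.mk₀ (ModuleCat.ofHom (Submodule.inclusion hle)
          : ModuleCat.of (PS n) ↥(NMod n (k - 1) e) ⟶ ModuleCat.of (PS n) ↥(NMod n k e))).comp y (zero_add _) = 0 := by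
  have hm2 : n / 2 = m := by omega
  by_cases hpf : pfaffian n = 0
  · have hs : Subsingleton (SPf n) := IsLocalization.subsingleton (M := Submonoid.powers (pfaffian n)) (S := SPf n) ⟨1, by simp [hpf]⟩
    have h0 : (ModuleCat.ofHom (Submodule.inclusion hle)
          : ModuleCat.of (PS n) ↥(NMod n (k - 1) e) ⟶ ModuleCat.of (PS n) ↥(NMod n k e)) = 0 := by
      ext x
      exact Subsingleton.elim _ _
    rw [h0, Abelian.Ext.mk₀_zero, Abelian.Ext.zero_comp]
  · obtain ⟨r, hr⟩ : ∃ r, m = r + k := ⟨m - k, by omega⟩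
    have hr1 : 1 ≤ r := by omega
    have hz : n / 2 - k = r := by omega
    have hz' : n / 2 - (k - 1) = r + 1 := by omega
    have hq : pfBlock n r ≠ 0 := by
      apply q_ne' r k (by omega)
      rw [← hr, ← hm2]; exact hpf
    have hinj : Function.Injective (algebraMap (PS n) (SPf n)) :=
      IsLocalization.injective (SPf n) (powers_le_nonZeroDivisors_of_noZeroDivisors hpf)
    have hinv : algebraMap (PS n) (SPf n) (pfaffian n) * pfInv n = 1 := IsLocalization.Away.mul_invSelf _
    have hmap : ∀ s : ℕ, Function.Injective ((LinearMap.mulLeft (PS n) (pfInv n ^ s)).comp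
      (Algebra.linearMap (PS n) (SPf n))) := by
      intro s a b hab
      simp only [LinearMap.comp_apply, LinearMap.mulLeft_apply, Algebra.linearMap_apply] at hab
      apply hinj
      have h1 := congrArg (fun x => algebraMap (PS n) (SPf n) (pfaffian n) ^ s * x) hab
      simp only [← mul_assoc, ← mul_pow, hinv, one_pow, one_mul] at h1
      exact h1
    have hI : ∀ f ∈ invIdeal n (rect r e), pfInv n ^ (e + 2 * k) * algebraMap (PS n) (SPf n) (pfaffian n ^ 2 * f) ∈ NMod n k e := by
      intro f hf
      rw [NMod, hz]
      exact ⟨_, Ideal.mul_mem_left _ (pfaffian n ^ 2) hf, rfl⟩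
    let β : invIdeal n (rect r e) ≃ₗ[PS n] idL (invIdeal n (rect r e)) := Submodule.equivMapOfInjective (Algebra.linearMap (PS n) (Lau (SkewIdx n))) toL_alg_inj (invIdeal n (rect r e))
    let β' : invIdeal n (rect (r + 1) e) ≃ₗ[PS n] idL (invIdeal n (rect (r + 1) e)) := Submodule.equivMapOfInjective (Algebra.linearMap (PS n) (Lau (SkewIdx n))) toL_alg_inj (invIdeal n (rect (r + 1) e))
    let α' : invIdeal n (rect (n / 2 - (k - 1)) e) ≃ₗ[PS n] NMod n (k - 1) e := Submodule.equivMapOfInjective _ (hmap (e + 2 * (k - 1))) (invIdeal n (rect (n / 2 - (k - 1)) e))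
    have hc : invIdeal n (rect (n / 2 - (k - 1)) e) ≤ invIdeal n (rect (r + 1) e) := by rw [hz']
    let u : NMod n (k - 1) e →ₗ[PS n] idL (invIdeal n (rect (r + 1) e)) :=
      β'.toLinearMap ∘ₗ Submodule.inclusion hc ∘ₗ α'.symm.toLinearMap
    let v0 : invIdeal n (rect r e) →ₗ[PS n] NMod n k e :=
      LinearMap.codRestrict _ ((LinearMap.mulLeft (PS n) (pfInv n ^ (e + 2 * k))).comp ((Algebra.linearMap (PS n) (SPf n)).comp
        ((LinearMap.mulLeft (PS n) (pfaffian n ^ 2)).comp (invIdeal n (rect r e)).subtype))) (fun f => hI f.1 f.2)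
    let v : idL (invIdeal n (rect r e)) →ₗ[PS n] NMod n k e := v0 ∘ₗ β.symm.toLinearMap
    have hα : ∀ f, (α' f : SPf n) = pfInv n ^ (e + 2 * (k - 1)) * algebraMap (PS n) (SPf n) f.1 := fun f => rfl
    have hv0 : ∀ f, (v0 f : SPf n) = pfInv n ^ (e + 2 * k) * algebraMap (PS n) (SPf n) (pfaffian n ^ 2 * f.1) := fun f => rfl
    have hu : ∀ f, u (α' f) = β' ⟨f.1, hc f.2⟩ := by
      intro f
      change β' (Submodule.inclusion hc (α'.symm (α' f))) = _
      rw [LinearEquiv.symm_apply_apply]; rfl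
    have hv : ∀ f, v (β f) = v0 f := by
      intro f
      change v0 (β.symm (β f)) = _
      rw [LinearEquiv.symm_apply_apply]
    have hr' : ∀ f, rst (LinearMap.id : Lau (SkewIdx n) →ₗ[Lau (SkewIdx n)] Lau (SkewIdx n))
      (idL (invIdeal n (rect (r + 1) e))) (idL (invIdeal n (rect r e))) (idL_mono (inv_le r e hr1 (by omega))) (β' f) =
        β ⟨f.1, inv_le r e hr1 (by omega) f.2⟩ := fun f => rfl
    clear_value u v v0 α' β β'
    have hlin : Submodule.inclusion hle = v ∘ₗ (rst (LinearMap.id : Lau (SkewIdx n) →ₗ[Lau (SkewIdx n)] Lau (SkewIdx n))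
      (idL (invIdeal n (rect (r + 1) e))) (idL (invIdeal n (rect r e))) (idL_mono (inv_le r e hr1 (by omega)))) ∘ₗ u := by
      apply LinearMap.ext
      intro x
      obtain ⟨f, rfl⟩ := α'.surjective x
      rw [LinearMap.comp_apply, LinearMap.comp_apply, hu, hr', hv]
      apply Subtype.ext
      rw [hv0, Submodule.coe_inclusion, hα]
      have h2 : pfInv n ^ 2 * algebraMap (PS n) (SPf n) (pfaffian n) ^ 2 = 1 := by
        rw [← mul_pow, mul_comm, hinv, one_pow]
      have h3 : e + 2 * k = (e + 2 * (k - 1)) + 2 := by omega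
      have h4 : pfInv n ^ (e + 2 * k) = pfInv n ^ (e + 2 * (k - 1)) * pfInv n ^ 2 := by rw [h3, pow_add]
      rw [map_mul, map_pow, h4]
      linear_combination (-(pfInv n ^ (e + 2 * (k - 1)) * algebraMap (PS n) (SPf n) f.1)) * h2
    refine factor_zero (ModuleCat.ofHom u) _ (ModuleCat.ofHom v) _ ?_ _ (incl_ext r e hr1 (by omega) he hq j hj2) y
    rw [hlin, ModuleCat.ofHom_comp, ModuleCat.ofHom_comp, Category.assoc]

end assembly
end Cech

end SkewLC

namespace SkewLC

open CategoryTheory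

/-- Let `n = 2m` be even, `1 ≤ k ≤ m-1`, and
`1 ≤ j ≤ binom(n,2)`.  For every `e ≥ 1`, the morphism
`Ext^j_S(𝒩_{k,e}, S) → Ext^j_S(𝒩_{k-1,e}, S)` induced (contravariantly) by
the inclusion `𝒩_{k-1,e} ⊆ 𝒩_{k,e}` is the zero map.  Here
`𝒩_{k,e} = I_{(m-k)×e} ⊗_S 𝒫_{-e-2k} ⊆ S_Pf` (`NMod n k e`), and the
(true) inclusion `𝒩_{k-1,e} ≤ 𝒩_{k,e}` is supplied as the hypothesis
`hle`. -/
theorem ext_NMod_map_eq_zero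
    (m : ℕ) (hm : 1 ≤ m) (n : ℕ) (hn : n = 2 * m)
    (k : ℕ) (hk1 : 1 ≤ k) (hk2 : k < m)
    (j : ℕ) (hj1 : 1 ≤ j) (hj2 : j ≤ n.choose 2)
    (e : ℕ) (he : 1 ≤ e) (hle : NMod n (k - 1) e ≤ NMod n k e) :
    (((Ext (PS n) (ModuleCat (PS n)) j).map
        ((ModuleCat.ofHom (Submodule.inclusion hle)
          : ModuleCat.of (PS n) ↥(NMod n (k - 1) e) ⟶
            ModuleCat.of (PS n) ↥(NMod n k e))).op).app
      (ModuleCat.of (PS n) (PS n))) = 0 := by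
  obtain ⟨j, rfl⟩ : ∃ i, j = i + 1 := ⟨j - 1, by omega⟩
  exact Cech.bridge _ j fun y => Cech.main m n k j e hn hk1 hk2 hj2 he hle y

end SkewLC
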